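/- Let α be a real algebraic number of degree at least three, and let (a_ℓ)_{ℓ≥1} be the sequence of partial quotients of its continued fraction expansion. Then the sequence (a_ℓ)_{ℓ≥1} cannot be generated by a recurrent morphism; that is, there do not exist a finite alphabet A, a prolongable morphism σ on A with fixed point a in which every occurring letter occurs at least twice, and a coding φ such that (a_ℓ)_{ℓ≥1} = φ(a). -/

import Mathlib

open Filter Topology

/-- The `n`-th iterate of the morphism `σ` (given by its action on letters and
extended to the free monoid by concatenation) applied to the word `W`. -/
def iterM {A : Type*} (σ : A → List A) (n : ℕ) (W : List A) : List A :=
  (fun L => L.flatMap σ)^[n] W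

/-- The morphism `σ` is prolongable on the letter `l`: `σ l = l W` for a word `W`
such that `σ^n(W)` is non-empty for every `n ≥ 0`. -/
def Prolongable {A : Type*} (σ : A → List A) (l : A) : Prop :=
  ∃ W : List A, σ l = l :: W ∧ ∀ n : ℕ, iterM σ n W ≠ []

/-- The infinite word `x` is the fixed point of the prolongable morphism `σ`
starting from the letter `l`: every word `σ^n(l)` is a prefix of `x`. -/
def IsFixedPointSeq {A : Type*} (σ : A → List A) (l : A) (x : ℕ → A) : Prop :=
  ∀ n i, i < (iterM σ n [l]).length → (iterM σ n [l])[i]? = some (x i)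

/-- Numerators of the convergents of `[a_0; a_1, a_2, …]` where `a i` denotes the
partial quotient `a_{i+1}`: `p_0 = a_0`, `p_1 = a_1 a_0 + 1`, `p_{ℓ+1} = a_{ℓ+1} p_ℓ + p_{ℓ-1}`. -/
def cvP (a0 : ℤ) (a : ℕ → ℕ) : ℕ → ℤ
  | 0 => a0
  | 1 => (a 0 : ℤ) * a0 + 1
  | n + 2 => (a (n + 1) : ℤ) * cvP a0 a (n + 1) + cvP a0 a n

/-- Denominators of the convergents of `[a_0; a_1, a_2, …]`:
`q_0 = 1`, `q_1 = a_1`, `q_{ℓ+1} = a_{ℓ+1} q_ℓ + q_{ℓ-1}`. -/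
def cvQ (a : ℕ → ℕ) : ℕ → ℤ
  | 0 => 1
  | 1 => (a 0 : ℤ)
  | n + 2 => (a (n + 1) : ℤ) * cvQ a (n + 1) + cvQ a n

set_option linter.all false

namespace RothAux
open MvPolynomial

/-- Hasse derivative -/
noncomputable def hD {ι : Type*} [Fintype ι] {R : Type*} [CommRing R] (μ : ι →₀ ℕ) :
    MvPolynomial ι R →ₗ[R] MvPolynomial ι R :=
  (basisMonomials ι R).constr R fun d => monomial (d - μ) ((∏ i, (d i).choose (μ i) : ℕ) : R)

section
variable {ι : Type*} [Fintype ι] {R : Type*} [CommRing R]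

lemma hD_monomial (μ d : ι →₀ ℕ) (c : R) :
    hD μ (monomial d c) = monomial (d - μ) (c * ((∏ i, (d i).choose (μ i) : ℕ) : R)) := by
  have h1 : (monomial d c : MvPolynomial ι R) = c • (basisMonomials ι R d) := by
    simp [smul_monomial]
  rw [h1, map_smul, hD, Module.Basis.constr_basis, smul_monomial]
  simp

lemma coeff_hD (μ e : ι →₀ ℕ) (P : MvPolynomial ι R) :
    coeff e (hD μ P) = ((∏ i, (e i + μ i).choose (μ i) : ℕ) : R) * coeff (e + μ) P := by
  classical
  induction P using MvPolynomial.induction_on' with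
  | add p q hp hq => rw [map_add, coeff_add, hp, hq, coeff_add]; ring
  | monomial d c =>
    rw [hD_monomial, coeff_monomial, coeff_monomial]
    by_cases h : d = e + μ
    · subst h; simp [mul_comm]
    · rw [if_neg h, mul_zero]
      split_ifs with h2
      · have : ∃ i, d i < μ i := by
          by_contra hcon
          push Not at hcon
          apply h
          ext i
          have := DFunLike.congr_fun h2 i
          simp at this
          have := hcon i
          simp; omega
        obtain ⟨i, hi⟩ := this
        rw [Finset.prod_eq_zero (Finset.mem_univ i) (Nat.choose_eq_zero_of_lt hi)]
        simp
      · rfl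

lemma coeff_pd (i : ι) (e : ι →₀ ℕ) (P : MvPolynomial ι R) :
    coeff e (pderiv i P) = ((e i + 1 : ℕ) : R) * coeff (e + Finsupp.single i 1) P := by
  classical
  induction P using MvPolynomial.induction_on' with
  | add p q hp hq => rw [map_add, coeff_add, hp, hq, coeff_add]; ring
  | monomial d c =>
    rw [pderiv_monomial, coeff_monomial, coeff_monomial]
    by_cases h : d = e + Finsupp.single i 1
    · subst h; simp [mul_comm]
    · rw [if_neg h, mul_zero]
      split_ifs with h2
      · have : d i = 0 := by
          by_contra hcon
          apply h
          ext j
          have := DFunLike.congr_fun h2 j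
          by_cases hj : i = j
          · subst hj; simp at this ⊢; omega
          · simp [Finsupp.single_apply, hj] at this ⊢; omega
        simp [this]
      · rfl

lemma pderiv_hD (i : ι) (μ : ι →₀ ℕ) (P : MvPolynomial ι R) :
    pderiv i (hD μ P) = ((μ i + 1 : ℕ) : R) • hD (μ + Finsupp.single i 1) P := by
  classical
  ext e
  rw [coeff_pd, coeff_smul, coeff_hD, coeff_hD, smul_eq_mul, ← mul_assoc, ← mul_assoc]
  have : e + Finsupp.single i 1 + μ = e + (μ + Finsupp.single i 1) := by abel
  rw [this]
  congr 1
  rw [← Nat.cast_mul, ← Nat.cast_mul]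
  congr 1
  rw [← Finset.mul_prod_erase _ _ (Finset.mem_univ i), ← Finset.mul_prod_erase _ _ (Finset.mem_univ i)]
  have h2 : ∏ x ∈ Finset.univ.erase i, ((e + Finsupp.single i 1 : ι →₀ ℕ) x + μ x).choose (μ x)
      = ∏ x ∈ Finset.univ.erase i, (e x + (μ + Finsupp.single i 1 : ι →₀ ℕ) x).choose ((μ + Finsupp.single i 1 : ι →₀ ℕ) x) := by
    apply Finset.prod_congr rfl
    intro x hx
    have : i ≠ x := (Finset.ne_of_mem_erase hx).symm
    simp [Finsupp.single_apply, this]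
  rw [h2, ← mul_assoc, ← mul_assoc]
  congr 1
  simp
  have := Nat.add_one_mul_choose_eq (e i + μ i) (μ i)
  have h3 := Nat.choose_mul_succ_eq (e i + μ i) (μ i)
  have e1 : e i + μ i + 1 - μ i = e i + 1 := by omega
  rw [e1] at h3
  have e2 : e i + 1 + μ i = e i + μ i + 1 := by ring
  have e3 : e i + (μ i + 1) = e i + μ i + 1 := by ring
  rw [e2, e3]
  nlinarith

lemma hD_zero (P : MvPolynomial ι R) : hD 0 P = P := by
  ext e; rw [coeff_hD]; simp

/-- Taylor shift -/
noncomputable def tsh (ξ : ι → R) : MvPolynomial ι R →ₐ[R] MvPolynomial ι R :=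
  aeval fun i => X i + C (ξ i)

lemma tsh_pderiv (ξ : ι → R) (i : ι) (P : MvPolynomial ι R) :
    tsh ξ (pderiv i P) = pderiv i (tsh ξ P) := by
  classical
  induction P using MvPolynomial.induction_on with
  | C a => simp [tsh]
  | add p q hp hq => simp only [map_add, hp, hq]
  | mul_X p j hp =>
    rw [Derivation.leibniz, map_add, map_mul, Derivation.leibniz, smul_eq_mul, smul_eq_mul,
      map_mul, smul_eq_mul, map_mul, hp, smul_eq_mul]
    congr 2
    · simp [tsh, pderiv_X, Pi.single_apply]

lemma exists_decomp (μ : ι →₀ ℕ) (h : μ ≠ 0) : ∃ (i : ι) (ν : ι →₀ ℕ), μ = ν + Finsupp.single i 1 := by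
  classical
  obtain ⟨i, hi⟩ := Finsupp.ne_iff.1 h
  refine ⟨i, μ - Finsupp.single i 1, ?_⟩
  ext j
  by_cases hj : i = j
  · subst hj; simp at hi ⊢; omega
  · simp [Finsupp.single_apply, hj]

lemma tsh_hD [IsDomain R] [CharZero R] (ξ : ι → R) (μ : ι →₀ ℕ) (P : MvPolynomial ι R) :
    tsh ξ (hD μ P) = hD μ (tsh ξ P) := by
  classical
  have key : ∀ n : ℕ, ∀ μ : ι →₀ ℕ, ∑ i, μ i = n → tsh ξ (hD μ P) = hD μ (tsh ξ P) := by
    intro n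
    induction n with
    | zero =>
      intro μ h
      have : μ = 0 := by
        ext i
        simp at h
        simp [h i]
      subst this
      rw [hD_zero, hD_zero]
    | succ n ih =>
      intro μ h
      have h0 : μ ≠ 0 := by rintro rfl; simp at h
      obtain ⟨i, ν, rfl⟩ := exists_decomp μ h0
      have h1 : ∑ i, ν i = n := by
        simp [Finset.sum_add_distrib, Finsupp.single_apply] at h
        exact h
      have h2 := pderiv_hD i ν P
      have h3 := pderiv_hD i ν (tsh ξ P)
      rw [← ih ν h1, ← tsh_pderiv, h2, map_smul] at h3
      have h4 : ((ν i + 1 : ℕ) : R) ≠ 0 := Nat.cast_ne_zero.2 (Nat.succ_ne_zero (ν i))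
      exact smul_right_injective (MvPolynomial ι R) h4 h3
  exact key _ μ rfl

lemma coeff_zero_tsh (ξ : ι → R) (P : MvPolynomial ι R) : coeff 0 (tsh ξ P) = eval ξ P := by
  have : (constantCoeff : MvPolynomial ι R →+* R).comp (tsh ξ : MvPolynomial ι R →ₐ[R] _).toRingHom = eval ξ := by
    apply MvPolynomial.ringHom_ext
    · intro r; simp [tsh]
    · intro i; simp [tsh]
  exact DFunLike.congr_fun this P

lemma coeff_tsh [IsDomain R] [CharZero R] (ξ : ι → R) (μ : ι →₀ ℕ) (P : MvPolynomial ι R) :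
    coeff μ (tsh ξ P) = eval ξ (hD μ P) := by
  rw [← coeff_zero_tsh, tsh_hD, coeff_hD]
  simp

end

/-! l1 norm -/
section
variable {ι : Type*} 

noncomputable def l1 (P : MvPolynomial ι ℝ) : ℝ := ∑ d ∈ P.support, |coeff d P|

lemma l1_eq (P : MvPolynomial ι ℝ) (s : Finset (ι →₀ ℕ)) (h : P.support ⊆ s) :
    l1 P = ∑ d ∈ s, |coeff d P| := by
  apply Finset.sum_subset h
  intro x _ hx
  simpa using hx

lemma l1_nonneg (P : MvPolynomial ι ℝ) : 0 ≤ l1 P := Finset.sum_nonneg fun _ _ => abs_nonneg _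

lemma coeff_le_l1 (P : MvPolynomial ι ℝ) (d : ι →₀ ℕ) : |coeff d P| ≤ l1 P := by
  by_cases h : d ∈ P.support
  · exact Finset.single_le_sum (f := fun d => |coeff d P|) (fun _ _ => abs_nonneg _) h
  · rw [notMem_support_iff.1 h, abs_zero]; exact l1_nonneg P

@[simp] lemma l1_zero : l1 (0 : MvPolynomial ι ℝ) = 0 := by simp [l1]

lemma l1_add_le (P Q : MvPolynomial ι ℝ) : l1 (P + Q) ≤ l1 P + l1 Q := by
  classical
  rw [l1_eq (P + Q) (P.support ∪ Q.support) MvPolynomial.support_add,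
    l1_eq P (P.support ∪ Q.support) Finset.subset_union_left,
    l1_eq Q (P.support ∪ Q.support) Finset.subset_union_right, ← Finset.sum_add_distrib]
  apply Finset.sum_le_sum
  intro d _
  rw [coeff_add]
  exact abs_add_le _ _

lemma l1_sum_le {κ : Type*} (s : Finset κ) (f : κ → MvPolynomial ι ℝ) :
    l1 (∑ k ∈ s, f k) ≤ ∑ k ∈ s, l1 (f k) := by
  classical
  induction s using Finset.induction_on with
  | empty => simp
  | insert a s ha ih =>
    rw [Finset.sum_insert ha, Finset.sum_insert ha]
    linarith [l1_add_le (f a) (∑ k ∈ s, f k)]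

lemma l1_monomial (d : ι →₀ ℕ) (c : ℝ) : l1 (monomial d c) = |c| := by
  classical
  rw [l1_eq (monomial d c) {d} support_monomial_subset]
  simp

lemma l1_C (c : ℝ) : l1 (C c : MvPolynomial ι ℝ) = |c| := l1_monomial 0 c
lemma l1_X (i : ι) : l1 (X i : MvPolynomial ι ℝ) = 1 := by
  rw [X, l1_monomial]; simp
lemma l1_one : l1 (1 : MvPolynomial ι ℝ) = 1 := by
  have := l1_C (ι := ι) 1; simpa using this

lemma l1_monomial_mul (d : ι →₀ ℕ) (c : ℝ) (Q : MvPolynomial ι ℝ) :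
    l1 (monomial d c * Q) ≤ |c| * l1 Q := by
  conv_lhs => rw [Q.as_sum, Finset.mul_sum]
  refine (l1_sum_le _ _).trans ?_
  rw [l1, Finset.mul_sum]
  apply Finset.sum_le_sum
  intro e _
  rw [monomial_mul, l1_monomial, abs_mul]

lemma l1_mul_le (P Q : MvPolynomial ι ℝ) : l1 (P * Q) ≤ l1 P * l1 Q := by
  conv_lhs => rw [P.as_sum, Finset.sum_mul]
  refine (l1_sum_le _ _).trans ?_
  rw [l1, Finset.sum_mul]
  apply Finset.sum_le_sum
  intro e _
  exact l1_monomial_mul _ _ _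

lemma l1_smul (c : ℝ) (P : MvPolynomial ι ℝ) : l1 (c • P) ≤ |c| * l1 P := by
  rw [smul_eq_C_mul, ← l1_C (ι := ι)]; exact l1_mul_le _ _

lemma l1_neg (P : MvPolynomial ι ℝ) : l1 (-P) ≤ l1 P := by
  have := l1_smul (-1) P
  simpa using this

lemma l1_pow_le (P : MvPolynomial ι ℝ) (n : ℕ) : l1 (P ^ n) ≤ l1 P ^ n := by
  induction n with
  | zero => simp [l1_one]
  | succ n ih =>
    rw [pow_succ, pow_succ]
    exact (l1_mul_le _ _).trans (mul_le_mul_of_nonneg_right ih (l1_nonneg _))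

lemma l1_prod_le {κ : Type*} (s : Finset κ) (f : κ → MvPolynomial ι ℝ) :
    l1 (∏ k ∈ s, f k) ≤ ∏ k ∈ s, l1 (f k) := by
  classical
  induction s using Finset.induction_on with
  | empty => simp [l1_one]
  | insert a s ha ih =>
    rw [Finset.prod_insert ha, Finset.prod_insert ha]
    exact (l1_mul_le _ _).trans (mul_le_mul_of_nonneg_left ih (l1_nonneg _))

/-- integer polynomial norm -/
noncomputable def L (P : MvPolynomial ι ℤ) : ℝ := l1 (map (Int.castRingHom ℝ) P)

lemma L_nonneg (P : MvPolynomial ι ℤ) : 0 ≤ L P := l1_nonneg _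
lemma L_mul_le (P Q : MvPolynomial ι ℤ) : L (P * Q) ≤ L P * L Q := by
  rw [L, map_mul]; exact l1_mul_le _ _
lemma L_add_le (P Q : MvPolynomial ι ℤ) : L (P + Q) ≤ L P + L Q := by
  rw [L, map_add]; exact l1_add_le _ _
lemma L_sum_le {κ : Type*} (s : Finset κ) (f : κ → MvPolynomial ι ℤ) :
    L (∑ k ∈ s, f k) ≤ ∑ k ∈ s, L (f k) := by
  rw [L, map_sum]; exact l1_sum_le _ _
lemma L_prod_le {κ : Type*} (s : Finset κ) (f : κ → MvPolynomial ι ℤ) :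
    L (∏ k ∈ s, f k) ≤ ∏ k ∈ s, L (f k) := by
  rw [L, map_prod]; exact l1_prod_le _ _
lemma coeff_le_L (P : MvPolynomial ι ℤ) (d : ι →₀ ℕ) : |((coeff d P : ℤ) : ℝ)| ≤ L P := by
  have := coeff_le_l1 (map (Int.castRingHom ℝ) P) d
  simpa [coeff_map, L] using this
lemma L_eq (P : MvPolynomial ι ℤ) : L P = ∑ d ∈ P.support, |((coeff d P : ℤ) : ℝ)| := by
  rw [L, l1_eq _ P.support (support_map_subset _ _)]
  simp [coeff_map]
lemma one_le_L (P : MvPolynomial ι ℤ) (h : P ≠ 0) : 1 ≤ L P := by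
  obtain ⟨d, hd⟩ := MvPolynomial.ne_zero_iff.1 h
  refine le_trans ?_ (coeff_le_L P d)
  exact_mod_cast Int.one_le_abs hd
lemma eq_zero_of_L (P : MvPolynomial ι ℤ) (h : L P < 1) : P = 0 := by
  by_contra hc; linarith [one_le_L P hc]

lemma L_hD [Fintype ι] (μ : ι →₀ ℕ) (P : MvPolynomial ι ℤ) (r : ι → ℕ)
    (hP : ∀ d ∈ P.support, ∀ i, d i ≤ r i) : L (hD μ P) ≤ 2 ^ (∑ i, r i) * L P := by
  classical
  have : hD μ P = ∑ d ∈ P.support, hD μ (monomial d (coeff d P)) := by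
    conv_lhs => rw [P.as_sum, map_sum]
  rw [this]
  refine (L_sum_le _ _).trans ?_
  rw [L_eq, Finset.mul_sum]
  apply Finset.sum_le_sum
  intro d hd
  rw [hD_monomial, L, map_monomial, l1_monomial]
  simp only [eq_intCast, Int.cast_mul, abs_mul, Int.cast_natCast, Nat.abs_cast]
  rw [mul_comm]
  apply mul_le_mul_of_nonneg_right _ (abs_nonneg _)
  have : (∏ i, (d i).choose (μ i)) ≤ 2 ^ (∑ i, r i) := by
    rw [← Finset.prod_pow_eq_pow_sum]
    apply Finset.prod_le_prod' 
    intro i _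
    exact (Nat.choose_le_two_pow _ _).trans (Nat.pow_le_pow_right (by norm_num) (hP d hd i))
  exact_mod_cast this

end
end RothAux

set_option linter.all false

namespace RothAux
open MvPolynomial

section wronskian
variable {ι : Type*} [Fintype ι]

lemma hD_stable {n : ℕ} (T : Set (Fin n → MvPolynomial ι ℚ))
    (hT : ∀ c ∈ T, ∀ i, (fun q => pderiv i (c q)) ∈ T)
    (hs : ∀ c ∈ T, ∀ r : ℚ, (fun q => r • c q) ∈ T)
    (c : Fin n → MvPolynomial ι ℚ) (hc : c ∈ T) :
    ∀ (k : ℕ) (μ : ι →₀ ℕ), ∑ i, μ i = k → (fun q => hD μ (c q)) ∈ T := by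
  classical
  intro k
  induction k with
  | zero =>
    intro μ h
    have : μ = 0 := by
      ext i
      simp at h
      simp [h i]
    subst this
    simp only [hD_zero]; exact hc
  | succ n ih =>
    intro μ h
    have h0 : μ ≠ 0 := by rintro rfl; simp at h
    obtain ⟨i, ν, rfl⟩ := exists_decomp μ h0
    have h1 : ∑ i, ν i = n := by
      simp [Finset.sum_add_distrib, Finsupp.single_apply] at h
      exact h
    have h2 := hs _ (hT _ (ih ν h1) i) (((ν i + 1 : ℕ) : ℚ)⁻¹)
    have h4 : ((ν i + 1 : ℕ) : ℚ) ≠ 0 := Nat.cast_ne_zero.2 (Nat.succ_ne_zero (ν i))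
    convert h2 using 2 with q
    rw [pderiv_hD, smul_smul, inv_mul_cancel₀ h4, one_smul]

lemma stable_const {n : ℕ} (T : Set (Fin n → MvPolynomial ι ℚ))
    (hT : ∀ c ∈ T, ∀ i, (fun q => pderiv i (c q)) ∈ T)
    (hs : ∀ c ∈ T, ∀ r : ℚ, (fun q => r • c q) ∈ T)
    (c : Fin n → MvPolynomial ι ℚ) (hc : c ∈ T) (h0 : c ≠ 0) :
    ∃ v : Fin n → ℚ, v ≠ 0 ∧ (fun q => C (v q)) ∈ T := by
  classical
  obtain ⟨q0, hq0⟩ := Function.ne_iff.1 h0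
  obtain ⟨d0, hd0⟩ := MvPolynomial.ne_zero_iff.1 hq0
  let S := Finset.univ.biUnion fun q => (c q).support
  have hS : S.Nonempty := ⟨d0, by simp only [S, Finset.mem_biUnion]; exact ⟨q0, Finset.mem_univ _, by simpa using hd0⟩⟩
  obtain ⟨d, hd, hmax⟩ := S.exists_max_image (fun d => ∑ i, d i) hS
  simp only [S, Finset.mem_biUnion, Finset.mem_univ, true_and] at hd hmax
  obtain ⟨q1, hq1⟩ := hd
  refine ⟨fun q => coeff d (c q), ?_, ?_⟩
  · intro h
    have := congrFun h q1
    simp at hq1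
    exact hq1 this
  · have := hD_stable T hT hs c hc _ d rfl
    convert this using 2 with q
    ext e
    rw [coeff_hD, coeff_C]
    split_ifs with he
    · subst he; simp
    · have : coeff (e + d) (c q) = 0 := by
        by_contra hcon
        have h1 := hmax (e + d) ⟨q, by simpa using hcon⟩
        simp [Finset.sum_add_distrib] at h1
        apply he
        ext i
        simp [h1 i]
      rw [this, mul_zero]

lemma wronskian {n : ℕ} (f : Fin n → MvPolynomial ι ℚ) (hf : LinearIndependent ℚ f) :
    ∃ μ : Fin n → (ι →₀ ℕ), (∀ p, ∑ i, μ p i < n) ∧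
      Matrix.det (Matrix.of fun p q => hD (μ p) (f q)) ≠ 0 := by
  classical
  let R := MvPolynomial ι ℚ
  let F := FractionRing R
  let v : (ι →₀ ℕ) → Fin n → F := fun μ q => algebraMap R F (hD μ (f q))
  let S : ℕ → Submodule F (Fin n → F) := fun k => Submodule.span F (v '' {μ | ∑ i, μ i < k})
  have Smono : ∀ k, S k ≤ S (k+1) := fun k => Submodule.span_mono (Set.image_mono fun μ (h : _ < k) => h.trans (Nat.lt_succ_self k))
  by_cases htop : S n = ⊤
  · -- choose basis
    obtain ⟨b, hb1, hb2, hb3⟩ := exists_linearIndependent F (v '' {μ | ∑ i, μ i < n})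
    have hspan : Submodule.span F b = ⊤ := hb2.trans htop
    let B := Module.Basis.mk hb3 (by simp [hspan])
    haveI : Fintype b := FiniteDimensional.fintypeBasisIndex B
    have hcard : Fintype.card b = n := by
      have := Module.finrank_eq_card_basis B
      simpa using this.symm
    let e : Fin n ≃ b := (Fintype.equivFinOfCardEq hcard).symm
    have hμ : ∀ p : Fin n, ∃ μ : ι →₀ ℕ, ∑ i, μ i < n ∧ v μ = (e p : Fin n → F) := by
      intro p
      obtain ⟨μ, h1, h2⟩ := hb1 (e p).2
      exact ⟨μ, h1, h2⟩
    choose μ h1 h2 using hμ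
    refine ⟨μ, h1, ?_⟩
    intro hdet
    have hli : LinearIndependent F (fun p : Fin n => v (μ p)) := by
      have : (fun p : Fin n => v (μ p)) = (fun x : b => (x : Fin n → F)) ∘ e := by
        funext p; exact h2 p
      rw [this]
      exact hb3.comp _ e.injective
    have hu := Matrix.linearIndependent_rows_iff_isUnit (A := Matrix.of fun p => v (μ p)) |>.1 hli
    rw [Matrix.isUnit_iff_isUnit_det, isUnit_iff_ne_zero] at hu
    apply hu
    have : (Matrix.of fun p => v (μ p)) = (algebraMap R F).mapMatrix (Matrix.of fun p q => hD (μ p) (f q)) := by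
      ext p q; rfl
    rw [this, ← RingHom.map_det, hdet, map_zero]
  · exfalso
    have hex : ∃ k < n, S k = S (k+1) := by
      by_contra hcon
      push Not at hcon
      have : ∀ k ≤ n, k ≤ Module.finrank F (S k) := by
        intro k
        induction k with
        | zero => intro _; omega
        | succ k ih =>
          intro hk
          have h1 := ih (by omega)
          have h2 : S k < S (k+1) := lt_of_le_of_ne (Smono k) (hcon k (by omega))
          have := Submodule.finrank_lt_finrank_of_lt h2
          omega
      apply htop
      apply Submodule.eq_top_of_finrank_eq
      have h1 := this n le_rfl
      have h2 := Submodule.finrank_le (S n)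
      simp at h2 ⊢
      omega
    obtain ⟨k, hk, hSk⟩ := hex
    have hne : S k ≠ ⊤ := by
      intro h
      apply htop
      have : Monotone S := monotone_nat_of_le_succ Smono
      exact top_le_iff.1 (h ▸ this hk.le)
    obtain ⟨φ, hφ0, hφ⟩ := Submodule.exists_le_ker_of_lt_top (S k) (lt_top_iff_ne_top.2 hne)
    -- coefficients
    let a : Fin n → F := fun q => φ (Pi.single q 1)
    have hφa : ∀ w : Fin n → F, φ w = ∑ q, w q * a q := by
      intro w
      conv_lhs => rw [pi_eq_sum_univ' w, map_sum]
      apply Finset.sum_congr rfl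
      intro q _
      rw [map_smul, smul_eq_mul]
    have ha0 : a ≠ 0 := by
      intro h
      apply hφ0
      ext w
      simp [a] at h
      have := congrFun h w
      simpa using this
    obtain ⟨b, hb⟩ := IsLocalization.exist_integer_multiples_of_finite (nonZeroDivisors R) a
    choose c hc using hb
    have hb0 : (algebraMap R F) b ≠ 0 := by
      intro h
      have := (map_eq_zero_iff _ (IsFractionRing.injective R F)).1 h
      exact nonZeroDivisors.ne_zero b.2 this
    have hca : ∀ q, algebraMap R F (c q) = algebraMap R F b * a q := by
      intro q; rw [hc q, Algebra.smul_def]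
    let T : Set (Fin n → MvPolynomial ι ℚ) := {c | ∀ μ : ι →₀ ℕ, ∑ i, μ i < k → ∑ q, c q * hD μ (f q) = 0}
    let T' : Set (Fin n → MvPolynomial ι ℚ) := {c | ∀ μ : ι →₀ ℕ, ∑ i, μ i < k + 1 → ∑ q, c q * hD μ (f q) = 0}
    have hTT : ∀ c ∈ T, c ∈ T' := by
      intro c hc μ hμ
      let ψ : (Fin n → F) →ₗ[F] F := ∑ q, (algebraMap R F (c q)) • LinearMap.proj q
      have hψ : ∀ μ, ψ (v μ) = algebraMap R F (∑ q, c q * hD μ (f q)) := by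
        intro μ; simp [ψ, v, map_sum, LinearMap.sum_apply, Algebra.smul_def]
      have h1 : S k ≤ LinearMap.ker ψ := by
        apply Submodule.span_le.2
        rintro _ ⟨μ, hμ, rfl⟩
        show ψ (v μ) = 0
        rw [hψ, hc μ hμ, map_zero]
      have h2 : v μ ∈ S (k+1) := Submodule.subset_span ⟨μ, hμ, rfl⟩
      rw [← hSk] at h2
      have h3 : ψ (v μ) = 0 := h1 h2
      rw [hψ] at h3
      exact (map_eq_zero_iff _ (IsFractionRing.injective R F)).1 h3
    have hcT : c ∈ T := by
      intro μ hμ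
      apply IsFractionRing.injective R F
      have h1 : φ (v μ) = 0 := hφ (Submodule.subset_span ⟨μ, hμ, rfl⟩)
      rw [hφa] at h1
      rw [map_sum, map_zero]
      simp only [map_mul, hca]
      have : ∑ q, algebraMap R F b * a q * (algebraMap R F) (hD μ (f q)) = algebraMap R F b * ∑ q, v μ q * a q := by
        rw [Finset.mul_sum]
        apply Finset.sum_congr rfl
        intro q _
        simp only [v]; ring
      rw [this, h1, mul_zero]
    have hc0 : c ≠ 0 := by
      intro h
      apply ha0
      funext q
      have := hca q
      rw [h, Pi.zero_apply, map_zero] at this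
      exact (mul_eq_zero.1 this.symm).resolve_left hb0
    obtain ⟨w, hw0, hw⟩ := stable_const T (by
      intro c hc i μ hμ
      have h1 := hc μ hμ
      have h2 := hTT c hc (μ + Finsupp.single i 1) (by
        simp [Finset.sum_add_distrib, Finsupp.single_apply]; exact hμ)
      have h3 := congrArg (pderiv i) h1
      rw [map_sum, map_zero] at h3
      simp only [Derivation.leibniz, pderiv_hD, smul_eq_mul] at h3
      rw [Finset.sum_add_distrib] at h3
      have h4 : ∑ x, c x * ((μ i + 1 : ℕ) : ℚ) • hD (μ + Finsupp.single i 1) (f x) = 0 := by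
        simp only [mul_smul_comm]
        rw [← Finset.smul_sum, h2, smul_zero]
      rw [h4, zero_add] at h3
      rw [← h3]
      apply Finset.sum_congr rfl
      intro q _; ring) (by
      intro c hc r μ hμ
      simp only [smul_mul_assoc]
      rw [← Finset.smul_sum, hc μ hμ, smul_zero]) c hcT hc0
    have h1 := hTT _ hw 0 (by simp)
    simp only [hD_zero] at h1
    apply hw0
    funext q
    exact Fintype.linearIndependent_iff.1 hf w (by simpa [smul_eq_C_mul] using h1) q

end wronskian
end RothAux

set_option linter.all false

namespace RothAux
open MvPolynomial

section sep
variable {m : ℕ} {R : Type*} [CommRing R]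

/-- product of polynomials in separate variables -/
noncomputable def sep (f : MvPolynomial (Fin m) R) (g : MvPolynomial (Fin 1) R) :
    MvPolynomial (Fin (m+1)) R :=
  rename Fin.succ f * rename (fun _ : Fin 1 => (0 : Fin (m+1))) g

lemma mapDomain_cons (e : Fin m →₀ ℕ) (d : Fin 1 →₀ ℕ) :
    Finsupp.mapDomain Fin.succ e + Finsupp.mapDomain (fun _ : Fin 1 => (0 : Fin (m+1))) d
      = Finsupp.cons (d 0) e := by
  ext i
  have hinj : Function.Injective (fun _ : Fin 1 => (0 : Fin (m+1))) := fun a b _ => Subsingleton.elim _ _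
  refine Fin.cases ?_ (fun i => ?_) i
  · rw [Finsupp.add_apply, Finsupp.mapDomain_notin_range, Finsupp.cons_zero, zero_add]
    · exact Finsupp.mapDomain_apply hinj d 0
    · rintro ⟨j, hj⟩; exact Fin.succ_ne_zero j hj
  · rw [Finsupp.add_apply, Finsupp.mapDomain_apply (Fin.succ_injective m), Finsupp.cons_succ,
      Finsupp.mapDomain_notin_range, add_zero]
    rintro ⟨j, hj⟩; exact Fin.succ_ne_zero i hj.symm

lemma sep_monomial (e : Fin m →₀ ℕ) (d : Fin 1 →₀ ℕ) (c c' : R) :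
    sep (monomial e c) (monomial d c') = monomial (Finsupp.cons (d 0) e) (c * c') := by
  rw [sep, rename_monomial, rename_monomial, monomial_mul, mapDomain_cons]

lemma sep_add_left (f f' : MvPolynomial (Fin m) R) (g) : sep (f + f') g = sep f g + sep f' g := by
  simp [sep, add_mul]
lemma sep_add_right (f : MvPolynomial (Fin m) R) (g g') : sep f (g + g') = sep f g + sep f g' := by
  simp [sep, mul_add]

lemma fin1_eq (d : Fin 1 →₀ ℕ) : d = Finsupp.single 0 (d 0) := by
  apply Finsupp.ext; intro i; have := Subsingleton.elim i 0; subst this; simp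

lemma coeff_sep (f : MvPolynomial (Fin m) R) (g : MvPolynomial (Fin 1) R) (D : Fin (m+1) →₀ ℕ) :
    coeff D (sep f g) = coeff D.tail f * coeff (Finsupp.single 0 (D 0)) g := by
  classical
  induction f using MvPolynomial.induction_on' with
  | add p q hp hq => rw [sep_add_left, coeff_add, hp, hq, coeff_add, add_mul]
  | monomial e c =>
    induction g using MvPolynomial.induction_on' with
    | add p q hp hq => rw [sep_add_right, coeff_add, hp, hq, coeff_add, mul_add]
    | monomial d c' =>
      rw [sep_monomial, coeff_monomial, coeff_monomial, coeff_monomial]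
      have h1 : Finsupp.cons (d 0) e = D ↔ e = D.tail ∧ d = Finsupp.single 0 (D 0) := by
        constructor
        · rintro rfl
          refine ⟨by simp, ?_⟩
          simpa using fin1_eq d
        · rintro ⟨rfl, h⟩
          rw [h]; simp
      by_cases ha : e = D.tail <;> by_cases hb : d = Finsupp.single 0 (D 0)
      · rw [if_pos (h1.2 ⟨ha, hb⟩), if_pos ha, if_pos hb]
      · rw [if_neg (fun h => hb (h1.1 h).2), if_neg hb, mul_zero]
      · rw [if_neg (fun h => ha (h1.1 h).1), if_neg ha, zero_mul]
      · rw [if_neg (fun h => ha (h1.1 h).1), if_neg ha, zero_mul]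

lemma hD_sep (f : MvPolynomial (Fin m) R) (g : MvPolynomial (Fin 1) R) (D : Fin (m+1) →₀ ℕ) :
    hD D (sep f g) = sep (hD D.tail f) (hD (Finsupp.single 0 (D 0)) g) := by
  ext E
  rw [coeff_hD, coeff_sep, coeff_sep, coeff_hD, coeff_hD, Fin.prod_univ_succ]
  simp only [Finsupp.add_apply, Nat.cast_mul, Finset.univ_unique, Fin.default_eq_zero, Fin.isValue,
    Finset.prod_singleton, Finsupp.single_apply, if_true, Finsupp.tail_apply]
  have h1 : (E + D).tail = E.tail + D.tail := by ext i; simp [Finsupp.tail_apply]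
  have h2 : (Finsupp.single (0 : Fin 1) (E 0 + D 0)) = Finsupp.single 0 (E 0) + Finsupp.single 0 (D 0) := by
    rw [Finsupp.single_add]
  rw [h1, h2]; ring

lemma tsh_sep (f : MvPolynomial (Fin m) R) (g : MvPolynomial (Fin 1) R) (ξ : Fin (m+1) → R) :
    tsh ξ (sep f g) = sep (tsh (fun i => ξ i.succ) f) (tsh (fun _ => ξ 0) g) := by
  rw [sep, map_mul, sep]
  congr 1
  · have : (tsh ξ).comp (rename Fin.succ) = (rename (Fin.succ)).comp (tsh (R := R) (fun i : Fin m => ξ i.succ)) := by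
      apply MvPolynomial.algHom_ext
      intro i; simp [tsh]
    exact DFunLike.congr_fun this f
  · have : (tsh ξ).comp (rename (fun _ : Fin 1 => (0 : Fin (m+1)))) =
        (rename ((fun _ : Fin 1 => (0 : Fin (m+1))))).comp (tsh (R := R) (fun _ : Fin 1 => ξ 0)) := by
      apply MvPolynomial.algHom_ext
      intro i; simp [tsh]
    exact DFunLike.congr_fun this g

lemma map_hD {ι : Type*} [Fintype ι] {S : Type*} [CommRing S] (φ : R →+* S) (μ : ι →₀ ℕ) (P : MvPolynomial ι R) :
    map φ (hD μ P) = hD μ (map φ P) := by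
  ext e; simp [coeff_hD, coeff_map]

/-- slice: fix the exponent of the variable 0 -/
noncomputable def slX (a : ℕ) (P : MvPolynomial (Fin (m+1)) R) : MvPolynomial (Fin m) R := by
  classical exact ∑ D ∈ P.support.filter (fun D => D 0 = a), monomial D.tail (coeff D P)

noncomputable def slY (e : Fin m →₀ ℕ) (P : MvPolynomial (Fin (m+1)) R) : MvPolynomial (Fin 1) R := by
  classical exact ∑ D ∈ P.support.filter (fun D => D.tail = e), monomial (Finsupp.single 0 (D 0)) (coeff D P)

lemma coeff_slX (a : ℕ) (P : MvPolynomial (Fin (m+1)) R) (e) : coeff e (slX a P) = coeff (Finsupp.cons a e) P := by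
  classical
  rw [slX, coeff_sum]
  simp only [coeff_monomial]
  rw [← Finset.sum_filter, Finset.filter_filter]
  by_cases h : Finsupp.cons a e ∈ P.support
  · rw [Finset.sum_eq_single_of_mem (Finsupp.cons a e)]
    · simp [h]
    · intro D hD hne
      simp at hD
      exact absurd (by rw [← hD.2.1, ← hD.2.2]; simp) hne
  · rw [notMem_support_iff.1 h]
    apply Finset.sum_eq_zero
    intro D hD
    simp only [Finset.mem_filter] at hD
    exfalso; apply h
    rw [← hD.2.1, ← hD.2.2, Finsupp.cons_tail]; exact hD.1

lemma coeff_slY (e) (P : MvPolynomial (Fin (m+1)) R) (d) : coeff d (slY e P) = coeff (Finsupp.cons (d 0) e) P := by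
  classical
  rw [slY, coeff_sum]
  simp only [coeff_monomial]
  rw [← Finset.sum_filter, Finset.filter_filter]
  by_cases h : Finsupp.cons (d 0) e ∈ P.support
  · rw [Finset.sum_eq_single_of_mem (Finsupp.cons (d 0) e)]
    · simp [h, ← fin1_eq]
    · intro D hD hne
      simp at hD
      exact absurd (by rw [← hD.2.1, ← hD.2.2]; simp) hne
  · rw [notMem_support_iff.1 h]
    apply Finset.sum_eq_zero
    intro D hD
    simp only [Finset.mem_filter] at hD
    exfalso; apply h
    rw [← hD.2.1, ← hD.2.2, Finsupp.single_eq_same, Finsupp.cons_tail]; exact hD.1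

lemma L_monomial {ι : Type*} (d : ι →₀ ℕ) (c : ℤ) : L (monomial d c) = |(c : ℝ)| := by
  rw [L, map_monomial, l1_monomial]; simp

lemma L_slX (a : ℕ) (P : MvPolynomial (Fin (m+1)) ℤ) : L (slX a P) ≤ L P := by
  classical
  rw [slX, L_eq P]
  refine (L_sum_le _ _).trans ?_
  simp only [L_monomial]
  exact Finset.sum_le_sum_of_subset_of_nonneg (Finset.filter_subset _ _) (fun _ _ _ => abs_nonneg _)

lemma L_slY (e) (P : MvPolynomial (Fin (m+1)) ℤ) : L (slY e P) ≤ L P := by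
  classical
  rw [slY, L_eq P]
  refine (L_sum_le _ _).trans ?_
  simp only [L_monomial]
  exact Finset.sum_le_sum_of_subset_of_nonneg (Finset.filter_subset _ _) (fun _ _ _ => abs_nonneg _)

end sep

section uni
lemma coeff_toPoly {R : Type*} [CommRing R] (V : MvPolynomial (Fin 1) R) (n : ℕ) :
    (MvPolynomial.aeval (fun _ : Fin 1 => (Polynomial.X : Polynomial R)) V).coeff n = coeff (Finsupp.single 0 n) V := by
  classical
  induction V using MvPolynomial.induction_on' with
  | add p q hp hq => rw [map_add, Polynomial.coeff_add, hp, hq, coeff_add]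
  | monomial d c =>
    rw [aeval_monomial, coeff_monomial, fin1_eq d]
    simp [Polynomial.coeff_X_pow, Finsupp.prod_fintype]
    by_cases h : n = d 0
    · simp [h]
    · rw [if_neg h, if_neg]
      intro h2
      apply h
      simpa using h2.symm

lemma uni_bound (V : MvPolynomial (Fin 1) ℤ) (hV : V ≠ 0) (a b : ℤ) (hb : 0 < b) (hab : IsCoprime a b) :
    ∃ i : ℕ, coeff (Finsupp.single 0 i) (tsh (fun _ => (a / b : ℚ)) (map (Int.castRingHom ℚ) V)) ≠ 0 ∧
      (b : ℝ) ^ i ≤ L V := by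
  classical
  let p : Polynomial ℤ := MvPolynomial.aeval (fun _ : Fin 1 => (Polynomial.X : Polynomial ℤ)) V
  have hp0 : p ≠ 0 := by
    intro h
    apply hV
    ext d
    rw [fin1_eq d, ← coeff_toPoly]
    show p.coeff _ = _
    rw [h]; simp
  let pq : Polynomial ℚ := p.map (Int.castRingHom ℚ)
  have hpq0 : pq ≠ 0 := (Polynomial.map_ne_zero_iff (RingHom.injective_int _)).2 hp0
  let ξ : ℚ := a / b
  have htr : ∀ i, coeff (Finsupp.single 0 i) (tsh (fun _ => ξ) (map (Int.castRingHom ℚ) V))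
      = (pq.comp (Polynomial.X + Polynomial.C ξ)).coeff i := by
    intro i
    rw [← coeff_toPoly]
    congr 1
    have : ((MvPolynomial.aeval (fun _ : Fin 1 => (Polynomial.X : Polynomial ℚ))).toRingHom.comp
        (((tsh (fun _ : Fin 1 => ξ)).toRingHom).comp (map (Int.castRingHom ℚ)))) =
      ((Polynomial.compRingHom (Polynomial.X + Polynomial.C ξ)).comp (Polynomial.mapRingHom (Int.castRingHom ℚ))).comp
       (MvPolynomial.aeval (fun _ : Fin 1 => (Polynomial.X : Polynomial ℤ))).toRingHom := by
      apply MvPolynomial.ringHom_ext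
      · intro r; simp [tsh]
      · intro r; simp [tsh]
    exact DFunLike.congr_fun this V
  let Q := pq.comp (Polynomial.X + Polynomial.C ξ)
  have hQ0 : Q ≠ 0 := by
    intro h
    have : Q.comp (Polynomial.X - Polynomial.C ξ) = pq := by
      simp [Q, Polynomial.comp_assoc]
    rw [h] at this
    simp at this
    exact hpq0 this.symm
  have hex : ∃ i, Q.coeff i ≠ 0 := by
    by_contra h
    push Not at h
    exact hQ0 (Polynomial.ext (by simpa using h))
  refine ⟨Nat.find hex, ?_, ?_⟩
  · rw [htr]; exact Nat.find_spec hex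
  · set i := Nat.find hex
    have h1 : Polynomial.X ^ i ∣ Q := by
      rw [Polynomial.X_pow_dvd_iff]
      intro d hd
      by_contra h
      exact Nat.find_min hex hd h
    have h2 : (Polynomial.X - Polynomial.C ξ) ^ i ∣ pq := Polynomial.X_sub_C_pow_dvd_iff.2 h1
    let ℓ : Polynomial ℤ := Polynomial.C b * Polynomial.X - Polynomial.C a
    have hb' : (b : ℚ) ≠ 0 := by exact_mod_cast hb.ne'
    have hℓ : ℓ.map (Int.castRingHom ℚ) = Polynomial.C (b : ℚ) * (Polynomial.X - Polynomial.C ξ) := by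
      have e1 : Polynomial.C (b : ℚ) * Polynomial.C ξ = Polynomial.C (a : ℚ) := by
        rw [← Polynomial.C_mul, mul_div_cancel₀ _ hb']
      rw [mul_sub, e1]
      simp only [ℓ, Polynomial.map_sub, Polynomial.map_mul, Polynomial.map_C, Polynomial.map_X]
      simp only [eq_intCast]
    have hprim : ℓ.IsPrimitive := by
      intro r hr
      rw [Polynomial.C_dvd_iff_dvd_coeff] at hr
      have h1 := hr 1
      have h0 := hr 0
      simp only [ℓ, Polynomial.coeff_sub, Polynomial.coeff_C_mul, Polynomial.coeff_X_one, Polynomial.coeff_X_zero, Polynomial.coeff_C_zero, Polynomial.coeff_C_succ, mul_one, mul_zero, sub_zero, zero_sub, dvd_neg] at h1 h0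
      exact hab.isUnit_of_dvd' h0 h1
    have hprim' : (ℓ ^ i).IsPrimitive := by
      induction i with
      | zero => simpa using Polynomial.isPrimitive_one
      | succ k ih => rw [pow_succ]; exact Polynomial.IsPrimitive.mul ih hprim
    have h3 : ℓ ^ i ∣ p := by
      rw [Polynomial.IsPrimitive.Int.dvd_iff_map_cast_dvd_map_cast _ _ hprim']
      rw [Polynomial.map_pow, hℓ, mul_pow]
      have hu : IsUnit ((Polynomial.C (b : ℚ)) ^ i) := (Polynomial.isUnit_C.2 (isUnit_iff_ne_zero.2 hb')).pow i
      exact (hu.mul_left_dvd).2 h2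
    have hlc : ℓ.leadingCoeff = b := by
      have : ℓ = Polynomial.C b * Polynomial.X + Polynomial.C (-a) := by simp [ℓ, sub_eq_add_neg]
      rw [this]; exact Polynomial.leadingCoeff_linear hb.ne'
    have h4 : b ^ i ∣ p.leadingCoeff := by
      obtain ⟨w, hw⟩ := h3
      rw [hw, Polynomial.leadingCoeff_mul, Polynomial.leadingCoeff_pow, hlc]
      exact dvd_mul_right _ _
    have h5 : b ^ i ≤ |p.leadingCoeff| := 
      Int.le_of_dvd (abs_pos.2 (Polynomial.leadingCoeff_ne_zero.2 hp0)) ((dvd_abs _ _).2 h4)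
    have h6 := coeff_le_L V (Finsupp.single 0 p.natDegree)
    rw [← coeff_toPoly] at h6
    refine le_trans ?_ h6
    exact_mod_cast h5

end uni
end RothAux

set_option linter.all false

namespace RothAux
open MvPolynomial

lemma decomp {m : ℕ} (P : MvPolynomial (Fin (m+1)) ℚ) (hP : P ≠ 0) (r0 : ℕ) (hdeg : degreeOf 0 P ≤ r0) :
    ∃ s ≤ r0, ∃ (f : Fin (s+1) → MvPolynomial (Fin m) ℚ) (g : Fin (s+1) → MvPolynomial (Fin 1) ℚ),
      LinearIndependent ℚ f ∧ LinearIndependent ℚ g ∧ P = ∑ j, sep (f j) (g j) := by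
  classical
  let Mo : Submodule ℚ (MvPolynomial (Fin 1) ℚ) :=
    Submodule.span ℚ (Set.range fun a : Fin (r0+1) => monomial (Finsupp.single 0 (a : ℕ)) 1)
  let G : Submodule ℚ (MvPolynomial (Fin 1) ℚ) := Submodule.span ℚ (Set.range fun e => slY e P)
  have hGM : G ≤ Mo := by
    apply Submodule.span_le.2
    rintro _ ⟨e, rfl⟩
    show slY e P ∈ Mo
    rw [slY]
    apply Submodule.sum_mem
    intro D hD
    have h1 : D 0 ≤ r0 := (degreeOf_le_iff.1 hdeg) D (Finset.mem_filter.1 hD).1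
    have h2 : (monomial (Finsupp.single 0 (D 0)) (coeff D P) : MvPolynomial (Fin 1) ℚ)
        = coeff D P • monomial (Finsupp.single 0 (D 0)) 1 := by simp [smul_monomial]
    rw [h2]
    apply Submodule.smul_mem
    exact Submodule.subset_span ⟨⟨D 0, by omega⟩, rfl⟩
  haveI : FiniteDimensional ℚ Mo := FiniteDimensional.span_of_finite ℚ (Set.finite_range _)
  haveI : FiniteDimensional ℚ G := Submodule.finiteDimensional_of_le hGM
  have hfr : Module.finrank ℚ G ≤ r0 + 1 := by
    refine (Submodule.finrank_mono hGM).trans ?_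
    have := finrank_range_le_card (R := ℚ) (fun a : Fin (r0+1) => (monomial (Finsupp.single 0 (a : ℕ)) 1 : MvPolynomial (Fin 1) ℚ))
    simpa [Set.finrank] using this
  have hpos : 0 < Module.finrank ℚ G := by
    rw [Module.finrank_pos_iff, Submodule.nontrivial_iff_ne_bot]
    intro hbot
    obtain ⟨D, hD⟩ := MvPolynomial.ne_zero_iff.1 hP
    have h1 : slY D.tail P ∈ G := Submodule.subset_span ⟨_, rfl⟩
    rw [hbot, Submodule.mem_bot] at h1
    have h2 := coeff_slY D.tail P (Finsupp.single 0 (D 0))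
    rw [h1] at h2
    simp at h2
    exact hD h2.symm
  obtain ⟨s, hs⟩ : ∃ s, Module.finrank ℚ G = s + 1 := ⟨_, (Nat.succ_pred_eq_of_pos hpos).symm⟩
  let B := Module.finBasisOfFinrankEq ℚ G hs
  let el : (Fin m →₀ ℕ) → G := fun e => ⟨slY e P, Submodule.subset_span ⟨e, rfl⟩⟩
  let f : Fin (s+1) → MvPolynomial (Fin m) ℚ := fun j =>
    ∑ e ∈ P.support.image Finsupp.tail, monomial e (B.repr (el e) j)
  have hel : ∀ e, e ∉ P.support.image Finsupp.tail → el e = 0 := by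
    intro e he
    apply Subtype.ext
    show slY e P = 0
    rw [slY]
    apply Finset.sum_eq_zero
    intro D hD
    rw [Finset.mem_filter] at hD
    exact absurd (Finset.mem_image.2 ⟨D, hD.1, hD.2⟩) he
  have hf : ∀ j e, coeff e (f j) = B.repr (el e) j := by
    intro j e
    simp only [f, coeff_sum, coeff_monomial]
    rw [Finset.sum_ite_eq']
    split_ifs with h
    · rfl
    · rw [hel e h]; simp
  refine ⟨s, by omega, f, fun j => (B j : MvPolynomial (Fin 1) ℚ), ?_, ?_, ?_⟩
  · rw [Fintype.linearIndependent_iff]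
    intro c hc j
    let ψ : G →ₗ[ℚ] ℚ := ∑ j, c j • B.coord j
    have hψ : ∀ e, ψ (el e) = 0 := by
      intro e
      have := congrArg (coeff e) hc
      simp only [coeff_sum, coeff_smul, hf, coeff_zero] at this
      simpa [ψ, LinearMap.sum_apply] using this
    have h0 : ∀ x (hx : x ∈ G), ψ ⟨x, hx⟩ = 0 := by
      intro x hx
      induction hx using Submodule.span_induction with
      | mem x h => obtain ⟨e, rfl⟩ := h; exact hψ e
      | zero => exact map_zero ψ
      | add x y hx hy h1 h2 =>
        have := map_add ψ ⟨x, hx⟩ ⟨y, hy⟩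
        rw [h1, h2] at this
        simpa using this
      | smul a x hx h =>
        have := map_smul ψ a ⟨x, hx⟩
        rw [h] at this
        simpa using this
    have := h0 (B j) (B j).2
    simpa [ψ, LinearMap.sum_apply, Finsupp.single_apply] using this
  · exact B.linearIndependent.map' G.subtype (Submodule.ker_subtype G)
  · ext D
    rw [coeff_sum]
    simp only [coeff_sep, hf]
    have h1 := congrArg (fun x : G => coeff (Finsupp.single 0 (D 0)) (x : MvPolynomial (Fin 1) ℚ)) (B.sum_repr (el D.tail))
    have h2 := coeff_slY D.tail P (Finsupp.single 0 (D 0))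
    simp only [Finsupp.single_eq_same, Finsupp.cons_tail] at h2
    rw [← h2]
    simp only [Submodule.coe_sum, Submodule.coe_smul, coeff_sum, coeff_smul, smul_eq_mul] at h1
    exact h1.symm

section index
variable {ι : Type*} [Fintype ι]

noncomputable def wt (r : ι → ℕ) (μ : ι →₀ ℕ) : ℝ := ∑ i, (μ i : ℝ) / r i

lemma wt_nonneg (r : ι → ℕ) (μ : ι →₀ ℕ) : 0 ≤ wt r μ := Finset.sum_nonneg fun _ _ => by positivity
lemma wt_add (r : ι → ℕ) (μ ν : ι →₀ ℕ) : wt r (μ + ν) = wt r μ + wt r ν := by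
  simp [wt, add_div, Finset.sum_add_distrib]
lemma wt_zero (r : ι → ℕ) : wt r 0 = 0 := by simp [wt]

/-- vanishing to weighted order `t` of a polynomial at 0 -/
def Idx (r : ι → ℕ) (P : MvPolynomial ι ℚ) (t : ℝ) : Prop := ∀ μ, wt r μ < t → coeff μ P = 0

lemma Idx.mono {r : ι → ℕ} {P : MvPolynomial ι ℚ} {t t' : ℝ} (h : Idx r P t) (hh : t' ≤ t) : Idx r P t' :=
  fun μ hμ => h μ (hμ.trans_le hh)
lemma Idx.of_nonpos {r : ι → ℕ} {P : MvPolynomial ι ℚ} {t : ℝ} (h : t ≤ 0) : Idx r P t :=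
  fun μ hμ => absurd (wt_nonneg r μ) (by linarith)
lemma Idx.mul {r : ι → ℕ} {P Q : MvPolynomial ι ℚ} {t u : ℝ} (h : Idx r P t) (h' : Idx r Q u) :
    Idx r (P * Q) (t + u) := by
  classical
  intro μ hμ
  rw [coeff_mul]
  apply Finset.sum_eq_zero
  intro x hx
  rw [Finset.HasAntidiagonal.mem_antidiagonal] at hx
  rw [← hx, wt_add] at hμ
  by_cases h1 : wt r x.1 < t
  · rw [h _ h1, zero_mul]
  · rw [h' _ (by linarith), mul_zero]
lemma Idx.prod {κ : Type*} {r : ι → ℕ} (s : Finset κ) {P : κ → MvPolynomial ι ℚ} {t : κ → ℝ}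
    (h : ∀ k, Idx r (P k) (t k)) : Idx r (∏ k ∈ s, P k) (∑ k ∈ s, t k) := by
  classical
  induction s using Finset.induction_on with
  | empty => exact Idx.of_nonpos (by simp)
  | insert a s ha ih => rw [Finset.prod_insert ha, Finset.sum_insert ha]; exact (h a).mul ih
lemma Idx.sum {κ : Type*} {r : ι → ℕ} (s : Finset κ) {P : κ → MvPolynomial ι ℚ} {t : ℝ}
    (h : ∀ k ∈ s, Idx r (P k) t) : Idx r (∑ k ∈ s, P k) t := by
  intro μ hμ
  rw [coeff_sum]
  exact Finset.sum_eq_zero fun k hk => h k hk μ hμ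
lemma Idx.hD {r : ι → ℕ} {P : MvPolynomial ι ℚ} {t : ℝ} (h : Idx r P t) (μ : ι →₀ ℕ) :
    Idx r (hD μ P) (t - wt r μ) := by
  intro ν hν
  rw [coeff_hD, h (ν + μ) (by rw [wt_add]; linarith), mul_zero]
lemma Idx.det {n : ℕ} {r : ι → ℕ} (A : Matrix (Fin n) (Fin n) (MvPolynomial ι ℚ)) (t : Fin n → ℝ)
    (h : ∀ p q, Idx r (A p q) (t q)) : Idx r A.det (∑ q, t q) := by
  rw [Matrix.det_apply']
  apply Idx.sum
  intro σ _
  have h1 := (Idx.of_nonpos (r := r) (P := ((Equiv.Perm.sign σ : ℤ) : MvPolynomial ι ℚ)) le_rfl).mul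
    (Idx.prod Finset.univ (fun k => h (σ k) k))
  rw [zero_add] at h1
  exact h1
end index

end RothAux

set_option linter.all false

namespace RothAux
open MvPolynomial

lemma degreeOf_hD {ι : Type*} [Fintype ι] {R : Type*} [CommRing R] (μ : ι →₀ ℕ) (P : MvPolynomial ι R) (i : ι) (k : ℕ)
    (h : degreeOf i P ≤ k) : degreeOf i (hD μ P) ≤ k := by
  classical
  rw [degreeOf_le_iff] at h ⊢
  intro e he
  rw [mem_support_iff, coeff_hD] at he
  have h1 : coeff (e + μ) P ≠ 0 := fun h => he (by rw [h, mul_zero])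
  have := h _ (mem_support_iff.2 h1)
  simp at this; omega

lemma degreeOf_det {ι : Type*} {R : Type*} [CommRing R] {n : ℕ} (A : Matrix (Fin n) (Fin n) (MvPolynomial ι R)) (i : ι) (k : ℕ)
    (h : ∀ p q, degreeOf i (A p q) ≤ k) : degreeOf i A.det ≤ n * k := by
  classical
  rw [Matrix.det_apply']
  refine (degreeOf_sum_le _ _ _).trans (Finset.sup_le ?_)
  intro σ _
  refine (degreeOf_mul_le _ _ _).trans ?_
  have h1 : degreeOf i (((Equiv.Perm.sign σ : ℤ)) : MvPolynomial ι R) = 0 := by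
    have : (((Equiv.Perm.sign σ : ℤ)) : MvPolynomial ι R) = C (((Equiv.Perm.sign σ : ℤ)) : R) := by simp
    rw [this, degreeOf_C]
  rw [h1, zero_add]
  refine (degreeOf_prod_le _ _ _).trans ?_
  refine (Finset.sum_le_card_nsmul _ _ k (fun j _ => h _ _)).trans ?_
  simp

lemma L_det {ι : Type*} {n : ℕ} (A : Matrix (Fin n) (Fin n) (MvPolynomial ι ℤ)) (k : ℝ) (hk : 0 ≤ k)
    (h : ∀ p q, L (A p q) ≤ k) : L A.det ≤ (n * k) ^ n := by
  classical
  rw [Matrix.det_apply']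
  refine (L_sum_le _ _).trans ?_
  have h1 : ∀ σ ∈ (Finset.univ : Finset (Equiv.Perm (Fin n))), L ((((Equiv.Perm.sign σ : ℤ)) : MvPolynomial ι ℤ) * ∏ j, A (σ j) j) ≤ k ^ n := by
    intro σ _
    refine (L_mul_le _ _).trans ?_
    have h2 : L (((Equiv.Perm.sign σ : ℤ)) : MvPolynomial ι ℤ) ≤ 1 := by
      have : (((Equiv.Perm.sign σ : ℤ)) : MvPolynomial ι ℤ) = monomial 0 (Equiv.Perm.sign σ : ℤ) := by
        rw [← C_apply]; simp
      rw [this, L_monomial]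
      rcases Int.units_eq_one_or (Equiv.Perm.sign σ) with h | h <;> simp [h]
    have h3 : L (∏ j, A (σ j) j) ≤ k ^ n := by
      refine (L_prod_le _ _).trans ?_
      refine (Finset.prod_le_prod (fun _ _ => L_nonneg _) (fun j _ => h (σ j) j)).trans ?_
      simp
    calc _ ≤ 1 * k ^ n := mul_le_mul h2 h3 (L_nonneg _) zero_le_one
      _ = _ := one_mul _
  refine (Finset.sum_le_card_nsmul _ _ _ h1).trans ?_
  rw [Finset.card_univ, Fintype.card_perm, Fintype.card_fin, nsmul_eq_mul, mul_pow]
  apply mul_le_mul_of_nonneg_right _ (pow_nonneg hk n)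
  exact_mod_cast Nat.factorial_le_pow n

lemma wronskian1 {n : ℕ} (g : Fin n → MvPolynomial (Fin 1) ℚ) (hg : LinearIndependent ℚ g) :
      Matrix.det (Matrix.of fun (p : Fin n) q => hD (Finsupp.single 0 (p : ℕ)) (g q)) ≠ 0 := by
  classical
  obtain ⟨μ, hμ, hdet⟩ := wronskian g hg
  let e : Fin n → Fin n := fun p => ⟨μ p 0, by simpa using hμ p⟩
  have he : Function.Injective e := by
    intro p q hpq
    by_contra hne
    apply hdet
    apply Matrix.det_zero_of_row_eq hne
    have h1 : μ p = μ q := by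
      rw [fin1_eq (μ p), fin1_eq (μ q)]
      have := congrArg Fin.val hpq
      simp only [e] at this
      rw [this]
    funext j
    simp [Matrix.of_apply, h1]
  let eq : Equiv.Perm (Fin n) := Equiv.ofBijective e (Finite.injective_iff_bijective.1 he)
  intro h0
  apply hdet
  have : (Matrix.of fun p q => hD (μ p) (g q)) =
      (Matrix.of fun (p : Fin n) q => hD (Finsupp.single 0 (p : ℕ)) (g q)).submatrix eq id := by
    ext1 p q
    simp only [Matrix.of_apply, Matrix.submatrix_apply, id]
    rw [fin1_eq (μ p)]
    simp [eq, e]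
  rw [this, Matrix.det_permute, h0, mul_zero]

/-- structure of the Wronskian step -/
lemma wr_step {m : ℕ} (P : MvPolynomial (Fin (m+1)) ℤ) (hP : P ≠ 0) (r : Fin (m+1) → ℕ)
    (hdeg : ∀ i, degreeOf i P ≤ r i) :
    ∃ s ≤ r 0, ∃ (μ : Fin (s+1) → (Fin m →₀ ℕ)) (W : MvPolynomial (Fin (m+1)) ℤ)
      (U : MvPolynomial (Fin m) ℤ) (V : MvPolynomial (Fin 1) ℤ) (c : ℚ),
      (∀ p, ∑ i, μ p i ≤ s) ∧
      W = Matrix.det (Matrix.of fun (p q : Fin (s+1)) => hD (Finsupp.cons (q : ℕ) (μ p)) P) ∧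
      U ≠ 0 ∧ V ≠ 0 ∧ L U ≤ L W ∧ L V ≤ L W ∧ (∀ i, degreeOf i U ≤ (s+1) * r i.succ) ∧
      c • map (Int.castRingHom ℚ) W = sep (map (Int.castRingHom ℚ) U) (map (Int.castRingHom ℚ) V) := by
  classical
  set Pq := map (Int.castRingHom ℚ) P with hPq
  have hPq0 : Pq ≠ 0 := by
    rw [hPq, Ne, map_eq_zero_iff _ (map_injective _ (RingHom.injective_int _))]; exact hP
  have hd0 : degreeOf 0 Pq ≤ r 0 := (by
    rw [degreeOf_le_iff]
    intro d hd
    exact degreeOf_le_iff.1 (hdeg 0) d (support_map_subset _ _ hd))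
  obtain ⟨s, hs, f, g, hf, hg, hdec⟩ := decomp Pq hPq0 (r 0) hd0
  obtain ⟨μ, hμ, hU0⟩ := wronskian f hf
  have hV0 := wronskian1 g hg
  set U0 := Matrix.det (Matrix.of fun p q => hD (μ p) (f q)) with hU0def
  set V0 := Matrix.det (Matrix.of fun (p : Fin (s+1)) q => hD (Finsupp.single 0 (p : ℕ)) (g q)) with hV0def
  set W := Matrix.det (Matrix.of fun (p q : Fin (s+1)) => hD (Finsupp.cons (q : ℕ) (μ p)) P) with hW
  have hWq : map (Int.castRingHom ℚ) W = sep U0 V0 := by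
    rw [hW, RingHom.map_det, sep, hU0def, hV0def, AlgHom.map_det, AlgHom.map_det,
      ← Matrix.det_transpose ((rename (fun _ : Fin 1 => (0 : Fin (m+1)))).mapMatrix _), ← Matrix.det_mul]
    congr 1
    ext1 p q
    simp only [RingHom.mapMatrix_apply, Matrix.map_apply, Matrix.of_apply, AlgHom.mapMatrix_apply,
      Matrix.mul_apply, Matrix.transpose_apply]
    rw [map_hD, ← hPq, hdec, map_sum]
    apply Finset.sum_congr rfl
    intro j _
    rw [hD_sep, sep]; simp
  obtain ⟨e, he⟩ := MvPolynomial.ne_zero_iff.1 hU0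
  obtain ⟨d, hd⟩ := MvPolynomial.ne_zero_iff.1 hV0
  have hcW : ∀ D, ((coeff D W : ℤ) : ℚ) = coeff D.tail U0 * coeff (Finsupp.single 0 (D 0)) V0 := by
    intro D
    have := coeff_map (Int.castRingHom ℚ) W D
    rw [hWq, coeff_sep] at this
    simpa using this.symm
  have hU : map (Int.castRingHom ℚ) (slX (d 0) W) = (coeff d V0) • U0 := by
    ext e'
    rw [coeff_map, coeff_slX, coeff_smul]
    have := hcW (Finsupp.cons (d 0) e')
    simp only [Finsupp.tail_cons, Finsupp.cons_zero, ← fin1_eq] at this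
    simp [this, mul_comm]
  have hV : map (Int.castRingHom ℚ) (slY e W) = (coeff e U0) • V0 := by
    ext d'
    rw [coeff_map, coeff_slY, coeff_smul]
    have := hcW (Finsupp.cons (d' 0) e)
    simp only [Finsupp.tail_cons, Finsupp.cons_zero, ← fin1_eq] at this
    simp [this]
  refine ⟨s, hs, μ, W, slX (d 0) W, slY e W, coeff d V0 * coeff e U0, ?_, hW, ?_, ?_, L_slX _ _, L_slY _ _, ?_, ?_⟩
  · intro p; exact Nat.lt_succ_iff.1 (hμ p)
  · intro h
    rw [h, map_zero] at hU
    exact (smul_ne_zero hd hU0) hU.symm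
  · intro h
    rw [h, map_zero] at hV
    exact (smul_ne_zero he hV0) hV.symm
  · intro i
    have hdW : degreeOf i.succ W ≤ (s+1) * r i.succ := by
      apply degreeOf_det
      intro p q
      exact degreeOf_hD _ _ _ _ (hdeg _)
    rw [degreeOf_le_iff] at hdW ⊢
    intro e' he'
    rw [mem_support_iff, coeff_slX] at he'
    have := hdW _ (mem_support_iff.2 he')
    simpa using this
  · rw [hU, hV, hWq, sep, sep, map_smul, map_smul, smul_mul_smul_comm]

end RothAux

set_option linter.all false

namespace RothAux
open MvPolynomial

lemma theta_bound (t σ : ℝ) (ht : 0 < t) (ht1 : t ≤ 1) (hσ0 : 0 < σ) (hσ : σ ≤ t^2/200) (s r0 : ℕ) (hs : s ≤ r0) (hr0 : 0 < r0) :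
    (s+1) * (t^2/16) ≤ ∑ q : Fin (s+1), max 0 (t - σ - (q : ℕ) / (r0 : ℝ)) := by
  classical
  rw [Fin.sum_univ_eq_sum_range (fun q => max 0 (t - σ - (q : ℝ) / (r0 : ℝ)))]
  have hr0' : (0:ℝ) < r0 := by exact_mod_cast hr0
  let k := min s ⌊t * r0 / 2⌋₊
  have hk : k ≤ s := min_le_left _ _
  have hsub : Finset.range (k+1) ⊆ Finset.range (s+1) := Finset.range_mono (by omega)
  refine le_trans ?_ (Finset.sum_le_sum_of_subset_of_nonneg hsub (fun _ _ _ => le_max_left _ _))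
  have h1 : ∀ q ∈ Finset.range (k+1), t/4 ≤ max 0 (t - σ - (q : ℝ) / (r0 : ℝ)) := by
    intro q hq
    rw [Finset.mem_range] at hq
    refine le_trans ?_ (le_max_right _ _)
    have h2 : (q : ℝ) ≤ t * r0 / 2 := by
      have : q ≤ ⌊t * r0 / 2⌋₊ := le_trans (by omega) (min_le_right s _)
      exact (Nat.cast_le.2 this).trans (Nat.floor_le (by positivity))
    have h3 : (q : ℝ) / r0 ≤ t / 2 := by rw [div_le_iff₀ hr0']; linarith
    nlinarith
  have h2 := Finset.card_nsmul_le_sum _ _ _ h1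
  refine le_trans ?_ h2
  rw [Finset.card_range, nsmul_eq_mul]
  have h3 : ((s:ℝ)+1) * (t/4) ≤ ((k + 1 : ℕ) : ℝ) := by
    rcases min_choice s ⌊t * r0 / 2⌋₊ with h | h
    · have : k = s := h
      rw [this]; push_cast; nlinarith
    · have : k = ⌊t * r0 / 2⌋₊ := h
      rw [this]
      have h4 := Nat.lt_floor_add_one (t * r0 / 2)
      push_cast
      have h5 : ((s:ℝ)+1) ≤ 2 * r0 := by
        have : s + 1 ≤ 2 * r0 := by omega
        exact_mod_cast this
      nlinarith
  nlinarith

theorem roth (m : ℕ) : ∀ t : ℝ, 0 < t → ∃ σ : ℝ, 0 < σ ∧ ∀ (r : Fin m → ℕ) (a b : Fin m → ℤ)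
    (P : MvPolynomial (Fin m) ℤ), (∀ i, 0 < r i) → (∀ i, 0 < b i) → (∀ i, IsCoprime (a i) (b i)) →
    P ≠ 0 → (∀ i, degreeOf i P ≤ r i) → (∀ i j, i < j → (r i : ℝ) ≤ σ * r j) →
    (∀ i, Real.log (L P) + ∑ j, (r j : ℝ) ≤ σ * r i * Real.log (b i)) →
    ¬ Idx r (tsh (fun i => (a i / b i : ℚ)) (map (Int.castRingHom ℚ) P)) t := by
  classical
  induction m with
  | zero =>
    intro t ht
    refine ⟨1, one_pos, ?_⟩
    intro r a b P _ _ _ hP _ _ _ hidx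
    have h1 := hidx 0 (by rw [wt_zero]; exact ht)
    rw [coeff_zero_tsh] at h1
    apply hP
    obtain ⟨c, rfl⟩ := MvPolynomial.C_surjective (Fin 0) P
    simp at h1
    rw [h1, C_0]
  | succ m ih =>
    have main : ∀ t : ℝ, 0 < t → t ≤ 1 → ∃ σ : ℝ, 0 < σ ∧ ∀ (r : Fin (m+1) → ℕ) (a b : Fin (m+1) → ℤ)
        (P : MvPolynomial (Fin (m+1)) ℤ), (∀ i, 0 < r i) → (∀ i, 0 < b i) → (∀ i, IsCoprime (a i) (b i)) →
        P ≠ 0 → (∀ i, degreeOf i P ≤ r i) → (∀ i j, i < j → (r i : ℝ) ≤ σ * r j) →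
        (∀ i, Real.log (L P) + ∑ j, (r j : ℝ) ≤ σ * r i * Real.log (b i)) →
        ¬ Idx r (tsh (fun i => (a i / b i : ℚ)) (map (Int.castRingHom ℚ) P)) t := by
      intro t ht ht1
      obtain ⟨σ', hσ', hih⟩ := ih (t^2/64) (by positivity)
      refine ⟨min (σ'/3) (t^2/200), by positivity, ?_⟩
      set σ := min (σ'/3) (t^2/200) with hσdef
      have hσ0 : 0 < σ := by positivity
      have hσ1 : σ ≤ σ'/3 := min_le_left _ _
      have hσ2 : σ ≤ t^2/200 := min_le_right _ _
      intro r a b P hr hb hab hP hdeg hrr hlog hidx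
      obtain ⟨s, hs, μ, W, U, V, c, hμ, hW, hU0, hV0, hUW, hVW, hdU, hsep⟩ := wr_step P hP r hdeg
      set Rsum := ∑ j, (r j : ℝ) with hRsum
      have hK : 0 ≤ Real.log (L P) := Real.log_nonneg (one_le_L P hP)
      set K := Real.log (L P) with hKdef
      -- bound for L W
      have hLP : 0 < L P := lt_of_lt_of_le one_pos (one_le_L P hP)
      have hLW : L W ≤ (((s+1 : ℕ) : ℝ) * (2 ^ (∑ i, r i) * L P)) ^ (s+1) := by
        rw [hW]
        apply L_det
        · positivity
        · intro p q
          exact L_hD _ _ _ (fun d hd i => degreeOf_le_iff.1 (hdeg i) d hd)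
      have hs1 : ((s:ℝ)) ≤ Rsum := by
        have h1 : (s:ℝ) ≤ r 0 := by exact_mod_cast hs
        exact h1.trans (Finset.single_le_sum (f := fun j => (r j : ℝ)) (fun _ _ => by positivity) (Finset.mem_univ 0))
      have hRcast : ((∑ i, r i : ℕ) : ℝ) = Rsum := by push_cast; rfl
      have hlogW : ∀ x : ℝ, 1 ≤ x → x ≤ L W → Real.log x ≤ (s+1) * (2 * Rsum + K) := by
        intro x hx hxW
        have h1 : Real.log x ≤ Real.log ((((s+1 : ℕ) : ℝ) * (2 ^ (∑ i, r i) * L P)) ^ (s+1)) :=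
          Real.log_le_log (by linarith) (hxW.trans hLW)
        rw [Real.log_pow, Real.log_mul (by positivity) (by positivity), Real.log_mul (by positivity) (by positivity),
          Real.log_pow, hRcast] at h1
        have h2 : Real.log ((s+1 : ℕ) : ℝ) ≤ s := by
          have := Real.log_le_sub_one_of_pos (x := ((s+1 : ℕ) : ℝ)) (by positivity)
          push_cast at this ⊢; linarith
        have h3 : Real.log 2 ≤ 1 := by linarith [Real.log_two_lt_d9]
        have hR0 : 0 ≤ Rsum := by positivity
        refine h1.trans ?_
        push_cast
        apply mul_le_mul_of_nonneg_left _ (by positivity)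
        push_cast at h2
        nlinarith
      -- the univariate factor
      obtain ⟨i0, hi0, hbi⟩ := uni_bound V hV0 (a 0) (b 0) (hb 0) (hab 0)
      have hr0 : (0:ℝ) < r 0 := by exact_mod_cast hr 0
      have hb0 : (1:ℝ) ≤ b 0 := by exact_mod_cast hb 0
      have hlb0 : 0 < Real.log (b 0) := by
        by_contra hcon
        have h1 := hlog 0
        have h2 : σ * r 0 * Real.log (b 0) ≤ 0 := mul_nonpos_of_nonneg_of_nonpos (by positivity) (by linarith)
        have h3 : (0:ℝ) < Rsum := Finset.sum_pos (fun j _ => by exact_mod_cast hr j) ⟨0, Finset.mem_univ _⟩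
        linarith
      have hi0r : (i0 : ℝ) / r 0 ≤ 2 * (s+1) * σ := by
        have h1 := hlogW ((b 0 : ℝ)^i0) (one_le_pow₀ hb0) (hbi.trans hVW)
        rw [Real.log_pow] at h1
        have h2 := hlog 0
        rw [div_le_iff₀ hr0]
        have h3 : (i0:ℝ) * Real.log (b 0) ≤ (2 * (s+1) * σ * r 0) * Real.log (b 0) := by
          have : ((s:ℝ)+1) * (2 * Rsum + K) ≤ (s+1) * (2 * (σ * r 0 * Real.log (b 0))) := by
            apply mul_le_mul_of_nonneg_left _ (by positivity)
            linarith
          linarith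
        exact le_of_mul_le_mul_right h3 hlb0
      -- U via induction hypothesis
      have hU := hih (fun i => (s+1) * r i.succ) (fun i => a i.succ) (fun i => b i.succ) U
        (fun i => Nat.mul_pos (Nat.succ_pos s) (hr _)) (fun i => hb _) (fun i => hab _) hU0 hdU
        (by
          intro i j hij
          have h1 := hrr i.succ j.succ (Fin.succ_lt_succ_iff.2 hij)
          have h2 : σ * (r j.succ : ℝ) ≤ σ' * r j.succ := mul_le_mul_of_nonneg_right (by linarith) (by positivity)
          push_cast
          nlinarith)
        (by
          intro i
          have h1 := hlog i.succ
          have h2 := hlogW (L U) (one_le_L U hU0) hUW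
          have h3 : ∑ j : Fin m, (((s+1) * r j.succ : ℕ) : ℝ) ≤ (s+1) * Rsum := by
            push_cast
            rw [← Finset.mul_sum]
            apply mul_le_mul_of_nonneg_left _ (by positivity)
            rw [hRsum, Fin.sum_univ_succ]
            linarith
          have hbi : (1:ℝ) ≤ b i.succ := by exact_mod_cast hb i.succ
          have h4 : 0 ≤ (r i.succ : ℝ) * Real.log (b i.succ) := mul_nonneg (by positivity) (Real.log_nonneg hbi)
          have h5 : 3 * σ * (r i.succ : ℝ) * Real.log (b i.succ) ≤ σ' * r i.succ * Real.log (b i.succ) := by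
            nlinarith
          have h6 : ((s:ℝ)+1) * (2 * Rsum + K) + (s+1) * Rsum ≤ (s+1) * (3 * σ * (r i.succ : ℝ) * Real.log (b i.succ)) := by
            rw [← mul_add]
            apply mul_le_mul_of_nonneg_left _ (by positivity)
            linarith
          have h7 : ((s:ℝ)+1) * (3 * σ * (r i.succ : ℝ) * Real.log (b i.succ)) ≤ (s+1) * (σ' * r i.succ * Real.log (b i.succ)) :=
            mul_le_mul_of_nonneg_left h5 (by positivity)
          push_cast
          push_cast at h3
          linarith)
      simp only [Idx] at hU
      push Not at hU
      obtain ⟨ν, hν, hνU⟩ := hU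
      -- index of W
      set ξ : Fin (m+1) → ℚ := fun i => (a i / b i : ℚ) with hξ
      have hWidx : Idx r (tsh ξ (map (Int.castRingHom ℚ) W)) (∑ q : Fin (s+1), max 0 (t - σ - (q : ℕ) / (r 0 : ℝ))) := by
        rw [hW, RingHom.map_det, AlgHom.map_det]
        apply Idx.det
        intro p q
        simp only [AlgHom.mapMatrix_apply, RingHom.mapMatrix_apply, Matrix.map_apply, Matrix.of_apply]
        rcases le_total (t - σ - (q : ℕ) / (r 0 : ℝ)) 0 with h | h
        · rw [max_eq_left h]; exact Idx.of_nonpos le_rfl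
        · rw [max_eq_right h, map_hD, tsh_hD]
          apply (hidx.hD _).mono
          have h1 : wt r (Finsupp.cons (q : ℕ) (μ p)) ≤ (q : ℕ) / (r 0 : ℝ) + σ := by
            rw [wt, Fin.sum_univ_succ]
            simp only [Finsupp.cons_zero, Finsupp.cons_succ]
            have h2 : ∑ i : Fin m, (μ p i : ℝ) / r i.succ ≤ ∑ i : Fin m, (μ p i : ℝ) * (σ / r 0) := by
              apply Finset.sum_le_sum
              intro i _
              rw [div_eq_mul_inv]
              apply mul_le_mul_of_nonneg_left _ (by positivity)
              have h3 := hrr 0 i.succ (Fin.succ_pos i)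
              have h4 : (0:ℝ) < r i.succ := by exact_mod_cast hr _
              rw [inv_eq_one_div, div_le_div_iff₀ h4 hr0]
              linarith
            have h3 : ∑ i : Fin m, (μ p i : ℝ) * (σ / r 0) ≤ σ := by
              rw [← Finset.sum_mul]
              have h4 : ∑ i : Fin m, (μ p i : ℝ) ≤ r 0 := by
                have := (hμ p).trans hs
                exact_mod_cast this
              calc _ ≤ (r 0 : ℝ) * (σ / r 0) := mul_le_mul_of_nonneg_right h4 (by positivity)
                _ = σ := by field_simp
            linarith
          linarith
      -- contradiction
      have hsepT : c • tsh ξ (map (Int.castRingHom ℚ) W) = sep (tsh (fun i => ξ i.succ) (map (Int.castRingHom ℚ) U))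
          (tsh (fun _ => ξ 0) (map (Int.castRingHom ℚ) V)) := by
        rw [← tsh_sep, ← hsep, map_smul]
      have hcoef := congrArg (coeff (Finsupp.cons i0 ν)) hsepT
      rw [coeff_smul, coeff_sep, Finsupp.tail_cons, Finsupp.cons_zero] at hcoef
      have hthe := theta_bound t σ ht ht1 hσ0 hσ2 s (r 0) hs (hr 0)
      have hw : wt r (Finsupp.cons i0 ν) < ∑ q : Fin (s+1), max 0 (t - σ - (q : ℕ) / (r 0 : ℝ)) := by
        refine lt_of_lt_of_le ?_ hthe
        rw [wt, Fin.sum_univ_succ]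
        simp only [Finsupp.cons_zero, Finsupp.cons_succ]
        have h1 : ∑ i : Fin m, (ν i : ℝ) / r i.succ = (s+1) * wt (fun i => (s+1) * r i.succ) ν := by
          rw [wt, Finset.mul_sum]
          apply Finset.sum_congr rfl
          intro i _
          have h4 : (0:ℝ) < r i.succ := by exact_mod_cast hr _
          push_cast
          field_simp
        rw [h1]
        have h2 : ((s:ℝ)+1) * wt (fun i => (s+1) * r i.succ) ν ≤ (s+1) * (t^2/64) :=
          mul_le_mul_of_nonneg_left hν.le (by positivity)
        have h3 : 2 * ((s:ℝ)+1) * σ ≤ 2 * (s+1) * (t^2/200) := mul_le_mul_of_nonneg_left hσ2 (by positivity)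
        have h4 : 0 < ((s:ℝ)+1) * t^2 := by positivity
        nlinarith
      rw [hWidx _ hw, smul_zero] at hcoef
      rcases mul_eq_zero.1 hcoef.symm with h | h
      · exact hνU h
      · exact hi0 h
    intro t ht
    obtain ⟨σ, hσ, h⟩ := main (min t 1) (by positivity) (min_le_right _ _)
    refine ⟨σ, hσ, ?_⟩
    intro r a b P h1 h2 h3 h4 h5 h6 h7 h8
    exact h r a b P h1 h2 h3 h4 h5 h6 h7 (h8.mono (min_le_left _ _))

end RothAux

set_option linter.all false

namespace RothAux

/-- box of exponents -/
def Jh (n : ℕ) : Finset (Fin 4 → ℕ) := Finset.piAntidiag Finset.univ n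
def JJ {m : ℕ} (r : Fin m → ℕ) : Finset (Fin m → Fin 4 → ℕ) := Fintype.piFinset fun h => Jh (r h)

lemma mem_Jh {n : ℕ} {j : Fin 4 → ℕ} : j ∈ Jh n ↔ ∑ k, j k = n := by
  simp [Jh, Finset.mem_piAntidiag]

lemma mem_JJ {m : ℕ} {r : Fin m → ℕ} {j : Fin m → Fin 4 → ℕ} : j ∈ JJ r ↔ ∀ h, ∑ k, j h k = r h := by
  simp [JJ, mem_Jh, Fintype.mem_piFinset]

lemma Jh_pos (n : ℕ) : 0 < (Jh n).card := by
  apply Finset.card_pos.2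
  refine ⟨fun k => if k = 0 then n else 0, ?_⟩
  rw [mem_Jh]; simp

lemma Jh_mean (n : ℕ) (l : Fin 4) : ∑ j ∈ Jh n, (j l : ℝ) = (Jh n).card * n / 4 := by
  have h1 : ∀ l, ∑ j ∈ Jh n, (j l : ℝ) = ∑ j ∈ Jh n, (j 0 : ℝ) := by
    intro l
    refine Finset.sum_bij' (fun j _ => j ∘ Equiv.swap 0 l) (fun j _ => j ∘ Equiv.swap 0 l) ?_ ?_ ?_ ?_ ?_
    · intro j hj
      rw [mem_Jh] at hj ⊢
      rw [← hj]; exact Equiv.sum_comp (Equiv.swap 0 l) j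
    · intro j hj
      rw [mem_Jh] at hj ⊢
      rw [← hj]; exact Equiv.sum_comp (Equiv.swap 0 l) j
    · intro j _; funext k; simp
    · intro j _; funext k; simp
    · intro j _; simp
  have h2 : ∑ l : Fin 4, ∑ j ∈ Jh n, (j l : ℝ) = (Jh n).card * n := by
    rw [Finset.sum_comm]
    rw [Finset.sum_congr rfl (g := fun _ => (n : ℝ))]
    · simp
    · intro j hj
      rw [mem_Jh] at hj
      rw [← hj]; push_cast; rfl
  simp only [h1] at h2 ⊢
  simp at h2
  linarith

lemma exp_quad (y : ℝ) (h : |y| ≤ 1) : Real.exp y ≤ 1 + y + y^2 := by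
  have := Real.abs_exp_sub_one_sub_id_le h
  have := (abs_le.1 this).2
  linarith

/-- the weighted sum -/
noncomputable def Zf {m : ℕ} (r : Fin m → ℕ) (e : Fin m → Fin 4 → ℝ) (j : Fin m → Fin 4 → ℕ) : ℝ :=
  ∑ h, ∑ l, e h l * (j h l : ℝ) / r h

lemma one_h (δ0 lam : ℝ) (hδ : 0 < δ0) (hδ1 : δ0 ≤ 1) (hl : lam = δ0 / 256) (n : ℕ) (hn : 0 < n) (e : Fin 4 → ℝ)
    (he : ∀ l, |e l| ≤ 4) (hs : ∑ l, e l ≤ -δ0) :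
    ∑ j ∈ Jh n, Real.exp (lam * ∑ l, e l * (j l : ℝ) / n) ≤ (Jh n).card * Real.exp (-lam * δ0 / 4 + 16 * lam^2) := by
  have hn' : (0:ℝ) < n := by exact_mod_cast hn
  have hlam : 0 < lam := by rw [hl]; positivity
  have hZ : ∀ j ∈ Jh n, |∑ l, e l * (j l : ℝ) / n| ≤ 4 := by
    intro j hj
    rw [mem_Jh] at hj
    have hj' : ∑ k, (j k : ℝ) = n := by exact_mod_cast hj
    refine (Finset.abs_sum_le_sum_abs _ _).trans ?_
    have : ∀ l ∈ (Finset.univ : Finset (Fin 4)), |e l * (j l : ℝ) / n| ≤ 4 * ((j l : ℝ) / n) := by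
      intro l _
      rw [mul_div_assoc, abs_mul, abs_of_nonneg (show (0:ℝ) ≤ (j l : ℝ) / n by positivity)]
      exact mul_le_mul_of_nonneg_right (he l) (by positivity)
    refine (Finset.sum_le_sum this).trans ?_
    rw [← Finset.mul_sum, ← Finset.sum_div, hj', div_self hn'.ne']; norm_num
  have h1 : ∀ j ∈ Jh n, Real.exp (lam * ∑ l, e l * (j l : ℝ) / n) ≤ 1 + 16 * lam^2 + lam * ∑ l, e l * (j l : ℝ) / n := by
    intro j hj
    have hz := hZ j hj
    set z := ∑ l, e l * (j l : ℝ) / n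
    have h2 : |lam * z| ≤ 1 := by
      rw [abs_mul, abs_of_pos hlam]
      have : lam * |z| ≤ lam * 4 := mul_le_mul_of_nonneg_left hz hlam.le
      rw [hl] at this ⊢; linarith
    have h3 := exp_quad _ h2
    have h4 : (lam * z)^2 ≤ 16 * lam^2 := by
      have : z^2 ≤ 16 := by
        have := sq_le_sq' (by linarith [(abs_le.1 hz).1]) (abs_le.1 hz).2
        linarith
      nlinarith [sq_nonneg lam]
    linarith
  refine (Finset.sum_le_sum h1).trans ?_
  rw [Finset.sum_add_distrib, ← Finset.mul_sum, Finset.sum_comm]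
  have h2 : ∀ l ∈ (Finset.univ : Finset (Fin 4)), ∑ j ∈ Jh n, e l * (j l : ℝ) / n = e l * ((Jh n).card / 4) := by
    intro l _
    rw [← Finset.sum_div, ← Finset.mul_sum, Jh_mean]; field_simp
  rw [Finset.sum_congr rfl h2, ← Finset.sum_mul]
  simp only [Finset.sum_const, nsmul_eq_mul]
  have hc : (0:ℝ) < (Jh n).card := by exact_mod_cast Jh_pos n
  have h3 := Real.add_one_le_exp (-lam * δ0 / 4 + 16 * lam^2)
  have h4 : lam * ((∑ l, e l) * ((Jh n).card / 4)) ≤ lam * (-δ0 * ((Jh n).card / 4)) := by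
    apply mul_le_mul_of_nonneg_left _ hlam.le
    exact mul_le_mul_of_nonneg_right hs (by positivity)
  have h5 := mul_le_mul_of_nonneg_left h3 hc.le
  linarith

lemma count (δ0 : ℝ) (hδ : 0 < δ0) (hδ1 : δ0 ≤ 1) (D : ℕ) (hD : 0 < D) : ∃ m : ℕ, 0 < m ∧ ∀ (r : Fin m → ℕ) (e : Fin m → Fin 4 → ℝ),
    (∀ h, 0 < r h) → (∀ h l, |e h l| ≤ 4) → (∀ h, ∑ l, e h l ≤ -δ0) → 
    2 * D * ((JJ r).filter (fun j => -(m * (δ0 / 8)) < Zf r e j)).card ≤ (JJ r).card := by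
  classical
  obtain ⟨m, hm⟩ := exists_nat_gt (Real.log (2 * D) / (δ0^2/4096))
  have hlogpos : 0 ≤ Real.log (2 * D) := Real.log_nonneg (by
    have : (1:ℝ) ≤ D := by exact_mod_cast hD
    linarith)
  have hm0 : 0 < m := by
    have : (0:ℝ) < m := lt_of_le_of_lt (by positivity) hm
    exact_mod_cast this
  refine ⟨m, hm0, ?_⟩
  intro r e hr he hs
  set lam := δ0 / 256 with hl
  have hlam : 0 < lam := by positivity
  have key : (((JJ r).filter (fun j => -(m * (δ0 / 8)) < Zf r e j)).card : ℝ) ≤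
      (JJ r).card * Real.exp (-(m * (δ0^2/4096))) := by
    let G : (Fin m → Fin 4 → ℕ) → ℝ := fun j => Real.exp (lam * (m * (δ0/8))) * ∏ h, Real.exp (lam * ∑ l, e h l * (j h l : ℝ) / r h)
    have hG0 : ∀ j, 0 ≤ G j := fun j => by positivity
    have hG1 : ∀ j ∈ (JJ r).filter (fun j => -(m * (δ0 / 8)) < Zf r e j), 1 ≤ G j := by
      intro j hj
      have hj2 := (Finset.mem_filter.1 hj).2
      show 1 ≤ Real.exp (lam * (m * (δ0/8))) * ∏ h, Real.exp (lam * ∑ l, e h l * (j h l : ℝ) / r h)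
      rw [← Real.exp_sum, ← Real.exp_add, ← Finset.mul_sum, ← mul_add]
      apply Real.one_le_exp
      apply mul_nonneg hlam.le
      rw [Zf] at hj2
      linarith
    have h1 : (((JJ r).filter (fun j => -(m * (δ0 / 8)) < Zf r e j)).card : ℝ) ≤ ∑ j ∈ JJ r, G j := by
      have h2 := Finset.card_nsmul_le_sum _ _ _ hG1
      rw [nsmul_eq_mul, mul_one] at h2
      exact h2.trans (Finset.sum_le_sum_of_subset_of_nonneg (Finset.filter_subset _ _) (fun j _ _ => hG0 j))
    have hGs : ∑ j ∈ JJ r, G j = Real.exp (lam * (m * (δ0/8))) * ∏ h, ∑ j ∈ Jh (r h), Real.exp (lam * ∑ l, e h l * (j l : ℝ) / r h) := by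
      rw [Finset.prod_univ_sum, Finset.mul_sum]; rfl
    refine h1.trans ?_
    rw [hGs]
    have h2 : ∏ h, ∑ j ∈ Jh (r h), Real.exp (lam * ∑ l, e h l * (j l : ℝ) / r h) ≤
        ∏ h : Fin m, (((Jh (r h)).card : ℝ) * Real.exp (-lam * δ0 / 4 + 16 * lam^2)) := by
      apply Finset.prod_le_prod
      · intro h _; positivity
      · intro h _; exact one_h δ0 lam hδ hδ1 hl (r h) (hr h) (e h) (he h) (hs h)
    refine (mul_le_mul_of_nonneg_left h2 (by positivity)).trans ?_
    rw [Finset.prod_mul_distrib, Finset.prod_const, Finset.card_univ, Fintype.card_fin, JJ, Fintype.card_piFinset,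
      ← Real.exp_nat_mul, Nat.cast_prod, mul_left_comm, ← Real.exp_add]
    apply le_of_eq
    congr 2
    rw [hl]; ring
  have h3 : Real.exp (-(m * (δ0^2/4096))) ≤ 1 / (2 * D) := by
    have h4 : Real.log (2 * D) ≤ m * (δ0^2/4096) := by
      rw [div_lt_iff₀ (by positivity)] at hm; linarith
    rw [Real.exp_neg, one_div]
    have hD' : (0:ℝ) < D := by exact_mod_cast hD
    apply inv_anti₀ (by positivity)
    rw [← Real.log_le_iff_le_exp (by positivity)]; exact h4
  have h4 := key.trans (mul_le_mul_of_nonneg_left h3 (Nat.cast_nonneg _))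
  have hD' : (0:ℝ) < D := by exact_mod_cast hD
  rw [mul_one_div, le_div_iff₀ (by positivity)] at h4
  have : ((2 * D * ((JJ r).filter (fun j => -(m * (δ0 / 8)) < Zf r e j)).card : ℕ) : ℝ) ≤ ((JJ r).card : ℕ) := by
    push_cast; linarith
  exact_mod_cast this

lemma card_JJ_le {m : ℕ} (r : Fin m → ℕ) : (JJ r).card ≤ 16 ^ (∑ h, r h) := by
  classical
  rw [JJ, Fintype.card_piFinset, ← Finset.prod_pow_eq_pow_sum]
  apply Finset.prod_le_prod'
  intro h _
  have h1 : Jh (r h) ⊆ Fintype.piFinset fun _ : Fin 4 => Finset.range (r h + 1) := by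
    intro j hj
    rw [mem_Jh] at hj
    rw [Fintype.mem_piFinset]
    intro k
    rw [Finset.mem_range, ← hj]
    exact Nat.lt_succ_of_le (Finset.single_le_sum (f := j) (fun _ _ => Nat.zero_le _) (Finset.mem_univ k))
  refine (Finset.card_le_card h1).trans ?_
  rw [Fintype.card_piFinset]
  simp only [Finset.card_range, Finset.prod_const, Finset.card_univ, Fintype.card_fin]
  calc (r h + 1)^4 ≤ (2 ^ (r h))^4 := Nat.pow_le_pow_left (Nat.lt_two_pow_self) 4
    _ = 16 ^ (r h) := by rw [← pow_mul, mul_comm, pow_mul]; norm_num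

end RothAux

set_option linter.all false

namespace RothAux
open MvPolynomial

lemma pow_rep (η : ℝ) (n : ℕ) (p : Fin (n+1) → ℤ) (h : η^(n+1) = ∑ i, (p i : ℝ) * η^(i:ℕ)) (K : ℝ) (hK : ∀ i, |(p i : ℝ)| + 1 ≤ K) :
    ∀ k : ℕ, ∃ u : Fin (n+1) → ℤ, η^k = ∑ i, (u i : ℝ) * η^(i:ℕ) ∧ ∀ i, |(u i : ℝ)| ≤ K^k := by
  have hK1 : 1 ≤ K := by have := hK 0; have := abs_nonneg (p 0 : ℝ); linarith
  intro k
  induction k with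
  | zero =>
    refine ⟨fun i => if i = 0 then 1 else 0, ?_, ?_⟩
    · simp
    · intro i; by_cases hi : i = 0 <;> simp [hi]
  | succ k ih =>
    obtain ⟨u, hu, hb⟩ := ih
    refine ⟨fun i => (Fin.cons 0 (fun j : Fin n => u j.castSucc) : Fin (n+1) → ℤ) i + u (Fin.last n) * p i, ?_, ?_⟩
    · have h1 : ∑ i, (((Fin.cons 0 (fun j : Fin n => u j.castSucc) : Fin (n+1) → ℤ) i : ℤ) : ℝ) * η^(i:ℕ)
          = ∑ j : Fin n, (u j.castSucc : ℝ) * η^((j:ℕ)+1) := by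
        rw [Fin.sum_univ_succ]; simp
      push_cast
      simp only [add_mul, Finset.sum_add_distrib]
      rw [h1]
      have h2 : ∑ x, (u (Fin.last n) : ℝ) * (p x : ℝ) * η^(x:ℕ) = u (Fin.last n) * η^(n+1) := by
        rw [h, Finset.mul_sum]; simp only [mul_assoc]
      rw [h2, pow_succ, hu, Fin.sum_univ_castSucc, add_mul, Finset.sum_mul]
      simp only [Fin.val_castSucc, Fin.val_last, pow_succ]
      simp only [mul_assoc]
    · intro i
      have h3 : |(((Fin.cons 0 (fun j : Fin n => u j.castSucc) : Fin (n+1) → ℤ) i : ℤ) : ℝ)| ≤ K^k := by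
        refine Fin.cases ?_ (fun j => ?_) i
        · simp; positivity
        · simp; exact hb _
      have h4 := hb (Fin.last n)
      push_cast
      refine (abs_add_le _ _).trans ?_
      rw [abs_mul, pow_succ]
      have h5 : |(u (Fin.last n) : ℝ)| * |(p i : ℝ)| ≤ K^k * (K - 1) :=
        mul_le_mul h4 (by linarith [hK i]) (abs_nonneg _) (by positivity)
      linarith

lemma theta_rep (θ : ℝ) (hθ : IsAlgebraic ℚ θ) : ∃ (D : ℕ) (a : ℤ) (η : ℝ) (K : ℝ), 0 < D ∧ a ≠ 0 ∧ 1 ≤ K ∧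
    ∀ (N : ℕ) (Q : MvPolynomial (Fin 1) ℤ), degreeOf 0 Q ≤ N → ∃ c : Fin D → ℤ,
      (a:ℝ)^N * aeval (fun _ => θ) Q = ∑ i, (c i : ℝ) * η^(i:ℕ) ∧ ∀ i, |(c i : ℝ)| ≤ K^N * L Q := by
  have h1 : IsAlgebraic ℤ θ := (IsFractionRing.isAlgebraic_iff ℤ ℚ ℝ).2 hθ
  obtain ⟨a, ha, hintg⟩ := h1.exists_integral_multiple
  obtain ⟨p, hp, hpη⟩ := hintg
  have hD : 0 < p.natDegree := by
    by_contra hcon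
    have : p = 1 := Polynomial.Monic.natDegree_eq_zero hp |>.1 (by omega)
    rw [this] at hpη
    simp at hpη
  obtain ⟨n, hn⟩ : ∃ n, p.natDegree = n + 1 := ⟨_, (Nat.succ_pred_eq_of_pos hD).symm⟩
  set η : ℝ := a • θ with hη
  have hη' : η = a * θ := by simp [hη]
  have hrel : η^(n+1) = ∑ i : Fin (n+1), ((-(p.coeff i) : ℤ) : ℝ) * η^(i:ℕ) := by
    rw [Polynomial.eval₂_eq_sum_range, hn, Finset.sum_range_succ, ← hn, Polynomial.Monic.coeff_natDegree hp, hn] at hpη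
    rw [Fin.sum_univ_eq_sum_range (fun i => ((-(p.coeff i) : ℤ) : ℝ) * η^i)]
    simp at hpη ⊢
    linarith
  let K0 : ℝ := 1 + ∑ i : Fin (n+1), |((-(p.coeff i) : ℤ) : ℝ)|
  have hK0 : ∀ i : Fin (n+1), |((-(p.coeff i) : ℤ) : ℝ)| + 1 ≤ K0 := by
    intro i
    have := Finset.single_le_sum (f := fun i : Fin (n+1) => |((-(p.coeff i) : ℤ) : ℝ)|) (fun _ _ => abs_nonneg _) (Finset.mem_univ i)
    simp only [K0]; linarith
  have hK1 : 1 ≤ K0 := by have := hK0 0; have := abs_nonneg (((-(p.coeff (0 : Fin (n+1))) : ℤ) : ℝ)); linarith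
  choose u hu hub using pow_rep η n _ hrel K0 hK0
  have ha1 : (1:ℝ) ≤ |(a:ℝ)| := by exact_mod_cast Int.one_le_abs ha
  refine ⟨n+1, a, η, |(a:ℝ)| * K0, Nat.succ_pos n, ha, ?_, ?_⟩
  · nlinarith
  intro N Q hQ
  rw [degreeOf_le_iff] at hQ
  refine ⟨fun i => ∑ d ∈ Q.support, coeff d Q * a^(N - d 0) * u (d 0) i, ?_, ?_⟩
  · rw [aeval_def, eval₂_eq', Finset.mul_sum]
    push_cast
    simp only [Finset.sum_mul]
    rw [Finset.sum_comm]
    apply Finset.sum_congr rfl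
    intro d hd
    have h2 : ∑ i, ((coeff d Q : ℤ) : ℝ) * (a:ℝ)^(N - d 0) * (u (d 0) i : ℝ) * η^(i:ℕ) =
        ((coeff d Q : ℤ) : ℝ) * (a:ℝ)^(N - d 0) * η^(d 0) := by
      rw [hu (d 0), Finset.mul_sum]; simp only [mul_assoc]
    rw [h2, hη', mul_pow]
    have h3 : (a:ℝ)^N = a^(N - d 0) * a^(d 0) := by rw [← pow_add, Nat.sub_add_cancel (hQ d hd)]
    rw [h3]; simp; ring
  · intro i
    push_cast
    refine (Finset.abs_sum_le_sum_abs _ _).trans ?_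
    rw [L_eq, Finset.mul_sum]
    apply Finset.sum_le_sum
    intro d hd
    rw [abs_mul, abs_mul, abs_pow, mul_pow]
    have h4 : |(a:ℝ)|^(N - d 0) ≤ |(a:ℝ)|^N := pow_le_pow_right₀ ha1 (Nat.sub_le _ _)
    have h5 : |(u (d 0) i : ℝ)| ≤ K0^N := (hub _ i).trans (pow_le_pow_right₀ hK1 (hQ d hd))
    calc |((coeff d Q : ℤ) : ℝ)| * |(a:ℝ)|^(N - d 0) * |(u (d 0) i : ℝ)| ≤ |((coeff d Q : ℤ) : ℝ)| * |(a:ℝ)|^N * K0^N := by gcongr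
      _ = _ := by ring

/-! majorants -/
section maj
variable {ι : Type*}

def Maj (θ : ℝ) (N : ℕ) (G Gp : MvPolynomial ι ℝ) : Prop :=
  ∀ d, ∃ Q : MvPolynomial (Fin 1) ℤ, degreeOf 0 Q ≤ N ∧ coeff d G = aeval (fun _ => θ) Q ∧ L Q ≤ coeff d Gp

lemma Maj.mul {θ : ℝ} {N N' : ℕ} {G Gp G' Gp' : MvPolynomial ι ℝ} (h : Maj θ N G Gp) (h' : Maj θ N' G' Gp') :
    Maj θ (N + N') (G * G') (Gp * Gp') := by
  classical
  intro d
  choose Q hQ1 hQ2 hQ3 using h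
  choose Q' hQ1' hQ2' hQ3' using h'
  refine ⟨∑ x ∈ Finset.HasAntidiagonal.antidiagonal d, Q x.1 * Q' x.2, ?_, ?_, ?_⟩
  · refine (degreeOf_sum_le _ _ _).trans (Finset.sup_le ?_)
    intro x _
    exact (degreeOf_mul_le _ _ _).trans (add_le_add (hQ1 _) (hQ1' _))
  · rw [coeff_mul, map_sum]
    simp only [map_mul, hQ2, hQ2']
  · rw [coeff_mul]
    refine (L_sum_le _ _).trans (Finset.sum_le_sum ?_)
    intro x _
    exact (L_mul_le _ _).trans (mul_le_mul (hQ3 _) (hQ3' _) (L_nonneg _) ((L_nonneg _).trans (hQ3 _)))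

lemma L_zero : L (0 : MvPolynomial ι ℤ) = 0 := by simp [L]
lemma L_one : L (1 : MvPolynomial ι ℤ) = 1 := by
  have := L_monomial (0 : ι →₀ ℕ) 1
  simpa using this

lemma Maj.one (θ : ℝ) : Maj θ 0 (1 : MvPolynomial ι ℝ) 1 := by
  classical
  intro d
  by_cases h : d = 0
  · subst h; refine ⟨1, ?_, ?_, ?_⟩ <;> simp [L_one]
  · refine ⟨0, ?_, ?_, ?_⟩ <;> simp [coeff_one, Ne.symm h, L_zero]

lemma Maj.pow {θ : ℝ} {N : ℕ} {G Gp : MvPolynomial ι ℝ} (h : Maj θ N G Gp) (n : ℕ) :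
    Maj θ (n * N) (G ^ n) (Gp ^ n) := by
  induction n with
  | zero => simpa using Maj.one θ
  | succ n ih => rw [pow_succ, pow_succ, Nat.succ_mul]; exact ih.mul h

lemma Maj.prod {κ : Type*} (s : Finset κ) {θ : ℝ} {N : κ → ℕ} {G Gp : κ → MvPolynomial ι ℝ} (h : ∀ k, Maj θ (N k) (G k) (Gp k)) :
    Maj θ (∑ k ∈ s, N k) (∏ k ∈ s, G k) (∏ k ∈ s, Gp k) := by
  classical
  induction s using Finset.induction_on with
  | empty => simpa using Maj.one θ
  | insert a s ha ih => rw [Finset.prod_insert ha, Finset.prod_insert ha, Finset.sum_insert ha]; exact (h a).mul ih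

end maj

def LM (θ : ℝ) : Fin 4 → Fin 4 → ℝ := ![![1,0,θ,0],![-θ,1,-θ^2,θ],![0,0,1,0],![0,0,-θ,1]]

noncomputable def LQ : Fin 4 → Fin 4 → MvPolynomial (Fin 1) ℤ :=
  ![![1,0,X 0,0],![-X 0,1,-(X 0)^2,X 0],![0,0,1,0],![0,0,-X 0,1]]

lemma LQ_eval (θ : ℝ) (k l : Fin 4) : aeval (fun _ => θ) (LQ k l) = LM θ k l := by
  fin_cases k <;> fin_cases l <;> simp [LQ, LM]

lemma L_neg {ι : Type*} (P : MvPolynomial ι ℤ) : L (-P) ≤ L P := by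
  rw [L, map_neg]; exact l1_neg _
lemma L_X {ι : Type*} (i : ι) : L (X i : MvPolynomial ι ℤ) = 1 := by
  rw [X, L_monomial]; simp

lemma LQ_L (k l : Fin 4) : L (LQ k l) ≤ 1 := by
  have h1 := L_neg (X 0 : MvPolynomial (Fin 1) ℤ)
  have h2 := L_neg ((X 0)^2 : MvPolynomial (Fin 1) ℤ)
  have h3 : L ((X 0)^2 : MvPolynomial (Fin 1) ℤ) ≤ 1 := by
    rw [pow_two]; refine (L_mul_le _ _).trans ?_; rw [L_X]; norm_num
  have h4 := L_X (0 : Fin 1)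
  rw [h4] at h1
  fin_cases k <;> fin_cases l <;> simp [LQ, L_one, L_zero] <;> linarith

lemma LQ_deg (k l : Fin 4) : degreeOf 0 (LQ k l) ≤ 2 := by
  have hX : degreeOf 0 (X 0 : MvPolynomial (Fin 1) ℤ) ≤ 1 := by simp
  have hX2 : degreeOf 0 ((X 0)^2 : MvPolynomial (Fin 1) ℤ) ≤ 2 := (degreeOf_pow_le _ _ _).trans (by omega)
  have h0 : degreeOf 0 (1 : MvPolynomial (Fin 1) ℤ) = 0 := by simp
  fin_cases k <;> fin_cases l <;> simp [LQ] <;> first | omega | simp [degreeOf]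

end RothAux

set_option linter.all false

namespace RothAux
open MvPolynomial

/-- multi-degree weights -/
def wv (m : ℕ) (κ : Type) : Fin m × κ → (Fin m → ℕ) := fun v => Pi.single v.1 1

noncomputable def toF {m : ℕ} (j : Fin m → Fin 4 → ℕ) : Fin m × Fin 4 →₀ ℕ :=
  Finsupp.equivFunOnFinite.symm (fun v => j v.1 v.2)

lemma toF_apply {m : ℕ} (j : Fin m → Fin 4 → ℕ) (v) : toF j v = j v.1 v.2 := rfl
lemma toF_inj {m : ℕ} : Function.Injective (toF (m := m)) := by
  intro j j' h
  funext h' k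
  exact DFunLike.congr_fun h (h', k)
lemma toF_surj {m : ℕ} (d : Fin m × Fin 4 →₀ ℕ) : toF (fun h k => d (h,k)) = d := by
  ext v; rfl

lemma weight_wv {m : ℕ} {κ : Type} [Fintype κ] (d : Fin m × κ →₀ ℕ) (h : Fin m) :
    Finsupp.weight (wv m κ) d h = ∑ k, d (h,k) := by
  classical
  rw [Finsupp.weight_apply, Finsupp.sum_fintype _ _ (by simp), Finset.sum_apply, Fintype.sum_prod_type]
  rw [Finset.sum_eq_single h]
  · simp [wv]
  · intro b _ hb
    apply Finset.sum_eq_zero; intro k _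
    simp [wv, Pi.single_apply, Ne.symm hb]
  · simp

noncomputable def phi {m : ℕ} (θ : ℝ) : MvPolynomial (Fin m × Fin 4) ℝ →ₐ[ℝ] MvPolynomial (Fin m × Fin 4) ℝ :=
  aeval (fun v => ∑ l, C (LM θ v.2 l) * X (v.1, l))

lemma phi_X {m : ℕ} (θ : ℝ) (v : Fin m × Fin 4) : phi θ (X v) = ∑ l, C (LM θ v.2 l) * X (v.1, l) := by simp [phi]

lemma phi_mon {m : ℕ} (θ : ℝ) (d : Fin m × Fin 4 →₀ ℕ) (c : ℝ) :
    phi θ (monomial d c) = C c * ∏ v, (∑ l, C (LM θ v.2 l) * X (v.1, l)) ^ d v := by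
  rw [phi, aeval_monomial, Finsupp.prod_fintype _ _ (by simp)]; rfl

lemma phi_MH {m : ℕ} (θ : ℝ) (P : MvPolynomial (Fin m × Fin 4) ℝ) (r : Fin m → ℕ)
    (hP : IsWeightedHomogeneous (wv m (Fin 4)) P r) : IsWeightedHomogeneous (wv m (Fin 4)) (phi θ P) r := by
  rw [as_sum P, map_sum]
  apply IsWeightedHomogeneous.sum
  intro d hd
  have h1 := hP (mem_support_iff.1 hd)
  rw [phi_mon]
  have h2 : IsWeightedHomogeneous (wv m (Fin 4)) (∏ v, (∑ l, C (LM θ v.2 l) * X (v.1, l)) ^ d v : MvPolynomial (Fin m × Fin 4) ℝ) (∑ v, d v • wv m (Fin 4) v) := by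
    apply IsWeightedHomogeneous.prod
    intro v _
    apply IsWeightedHomogeneous.pow
    apply IsWeightedHomogeneous.sum
    intro l _
    have := (isWeightedHomogeneous_C (wv m (Fin 4)) (LM θ v.2 l)).mul (isWeightedHomogeneous_X ℝ (wv m (Fin 4)) (v.1, l))
    rw [zero_add] at this
    exact this
  have h3 := (isWeightedHomogeneous_C (wv m (Fin 4)) (coeff d P)).mul h2
  rw [zero_add] at h3
  convert h3 using 1
  rw [← h1, Finsupp.weight_apply, Finsupp.sum_fintype _ _ (by simp)]

lemma maj_form {m : ℕ} (θ : ℝ) (v : Fin m × Fin 4) :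
    Maj θ 2 (∑ l, C (LM θ v.2 l) * X (v.1, l) : MvPolynomial (Fin m × Fin 4) ℝ) (∑ l, X (v.1, l)) := by
  classical
  intro d
  by_cases h : ∃ l, d = Finsupp.single (v.1, l) 1
  · obtain ⟨l, rfl⟩ := h
    have h1 : ∀ x : Fin 4, (Finsupp.single ((v.1, x) : Fin m × Fin 4) (1:ℕ) = Finsupp.single (v.1, l) 1) ↔ x = l := by
      intro x
      rw [Finsupp.single_left_inj (by norm_num)]; simp
    refine ⟨LQ v.2 l, LQ_deg _ _, ?_, ?_⟩
    · rw [LQ_eval, coeff_sum]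
      simp [coeff_C_mul, coeff_X', h1]
    · rw [coeff_sum]
      simp [coeff_X', h1]
      exact LQ_L _ _
  · have h1 : ∀ x : Fin 4, ¬ (Finsupp.single ((v.1, x) : Fin m × Fin 4) (1:ℕ) = d) := fun x hx => h ⟨x, hx.symm⟩
    refine ⟨0, by simp, ?_, ?_⟩ <;> rw [coeff_sum] <;> simp [coeff_C_mul, coeff_X', h1, L_zero]

lemma maj_mon {m : ℕ} (θ : ℝ) (r : Fin m → ℕ) (j : Fin m → Fin 4 → ℕ) (hj : j ∈ JJ r) (d : Fin m × Fin 4 →₀ ℕ) :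
    ∃ Q : MvPolynomial (Fin 1) ℤ, degreeOf 0 Q ≤ 2 * ∑ h, r h ∧ coeff d (phi θ (monomial (toF j) 1)) = aeval (fun _ => θ) Q
      ∧ L Q ≤ 4 ^ (∑ h, r h) := by
  have h1 := Maj.prod (θ := θ) Finset.univ (N := fun v => toF j v * 2) (fun v : Fin m × Fin 4 => (maj_form θ v).pow (toF j v))
  obtain ⟨Q, hQ1, hQ2, hQ3⟩ := h1 d
  have hs : ∑ v, toF j v = ∑ h, r h := by
    rw [Fintype.sum_prod_type]
    apply Finset.sum_congr rfl
    intro h _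
    exact (mem_JJ.1 hj) h
  refine ⟨Q, ?_, ?_, ?_⟩
  · rw [← Finset.sum_mul, hs] at hQ1; linarith
  · rw [phi_mon]; simpa using hQ2
  · refine hQ3.trans ((le_abs_self _).trans ((coeff_le_l1 _ _).trans ?_))
    refine (l1_prod_le _ _).trans ?_
    rw [← hs, ← Finset.prod_pow_eq_pow_sum]
    apply Finset.prod_le_prod
    · intro v _; exact l1_nonneg _
    · intro v _
      refine (l1_pow_le _ _).trans (pow_le_pow_left₀ (l1_nonneg _) ?_ _)
      refine (l1_sum_le _ _).trans ?_
      simp [l1_X]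

lemma JJ_ne {m : ℕ} (r : Fin m → ℕ) : (JJ r).Nonempty := by
  rw [JJ, Fintype.piFinset_nonempty]
  intro h; exact Finset.card_pos.1 (Jh_pos _)

attribute [local instance] Matrix.seminormedAddCommGroup

lemma siegel1 {α β : Type} [Fintype α] [Fintype β] [DecidableEq α] (A : Matrix α β ℤ) (K : ℝ) (hK : 1 ≤ K)
    (hA : ∀ i j, |(A i j : ℝ)| ≤ K) (hc : 2 * Fintype.card α ≤ Fintype.card β) (hm : 0 < Fintype.card α) :
    ∃ t : β → ℤ, t ≠ 0 ∧ A.mulVec t = 0 ∧ ∀ j, |(t j : ℝ)| ≤ Fintype.card β * K := by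
  obtain ⟨t, ht, hAt, hb⟩ := Int.Matrix.exists_ne_zero_int_vec_norm_le A (by omega) hm
  refine ⟨t, ht, hAt, fun j => ?_⟩
  have h1 : ‖A‖ ≤ K := by
    rw [Matrix.norm_le_iff (by linarith)]
    intro i j; rw [Int.norm_eq_abs]; exact hA i j
  have h2 : |(t j : ℝ)| ≤ ‖t‖ := by rw [← Int.norm_eq_abs]; exact norm_le_pi_norm t j
  have hn : (1:ℝ) ≤ Fintype.card β := by
    have : 1 ≤ Fintype.card β := by omega
    exact_mod_cast this
  have hc' : (2:ℝ) * Fintype.card α ≤ Fintype.card β := by exact_mod_cast hc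
  have hm' : (0:ℝ) < Fintype.card α := by exact_mod_cast hm
  refine h2.trans (hb.trans ?_)
  have h3 : (1:ℝ) ≤ Fintype.card β * max 1 ‖A‖ := by
    have := le_max_left 1 ‖A‖
    nlinarith
  calc _ ≤ ((Fintype.card β : ℝ) * max 1 ‖A‖) ^ (1:ℝ) := by
        apply Real.rpow_le_rpow_of_exponent_le h3
        rw [div_le_one (by linarith)]; linarith
    _ = Fintype.card β * max 1 ‖A‖ := Real.rpow_one _
    _ ≤ _ := by
      apply mul_le_mul_of_nonneg_left _ (by linarith)
      exact max_le hK h1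

theorem aux (θ : ℝ) (hθ : IsAlgebraic ℚ θ) : ∃ C : ℝ, 1 ≤ C ∧ ∀ δ0 : ℝ, 0 < δ0 → δ0 ≤ 1 → ∃ m : ℕ, 0 < m ∧
    ∀ (r : Fin m → ℕ) (e : Fin m → Fin 4 → ℝ), (∀ h, 0 < r h) → (∀ h l, |e h l| ≤ 4) → (∀ h, ∑ l, e h l ≤ -δ0) →
    ∃ P : MvPolynomial (Fin m × Fin 4) ℤ, P ≠ 0 ∧ IsWeightedHomogeneous (wv m (Fin 4)) P r ∧ L P ≤ C ^ (∑ h, r h) ∧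
      ∀ d : Fin m × Fin 4 →₀ ℕ, -(m * (δ0 / 8)) < Zf r e (fun h k => d (h,k)) →
        coeff d (phi θ (map (Int.castRingHom ℝ) P)) = 0 := by
  classical
  obtain ⟨D, a, η, K, hD, ha, hK, hrep⟩ := theta_rep θ hθ
  refine ⟨1024 * K^2, by nlinarith, ?_⟩
  intro δ0 hδ hδ1
  obtain ⟨m, hm, hcount⟩ := count δ0 hδ hδ1 D hD
  refine ⟨m, hm, ?_⟩
  intro r e hr he hs
  have hcnt := hcount r e hr he hs
  set bad := (JJ r).filter (fun j => -(m * (δ0 / 8)) < Zf r e j) with hbad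
  set R := ∑ h, r h with hR
  -- general construction
  have key : ∀ t : JJ r → ℤ, t ≠ 0 → (∀ j, |(t j : ℝ)| ≤ (64 * K^2)^R) → 
      (∀ j' ∈ bad, ∑ j : JJ r, (t j : ℝ) * coeff (toF j') (phi θ (monomial (toF j.1) 1)) = 0) →
      ∃ P : MvPolynomial (Fin m × Fin 4) ℤ, P ≠ 0 ∧ IsWeightedHomogeneous (wv m (Fin 4)) P r ∧ L P ≤ (1024 * K^2) ^ R ∧
      ∀ d : Fin m × Fin 4 →₀ ℕ, -(m * (δ0 / 8)) < Zf r e (fun h k => d (h,k)) →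
        coeff d (phi θ (map (Int.castRingHom ℝ) P)) = 0 := by
    intro t ht htb hz
    have hMH : IsWeightedHomogeneous (wv m (Fin 4)) (∑ j : JJ r, monomial (toF j.1) (t j)) r := by
      apply IsWeightedHomogeneous.sum
      intro j _
      apply isWeightedHomogeneous_monomial
      funext h
      rw [weight_wv]
      exact mem_JJ.1 j.2 h
    refine ⟨∑ j : JJ r, monomial (toF j.1) (t j), ?_, hMH, ?_, ?_⟩
    · intro h0
      apply ht
      funext j
      have := congrArg (coeff (toF j.1)) h0
      rw [coeff_sum, Finset.sum_eq_single j] at this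
      · simpa using this
      · intro b _ hb
        rw [coeff_monomial, if_neg]
        intro h; exact hb (Subtype.ext (toF_inj h))
      · simp
    · refine (L_sum_le _ _).trans ?_
      simp only [L_monomial]
      refine (Finset.sum_le_sum (fun j _ => htb j)).trans ?_
      have h16 : ((JJ r).card : ℝ) ≤ 16^R := by exact_mod_cast card_JJ_le r
      rw [Finset.sum_const, nsmul_eq_mul]
      have : (1024 * K^2)^R = 16^R * (64 * K^2)^R := by rw [← mul_pow]; ring
      rw [this]
      apply mul_le_mul_of_nonneg_right _ (by positivity)
      simpa using h16
    · intro d hd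
      have hmap : map (Int.castRingHom ℝ) (∑ j : JJ r, monomial (toF j.1) (t j)) = ∑ j : JJ r, C (t j : ℝ) * monomial (toF j.1) 1 := by
        rw [map_sum]; apply Finset.sum_congr rfl; intro j _
        rw [map_monomial, C_mul_monomial]; simp
      by_cases hdJ : (fun h k => d (h,k)) ∈ JJ r
      · have := hz (fun h k => d (h,k)) (by rw [hbad, Finset.mem_filter]; exact ⟨hdJ, hd⟩)
        rw [toF_surj] at this
        rw [hmap, map_sum, coeff_sum, ← this]
        apply Finset.sum_congr rfl
        intro j _
        have hC : phi θ (C (t j : ℝ) : MvPolynomial (Fin m × Fin 4) ℝ) = C (t j : ℝ) := by simp [phi]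
        rw [map_mul, hC, coeff_C_mul]
      · by_contra hne
        apply hdJ
        have h2 : IsWeightedHomogeneous (wv m (Fin 4)) (map (Int.castRingHom ℝ) (∑ j : JJ r, monomial (toF j.1) (t j))) r := by
          intro d' hd'
          apply hMH
          intro h0
          rw [coeff_map, h0] at hd'
          simp at hd'
        have := phi_MH θ _ r h2 hne
        rw [mem_JJ]
        intro h
        rw [← this, weight_wv]
  by_cases hb0 : bad = ∅
  · obtain ⟨j0, hj0⟩ := JJ_ne r
    refine key (fun j => if j = ⟨j0, hj0⟩ then 1 else 0) ?_ ?_ ?_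
    · intro h; have := congrFun h ⟨j0, hj0⟩; simp at this
    · intro j
      have : (1:ℝ) ≤ (64 * K^2)^R := one_le_pow₀ (by nlinarith)
      by_cases h : j = ⟨j0, hj0⟩ <;> simp [h]
      · exact this
      · positivity
    · intro j' hj'; rw [hb0] at hj'; simp at hj'
  · choose Q hQ1 hQ2 hQ3 using fun (j : JJ r) (j' : bad) => maj_mon θ r j.1 j.2 (toF j'.1)
    choose c hc1 hc2 using fun (j : JJ r) (j' : bad) => hrep (2 * R) (Q j j') (hQ1 j j')
    have hbc : 0 < bad.card := Finset.card_pos.2 (Finset.nonempty_iff_ne_empty.2 hb0)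
    obtain ⟨t, ht, hAt, htb⟩ := siegel1 (α := bad × Fin D) (β := JJ r) (Matrix.of fun x j => c j x.1 x.2) (K^(2*R) * 4^R)
      (by have h1 : (1:ℝ) ≤ K^(2*R) := one_le_pow₀ hK
          have h2 : (1:ℝ) ≤ 4^R := one_le_pow₀ (by norm_num)
          nlinarith)
      (by intro x j
          refine (hc2 j x.1 x.2).trans ?_
          apply mul_le_mul_of_nonneg_left (hQ3 _ _) (by positivity))
      (by have h' : 2 * D * bad.card ≤ (JJ r).card := hcnt
          simp; linarith)
      (by simp; exact ⟨by rwa [Finset.card_pos] at hbc, hD⟩)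
    apply key t ht
    · intro j
      refine (htb j).trans ?_
      have h16 : ((JJ r).card : ℝ) ≤ 16^R := by exact_mod_cast card_JJ_le r
      have : (64 * K^2)^R = 16^R * (K^(2*R) * 4^R) := by rw [pow_mul, ← mul_pow, ← mul_pow]; ring
      rw [this]
      apply mul_le_mul_of_nonneg_right _ (by positivity)
      simpa using h16
    · intro j' hj'
      have h1 : ∀ i, ∑ j : JJ r, c j ⟨j', hj'⟩ i * t j = 0 := by
        intro i
        have := congrFun hAt (⟨j', hj'⟩, i)
        simpa [Matrix.mulVec, dotProduct] using this
      have ha' : (a:ℝ)^(2*R) ≠ 0 := pow_ne_zero _ (by exact_mod_cast ha)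
      apply mul_left_cancel₀ ha'
      rw [mul_zero, Finset.mul_sum]
      have h2 : ∀ j : JJ r, (a:ℝ)^(2*R) * ((t j : ℝ) * coeff (toF j') (phi θ (monomial (toF j.1) 1))) = ∑ i, (t j : ℝ) * ((c j ⟨j', hj'⟩ i : ℝ) * η^(i:ℕ)) := by
        intro j
        rw [← Finset.mul_sum, ← hc1, hQ2 j ⟨j', hj'⟩]; ring
      simp only [h2]
      rw [Finset.sum_comm]
      apply Finset.sum_eq_zero
      intro i _
      have h3 : ∑ j : JJ r, (t j : ℝ) * ((c j ⟨j', hj'⟩ i : ℝ) * η^(i:ℕ)) = ((∑ j : JJ r, c j ⟨j', hj'⟩ i * t j : ℤ) : ℝ) * η^(i:ℕ) := by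
        push_cast; rw [Finset.sum_mul]; apply Finset.sum_congr rfl; intro j _; ring
      rw [h3, h1 i]; simp

end RothAux

set_option linter.all false

namespace RothAux
open MvPolynomial

noncomputable def up {m : ℕ} (i : Fin m →₀ ℕ) : Fin m × Fin 4 →₀ ℕ :=
  Finsupp.equivFunOnFinite.symm (fun v => if v.2 = 1 then i v.1 else 0)

lemma up_apply {m : ℕ} (i : Fin m →₀ ℕ) (v) : up i v = if v.2 = 1 then i v.1 else 0 := rfl
lemma up_add {m : ℕ} (i j : Fin m →₀ ℕ) : up (i + j) = up i + up j := by
  ext v; simp only [up_apply, Finsupp.add_apply]; split_ifs <;> simp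
lemma up_single {m : ℕ} (h : Fin m) : up (Finsupp.single h 1) = Finsupp.single (h, 1) 1 := by
  classical
  ext v
  obtain ⟨x, k⟩ := v
  rw [up_apply]
  by_cases hk : k = 1
  · subst hk; simp [Finsupp.single_apply]
  · have : ¬ ((h, (1 : Fin 4)) = (x, k)) := by rintro ⟨⟩; exact hk rfl
    rw [Finsupp.single_eq_of_ne' this]; simp [hk]

lemma phi_pderiv {m : ℕ} (θ : ℝ) (h : Fin m) (P : MvPolynomial (Fin m × Fin 4) ℝ) :
    phi θ (pderiv (h, 1) P) = pderiv (h, 1) (phi θ P) := by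
  classical
  induction P using MvPolynomial.induction_on with
  | C a => simp [phi]
  | add p q hp hq => simp only [map_add, hp, hq]
  | mul_X p j hp =>
    rw [Derivation.leibniz, map_add, map_mul, Derivation.leibniz, smul_eq_mul, smul_eq_mul,
      map_mul, smul_eq_mul, map_mul, hp, smul_eq_mul]
    congr 2
    rw [phi_X]
    obtain ⟨x, k⟩ := j
    simp only [map_sum, Derivation.leibniz, pderiv_C, smul_zero, add_zero, pderiv_X, Pi.single_apply, smul_eq_mul, Prod.mk.injEq, apply_ite (phi θ), map_one, map_zero, Fin.sum_univ_four]
    fin_cases k <;> by_cases hx : x = h <;> simp [hx, LM]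

lemma phi_hD {m : ℕ} (θ : ℝ) (i : Fin m →₀ ℕ) (P : MvPolynomial (Fin m × Fin 4) ℝ) :
    phi θ (hD (up i) P) = hD (up i) (phi θ P) := by
  classical
  have key : ∀ n : ℕ, ∀ μ : Fin m →₀ ℕ, ∑ i, μ i = n → phi θ (hD (up μ) P) = hD (up μ) (phi θ P) := by
    intro n
    induction n with
    | zero =>
      intro μ h
      have : up μ = 0 := by
        ext i
        simp at h
        simp [h, up_apply]
      rw [this, hD_zero, hD_zero]
    | succ n ih =>
      intro μ h
      have h0 : μ ≠ 0 := by rintro rfl; simp at h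
      obtain ⟨i, ν, rfl⟩ := exists_decomp μ h0
      have h1 : ∑ i, ν i = n := by
        simp [Finset.sum_add_distrib, Finsupp.single_apply] at h
        exact h
      have h2 := pderiv_hD (i, 1) (up ν) P
      have h3 := pderiv_hD (i, 1) (up ν) (phi θ P)
      rw [← ih ν h1, ← phi_pderiv, h2, map_smul, ← up_single, ← up_add] at h3
      have h4 : (((up ν) (i,1) + 1 : ℕ) : ℝ) ≠ 0 := Nat.cast_ne_zero.2 (Nat.succ_ne_zero _)
      exact smul_right_injective (MvPolynomial _ ℝ) h4 h3
  exact key _ i rfl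

lemma l1_aeval {ι κ : Type*} [Fintype ι] (G : MvPolynomial ι ℝ) (f : ι → MvPolynomial κ ℝ) (B : ι → ℝ) (E : ℝ)
    (hB : ∀ v, l1 (f v) ≤ B v) (hE : ∀ d, coeff d G ≠ 0 → ∏ v, B v ^ d v ≤ E) : l1 (aeval f G) ≤ E * l1 G := by
  rw [aeval_def, eval₂_eq']
  refine (l1_sum_le _ _).trans ?_
  rw [l1, Finset.mul_sum]
  apply Finset.sum_le_sum
  intro d hd
  refine (l1_mul_le _ _).trans ?_
  rw [algebraMap_eq, l1_C, mul_comm]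
  apply mul_le_mul_of_nonneg_right _ (abs_nonneg _)
  refine le_trans ?_ (hE d (mem_support_iff.1 hd))
  refine (l1_prod_le _ _).trans ?_
  apply Finset.prod_le_prod (fun _ _ => l1_nonneg _)
  intro v _
  exact (l1_pow_le _ _).trans (pow_le_pow_left₀ (l1_nonneg _) (hB v) _)

/-- the linear forms -/
def LF (θ : ℝ) (y : Fin 4 → ℤ) : Fin 4 → ℝ :=
  ![y 0 - θ * y 2, y 1 + θ * y 0 - θ * y 3 - θ^2 * y 2, y 2, θ * y 2 + y 3]

lemma LM_LF (θ : ℝ) (y : Fin 4 → ℤ) (k : Fin 4) : ∑ l, LM θ k l * LF θ y l = y k := by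
  fin_cases k <;> simp [LM, LF, Fin.sum_univ_four] <;> ring

noncomputable def psi {m : ℕ} (R : Type) [CommRing R] (y : Fin m → Fin 3 → Fin 4 → ℤ) :
    MvPolynomial (Fin m × Fin 4) R →ₐ[R] MvPolynomial (Fin m × Fin 3) R :=
  aeval (fun v => ∑ s, C ((y v.1 s v.2 : ℤ) : R) * X (v.1, s))

lemma map_psi {m : ℕ} {R : Type} [CommRing R] (f : ℤ →+* R) (y : Fin m → Fin 3 → Fin 4 → ℤ) (P : MvPolynomial (Fin m × Fin 4) ℤ) :
    map f (psi ℤ y P) = psi R y (map f P) := by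
  have : (MvPolynomial.map f).comp (psi ℤ y).toRingHom = (psi R y).toRingHom.comp (MvPolynomial.map f) := by
    apply MvPolynomial.ringHom_ext
    · intro r; simp [psi]
    · intro i; simp [psi]
  exact DFunLike.congr_fun this P

lemma psi_phi {m : ℕ} (θ : ℝ) (y : Fin m → Fin 3 → Fin 4 → ℤ) (P : MvPolynomial (Fin m × Fin 4) ℝ) :
    psi ℝ y P = aeval (fun v : Fin m × Fin 4 => ∑ s, C (LF θ (y v.1 s) v.2) * X (v.1, s) : _ → MvPolynomial (Fin m × Fin 3) ℝ) (phi θ P) := by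
  have : psi ℝ y = (aeval (fun v : Fin m × Fin 4 => ∑ s, C (LF θ (y v.1 s) v.2) * X (v.1, s) : _ → MvPolynomial (Fin m × Fin 3) ℝ)).comp (phi θ) := by
    apply MvPolynomial.algHom_ext
    intro v
    rw [AlgHom.comp_apply, phi_X, map_sum]
    simp only [map_mul, aeval_X, psi, algHom_C, algebraMap_eq]
    simp only [Finset.mul_sum]
    rw [Finset.sum_comm]
    apply Finset.sum_congr rfl
    intro s _
    rw [← LM_LF θ (y v.1 s) v.2, map_sum, Finset.sum_mul]
    apply Finset.sum_congr rfl
    intro l _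
    rw [map_mul]; ring
  rw [this]; rfl

lemma LM_le (θ : ℝ) (h0 : 0 ≤ θ) (h1 : θ ≤ 1) (k l : Fin 4) : |LM θ k l| ≤ 1 := by
  have h2 : θ^2 ≤ 1 := by nlinarith
  fin_cases k <;> fin_cases l <;> simp [LM, abs_of_nonneg h0, h1, h2]

lemma MH_le {m : ℕ} {R : Type} [CommRing R] {P : MvPolynomial (Fin m × Fin 4) R} {r : Fin m → ℕ} 
    (hP : IsWeightedHomogeneous (wv m (Fin 4)) P r) (d) (hd : coeff d P ≠ 0) (h : Fin m) : ∑ k, d (h,k) = r h := by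
  rw [← hP hd, weight_wv]

lemma psi_zero {m : ℕ} (θ : ℝ) (h0 : 0 ≤ θ) (h1 : θ ≤ 1) (P : MvPolynomial (Fin m × Fin 4) ℤ) (r : Fin m → ℕ)
    (hP : IsWeightedHomogeneous (wv m (Fin 4)) P r) (i : Fin m →₀ ℕ) (y : Fin m → Fin 3 → Fin 4 → ℤ) (B : Fin m × Fin 4 → ℝ)
    (hB : ∀ h l s, 3 * |LF θ (y h s) l| ≤ B (h,l)) (E : ℝ) (hE0 : 0 ≤ E)
    (hE : ∀ d, coeff (d + up i) (phi θ (map (Int.castRingHom ℝ) P)) ≠ 0 → ∏ v, B v ^ d v ≤ E)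
    (hlt : E * (64 ^ (∑ h, r h) * L P) < 1) : psi ℤ y (hD (up i) P) = 0 := by
  apply eq_zero_of_L
  refine lt_of_le_of_lt ?_ hlt
  rw [L, map_psi, psi_phi θ, map_hD, phi_hD]
  refine (l1_aeval _ _ B E ?_ ?_).trans ?_
  · intro v
    refine (l1_sum_le _ _).trans ?_
    have : ∀ s, l1 (C (LF θ (y v.1 s) v.2) * X (v.1, s) : MvPolynomial (Fin m × Fin 3) ℝ) ≤ B v / 3 := by
      intro s
      refine (l1_mul_le _ _).trans ?_
      rw [l1_C, l1_X]
      have := hB v.1 v.2 s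
      simp only [Prod.mk.eta] at this
      linarith
    refine (Finset.sum_le_sum (fun s _ => this s)).trans ?_
    simp; linarith
  · intro d hd
    apply hE
    rw [coeff_hD] at hd
    exact right_ne_zero_of_mul hd
  · apply mul_le_mul_of_nonneg_left _ hE0
    rw [← phi_hD, ← map_hD, phi]
    have hdeg : ∀ d, coeff d P ≠ 0 → ∀ v : Fin m × Fin 4, d v ≤ r v.1 := by
      intro d hd v
      rw [← MH_le hP d hd v.1]
      exact Finset.single_le_sum (f := fun k => d (v.1, k)) (fun _ _ => Nat.zero_le _) (Finset.mem_univ v.2)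
    have hLD := L_hD (up i) P (fun v => r v.1) (fun d hd => hdeg d (mem_support_iff.1 hd))
    refine (l1_aeval _ _ (fun _ => 4) (4 ^ (∑ h, r h)) ?_ ?_).trans ?_
    · intro v
      refine (l1_sum_le _ _).trans ?_
      have : ∀ l, l1 (C (LM θ v.2 l) * X (v.1, l) : MvPolynomial (Fin m × Fin 4) ℝ) ≤ 1 := by
        intro l
        refine (l1_mul_le _ _).trans ?_
        rw [l1_C, l1_X, mul_one]; exact LM_le θ h0 h1 _ _
      refine (Finset.sum_le_sum (fun s _ => this s)).trans ?_
      simp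
    · intro d hd
      rw [coeff_map, coeff_hD] at hd
      have hd' : coeff (d + up i) P ≠ 0 := by
        intro h; rw [h] at hd; simp at hd
      rw [Finset.prod_pow_eq_pow_sum]
      apply pow_le_pow_right₀ (by norm_num)
      rw [Fintype.sum_prod_type]
      apply Finset.sum_le_sum
      intro h _
      rw [← MH_le hP _ hd' h]
      apply Finset.sum_le_sum
      intro k _
      simp
    · have e1 : ∑ v : Fin m × Fin 4, r v.1 = 4 * ∑ h, r h := by
        rw [Fintype.sum_prod_type]; simp [Finset.mul_sum]
      rw [e1, pow_mul] at hLD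
      have e2 : (64:ℝ) ^ (∑ h, r h) = 4 ^ (∑ h, r h) * (2^4) ^ (∑ h, r h) := by rw [← mul_pow]; norm_num
      rw [e2, mul_assoc]
      apply mul_le_mul_of_nonneg_left hLD (by positivity)

end RothAux

set_option linter.all false

namespace RothAux
open MvPolynomial

noncomputable def ni {m : ℕ} (d : Fin m × Fin 4 →₀ ℕ) : Fin m × Fin 2 →₀ ℕ :=
  Finsupp.equivFunOnFinite.symm (fun v => if v.2 = 0 then d (v.1, 2) else d (v.1, 3))
noncomputable def ii {m : ℕ} (d : Fin m × Fin 4 →₀ ℕ) : Fin m →₀ ℕ :=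
  Finsupp.equivFunOnFinite.symm (fun h => d (h, 1))
lemma ni_apply {m : ℕ} (d : Fin m × Fin 4 →₀ ℕ) (v) : ni d v = if v.2 = 0 then d (v.1, 2) else d (v.1, 3) := rfl
lemma ii_apply {m : ℕ} (d : Fin m × Fin 4 →₀ ℕ) (h) : ii d h = d (h, 1) := rfl

open Classical in
noncomputable def til {m : ℕ} (n : Fin m × Fin 2 →₀ ℕ) : MvPolynomial (Fin m × Fin 4) ℤ →ₗ[ℤ] MvPolynomial (Fin m) ℤ :=
  (basisMonomials _ ℤ).constr ℤ fun d => if ni d = n then monomial (ii d) 1 else 0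

open Classical in
lemma til_monomial {m : ℕ} (n : Fin m × Fin 2 →₀ ℕ) (d) (c : ℤ) :
    til n (monomial d c) = if ni d = n then monomial (ii d) c else 0 := by
  have h1 : (monomial d c : MvPolynomial (Fin m × Fin 4) ℤ) = c • (basisMonomials _ ℤ d) := by
    simp [smul_monomial]
  rw [h1, map_smul, til, Module.Basis.constr_basis]
  split_ifs <;> simp [smul_monomial]

open Classical in
lemma til_eq {m : ℕ} (n : Fin m × Fin 2 →₀ ℕ) (P : MvPolynomial (Fin m × Fin 4) ℤ) :
    til n P = ∑ d ∈ P.support, if ni d = n then monomial (ii d) (coeff d P) else 0 := by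
  conv_lhs => rw [P.as_sum, map_sum]
  simp only [til_monomial]

lemma til_hD {m : ℕ} (n : Fin m × Fin 2 →₀ ℕ) (i : Fin m →₀ ℕ) (P : MvPolynomial (Fin m × Fin 4) ℤ) :
    til n (hD (up i) P) = hD i (til n P) := by
  classical
  rw [P.as_sum]
  simp only [map_sum]
  apply Finset.sum_congr rfl
  intro d _
  rw [hD_monomial, til_monomial, til_monomial]
  have h1 : ni (d - up i) = ni d := by
    ext v; simp [ni_apply, up_apply]
  have h2 : ii (d - up i) = ii d - i := by
    ext v; simp [ii_apply, up_apply]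
  rw [h1, h2]
  split_ifs
  · rw [hD_monomial]
    congr 2
    rw [Fintype.prod_prod_type]
    congr 1
    apply Finset.prod_congr rfl
    intro h _
    simp [Fin.prod_univ_four, up_apply, ii_apply]
  · simp

noncomputable def rho {m : ℕ} (ξ c c' : Fin m → ℚ) : MvPolynomial (Fin m × Fin 4) ℤ →ₐ[ℤ] MvPolynomial (Fin m × Fin 2) ℚ :=
  aeval (fun v => (![1, C (ξ v.1) + (C (c v.1) * X (v.1, 0) + C (c' v.1) * X (v.1, 1)), X (v.1, 0), X (v.1, 1)] : Fin 4 → MvPolynomial (Fin m × Fin 2) ℚ) v.2)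

noncomputable def sb {m : ℕ} (ξ c c' : Fin m → ℚ) : MvPolynomial (Fin m) ℤ →ₐ[ℤ] MvPolynomial (Fin m × Fin 2) ℚ :=
  aeval (fun h => C (ξ h) + (C (c h) * X (h, 0) + C (c' h) * X (h, 1)))

lemma sb_coeff {m : ℕ} (ξ c c' : Fin m → ℚ) (Q : MvPolynomial (Fin m) ℤ) :
    coeff 0 (sb ξ c c' Q) = eval ξ (map (Int.castRingHom ℚ) Q) := by
  have : (constantCoeff : MvPolynomial (Fin m × Fin 2) ℚ →+* ℚ).comp (sb ξ c c').toRingHom = (eval ξ).comp (MvPolynomial.map (Int.castRingHom ℚ)) := by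
    apply MvPolynomial.ringHom_ext
    · intro r; simp [sb]
    · intro i; simp [sb]
  exact DFunLike.congr_fun this Q

lemma rho_mon {m : ℕ} (ξ c c' : Fin m → ℚ) (d : Fin m × Fin 4 →₀ ℕ) (k : ℤ) :
    rho ξ c c' (monomial d k) = monomial (ni d) 1 * sb ξ c c' (monomial (ii d) k) := by
  rw [rho, sb, aeval_monomial, aeval_monomial, Finsupp.prod_fintype _ _ (by simp), Finsupp.prod_fintype _ _ (by simp)]
  rw [Fintype.prod_prod_type]
  have h1 : (monomial (ni d) (1:ℚ) : MvPolynomial (Fin m × Fin 2) ℚ) = ∏ h, (X (h,0) ^ d (h,2) * X (h,1) ^ d (h,3)) := by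
    rw [monomial_eq, Finsupp.prod_fintype _ _ (by simp), Fintype.prod_prod_type]
    simp [Fin.prod_univ_two, ni_apply]
  rw [h1, mul_left_comm, ← Finset.prod_mul_distrib]
  congr 1
  apply Finset.prod_congr rfl
  intro h _
  simp [Fin.prod_univ_four, ii_apply]
  ring

lemma rho_coeff {m : ℕ} (ξ c c' : Fin m → ℚ) (G : MvPolynomial (Fin m × Fin 4) ℤ) (n0 : Fin m × Fin 2 →₀ ℕ)
    (hmin : ∀ n, ∑ v, n v < ∑ v, n0 v → til n G = 0) :
    coeff n0 (rho ξ c c' G) = eval ξ (map (Int.castRingHom ℚ) (til n0 G)) := by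
  classical
  have h1 : rho ξ c c' G = ∑ n ∈ insert n0 (G.support.image ni), monomial n 1 * sb ξ c c' (til n G) := by
    have : ∀ n, til n G = ∑ d ∈ G.support with ni d = n, monomial (ii d) (coeff d G) := by
      intro n; rw [til_eq, Finset.sum_filter]
    simp only [this, map_sum, Finset.mul_sum]
    have h2 : ∀ n, ∑ d ∈ G.support with ni d = n, monomial n 1 * sb ξ c c' (monomial (ii d) (coeff d G)) =
        ∑ d ∈ G.support with ni d = n, rho ξ c c' (monomial d (coeff d G)) := by
      intro n
      apply Finset.sum_congr rfl
      intro d hd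
      rw [rho_mon, (Finset.mem_filter.1 hd).2]
    simp only [h2]
    rw [Finset.sum_fiberwise_of_maps_to (fun d hd => Finset.mem_insert_of_mem (Finset.mem_image_of_mem _ hd))]
    conv_lhs => rw [G.as_sum, map_sum]
  rw [h1, coeff_sum, Finset.sum_eq_single n0]
  · rw [coeff_monomial_mul', if_pos le_rfl, tsub_self, one_mul, sb_coeff]
  · intro n _ hn
    rw [coeff_monomial_mul']
    split_ifs with hle
    · rw [hmin n, map_zero, coeff_zero, mul_zero]
      apply Finset.sum_lt_sum (fun v _ => hle v)
      obtain ⟨v, hv⟩ := Finsupp.ne_iff.1 hn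
      exact ⟨v, Finset.mem_univ _, lt_of_le_of_ne (hle v) hv⟩
    · rfl
  · intro h; exact absurd (Finset.mem_insert_self _ _) h

lemma plane_span (a b u v : ℤ) (hb : 0 < b) (y : Fin 3 → Fin 4 → ℤ)
    (hy : LinearIndependent ℚ (fun s k => ((y s k : ℤ) : ℚ)))
    (hp : ∀ s, y s 0 * a + y s 1 * b + y s 2 * u + y s 3 * v = 0)
    (z : Fin 4 → ℚ) (hz : z 0 * a + z 1 * b + z 2 * u + z 3 * v = 0) :
    ∃ t : Fin 3 → ℚ, ∀ k, z k = ∑ s, t s * y s k := by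
  let f : (Fin 4 → ℚ) →ₗ[ℚ] ℚ :=
    (a : ℚ) • LinearMap.proj 0 + (b : ℚ) • LinearMap.proj 1 + (u : ℚ) • LinearMap.proj 2 + (v : ℚ) • LinearMap.proj 3
  have hf : ∀ z, f z = z 0 * a + z 1 * b + z 2 * u + z 3 * v := by intro z; simp [f]; ring
  have hb' : (b : ℚ) ≠ 0 := by exact_mod_cast hb.ne'
  have hsurj : LinearMap.range f = ⊤ := by
    rw [LinearMap.range_eq_top]
    intro q
    refine ⟨Pi.single 1 (q / b), ?_⟩
    rw [hf]; simp; field_simp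
  have hrk := LinearMap.finrank_range_add_finrank_ker f
  rw [hsurj, finrank_top] at hrk
  simp at hrk
  have hle : Submodule.span ℚ (Set.range (fun s k => ((y s k : ℤ) : ℚ))) ≤ LinearMap.ker f := by
    rw [Submodule.span_le]
    rintro _ ⟨s, rfl⟩
    simp only [SetLike.mem_coe, LinearMap.mem_ker, hf]
    exact_mod_cast hp s
  have heq := Submodule.eq_of_le_of_finrank_eq hle (by rw [finrank_span_eq_card hy]; simp; omega)
  have hzm : z ∈ LinearMap.ker f := by rw [LinearMap.mem_ker, hf]; exact hz
  rw [← heq, Submodule.mem_span_range_iff_exists_fun] at hzm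
  obtain ⟨t, ht⟩ := hzm
  refine ⟨t, fun k => ?_⟩
  rw [← ht]; simp

lemma rho_zero {m : ℕ} (a b u v : Fin m → ℤ) (hb : ∀ h, 0 < b h) (y : Fin m → Fin 3 → Fin 4 → ℤ)
    (hy : ∀ h, LinearIndependent ℚ (fun s k => ((y h s k : ℤ) : ℚ)))
    (hp : ∀ h s, y h s 0 * a h + y h s 1 * b h + y h s 2 * u h + y h s 3 * v h = 0)
    (G : MvPolynomial (Fin m × Fin 4) ℤ) (hG : psi ℤ y G = 0) :
    rho (fun h => ((-a h : ℤ) / b h : ℚ)) (fun h => (-u h / b h : ℚ)) (fun h => (-v h / b h : ℚ)) G = 0 := by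
  apply MvPolynomial.funext
  intro x
  rw [map_zero]
  choose t ht using fun h => plane_span (a h) (b h) (u h) (v h) (hb h) (y h) (hy h) (hp h)
    ![1, (-a h : ℤ) / b h + (-u h / b h * x (h,0) + -v h / b h * x (h,1)), x (h,0), x (h,1)] (by
      have hb' : (b h : ℚ) ≠ 0 := by exact_mod_cast (hb h).ne'
      simp; field_simp; ring)
  have h2 : ∀ G : MvPolynomial (Fin m × Fin 4) ℤ, 
      eval x (rho (fun h => ((-a h : ℤ) / b h : ℚ)) (fun h => (-u h / b h : ℚ)) (fun h => (-v h / b h : ℚ)) G) = 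
      eval (fun w => t w.1 w.2) (map (Int.castRingHom ℚ) (psi ℤ y G)) := by
    intro G
    have : (eval x).comp (rho (fun h => ((-a h : ℤ) / b h : ℚ)) (fun h => (-u h / b h : ℚ)) (fun h => (-v h / b h : ℚ))).toRingHom
       = ((eval (fun w => t w.1 w.2)).comp (MvPolynomial.map (Int.castRingHom ℚ))).comp (psi ℤ y).toRingHom := by
      apply MvPolynomial.ringHom_ext
      · intro r; simp [rho, psi]
      · intro w
        obtain ⟨h, k⟩ := w
        have := ht h k
        simp [rho, psi]
        rw [Finset.sum_congr rfl (fun s _ => mul_comm _ _), ← this]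
        fin_cases k <;> simp
    exact DFunLike.congr_fun this G
  rw [h2, hG]; simp

lemma reduce {m : ℕ} (r : Fin m → ℕ) (P : MvPolynomial (Fin m × Fin 4) ℤ) (hP0 : P ≠ 0)
    (hP : IsWeightedHomogeneous (wv m (Fin 4)) P r) (a b u v : Fin m → ℤ) (hb : ∀ h, 0 < b h) (y : Fin m → Fin 3 → Fin 4 → ℤ)
    (hy : ∀ h, LinearIndependent ℚ (fun s k => ((y h s k : ℤ) : ℚ)))
    (hp : ∀ h s, y h s 0 * a h + y h s 1 * b h + y h s 2 * u h + y h s 3 * v h = 0) (t : ℝ)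
    (hψ : ∀ i, wt r i < t → psi ℤ y (hD (up i) P) = 0) :
    ∃ Q : MvPolynomial (Fin m) ℤ, Q ≠ 0 ∧ (∀ h, degreeOf h Q ≤ r h) ∧ L Q ≤ L P ∧
      Idx r (tsh (fun h => ((-a h : ℤ) / b h : ℚ)) (map (Int.castRingHom ℚ) Q)) t := by
  classical
  have hne : {n | til n P ≠ 0}.Nonempty := by
    obtain ⟨d0, hd0⟩ := MvPolynomial.ne_zero_iff.1 hP0
    refine ⟨ni d0, fun h => hd0 ?_⟩
    have h1 := congrArg (coeff (ii d0)) h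
    rw [til_eq, coeff_sum, Finset.sum_eq_single d0] at h1
    · simpa using h1
    · intro d hd hdd
      split_ifs with hn
      · rw [coeff_monomial, if_neg]
        intro hi
        apply hdd
        have hs : ∀ h, d (h,1) = d0 (h,1) ∧ d (h,2) = d0 (h,2) ∧ d (h,3) = d0 (h,3) := by
          intro h
          have e1 := DFunLike.congr_fun hi h
          have e2 := DFunLike.congr_fun hn (h, 0)
          have e3 := DFunLike.congr_fun hn (h, 1)
          simp [ni_apply, ii_apply] at e1 e2 e3
          exact ⟨e1, e2, e3⟩
        ext w
        obtain ⟨h, k⟩ := w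
        have s1 := MH_le hP d (mem_support_iff.1 hd) h
        have s2 := MH_le hP d0 hd0 h
        rw [Fin.sum_univ_four] at s1 s2
        obtain ⟨e1, e2, e3⟩ := hs h
        fin_cases k
        · simp; omega
        · exact e1
        · exact e2
        · exact e3
      · simp
    · intro hh; simp at hh; exact absurd hh hd0
  obtain ⟨n0, hn0, hmin⟩ := WellFounded.has_min (measure (fun n : Fin m × Fin 2 →₀ ℕ => ∑ v, n v)).wf _ hne
  have hmin' : ∀ n, ∑ v, n v < ∑ v, n0 v → til n P = 0 := by
    intro n hn
    by_contra hc
    exact hmin n hc hn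
  refine ⟨til n0 P, hn0, ?_, ?_, ?_⟩
  · intro h
    rw [til_eq]
    refine (degreeOf_sum_le _ _ _).trans (Finset.sup_le ?_)
    intro d hd
    split_ifs
    · rw [degreeOf_monomial_eq _ _ (mem_support_iff.1 hd), ii_apply, ← MH_le hP d (mem_support_iff.1 hd) h]
      exact Finset.single_le_sum (f := fun k => d (h, k)) (fun _ _ => Nat.zero_le _) (Finset.mem_univ 1)
    · simp
  · rw [til_eq]
    refine (L_sum_le _ _).trans ?_
    rw [L_eq]
    apply Finset.sum_le_sum
    intro d _
    split_ifs
    · rw [L_monomial]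
    · rw [L_zero]; positivity
  · intro i hi
    rw [coeff_tsh, ← map_hD, ← til_hD]
    have hz := rho_zero a b u v hb y hy hp _ (hψ i hi)
    rw [← rho_coeff _ (fun h => (-u h / b h : ℚ)) (fun h => (-v h / b h : ℚ)) (hD (up i) P) n0, hz, coeff_zero]
    intro n hn
    rw [til_hD, hmin' n hn, map_zero]

end RothAux

set_option linter.all false

namespace RothAux
open MvPolynomial

lemma expo_bound {m : ℕ} (r : Fin m → ℕ) (e : Fin m → Fin 4 → ℝ) (ℓ : Fin m → ℝ) (d : Fin m × Fin 4 →₀ ℕ) (i : Fin m →₀ ℕ)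
    (Λ δ : ℝ) (hΛ : 0 < Λ) (hδ : 0 < δ) (hr : ∀ h, 0 < r h) (he : ∀ h l, |e h l| ≤ 4)
    (hs1 : ∀ h, Λ ≤ r h * ℓ h) (hs2 : ∀ h, r h * ℓ h ≤ (1 + δ/16) * Λ)
    (hd : ∀ h, ∑ k, d (h,k) ≤ r h) (hi : wt r i ≤ m * δ / 16)
    (hZ : Zf r e (fun h k => (d + up i) (h,k)) ≤ -(m * δ)) :
    ∑ v, (d v : ℝ) * (e v.1 v.2 * ℓ v.1) ≤ -(Λ * m * δ / 2) := by
  have hr' : ∀ h, (0:ℝ) < r h := fun h => by exact_mod_cast hr h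
  have h1 : Zf r e (fun h k => (d + up i) (h,k)) = ∑ h, (∑ k, e h k * d (h,k) / r h + e h 1 * (i h / r h)) := by
    unfold Zf
    apply Finset.sum_congr rfl
    intro h _
    simp [Fin.sum_univ_four, up_apply]; ring
  rw [h1, Finset.sum_add_distrib] at hZ
  have h2 : -(4 * wt r i) ≤ ∑ h, e h 1 * ((i h : ℝ) / r h) := by
    rw [wt, Finset.mul_sum, ← Finset.sum_neg_distrib]
    apply Finset.sum_le_sum
    intro h _
    have := (abs_le.1 (he h 1)).1
    have h0 : (0:ℝ) ≤ (i h : ℝ) / r h := by positivity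
    nlinarith
  have h3 : ∀ h, ∑ k, (d (h,k) : ℝ) * (e h k * ℓ h) ≤ Λ * (∑ k, e h k * d (h,k) / r h) + δ / 4 * Λ := by
    intro h
    have hD : ∑ k, (d (h,k) : ℝ) / r h ≤ 1 := by
      rw [← Finset.sum_div, div_le_one (hr' h)]
      exact_mod_cast hd h
    have h4 : ∀ k, (d (h,k) : ℝ) * (e h k * ℓ h) ≤ Λ * (e h k * d (h,k) / r h) + δ / 4 * Λ * (d (h,k) / r h) := by
      intro k
      have e1 : (d (h,k) : ℝ) * (e h k * ℓ h) = (e h k * (r h * ℓ h)) * (d (h,k) / r h) := by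
        have := (hr' h).ne'
        field_simp
      have e2 : Λ * (e h k * d (h,k) / r h) + δ / 4 * Λ * (d (h,k) / r h) = (Λ * e h k + δ / 4 * Λ) * (d (h,k) / r h) := by ring
      rw [e1, e2]
      apply mul_le_mul_of_nonneg_right _ (by positivity)
      have a1 := abs_le.1 (he h k)
      have a2 := hs1 h
      have a3 := hs2 h
      have a4 : e h k * (r h * ℓ h - Λ) ≤ 4 * (δ / 16 * Λ) := by
        calc e h k * (r h * ℓ h - Λ) ≤ 4 * (r h * ℓ h - Λ) := by apply mul_le_mul_of_nonneg_right a1.2; linarith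
          _ ≤ _ := by linarith
      linarith
    refine (Finset.sum_le_sum (fun k _ => h4 k)).trans ?_
    rw [Finset.sum_add_distrib, ← Finset.mul_sum, ← Finset.mul_sum]
    have : δ / 4 * Λ * ∑ k, (d (h,k) : ℝ) / r h ≤ δ / 4 * Λ * 1 := by
      apply mul_le_mul_of_nonneg_left hD (by positivity)
    linarith
  rw [Fintype.sum_prod_type]
  refine (Finset.sum_le_sum (fun h _ => h3 h)).trans ?_
  rw [Finset.sum_add_distrib, ← Finset.mul_sum]
  simp only [Finset.sum_const, Finset.card_univ, Fintype.card_fin, nsmul_eq_mul]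
  have h5 : ∑ h, ∑ k, e h k * (d (h,k) : ℝ) / r h ≤ -(m * δ) + 4 * (m * δ / 16) := by linarith
  have h6 := mul_le_mul_of_nonneg_left h5 hΛ.le
  nlinarith

/-- one family of approximations leads to a contradiction -/
lemma sub_step (θ : ℝ) (h0 : 0 ≤ θ) (h1 : θ ≤ 1) (C : ℝ) (hC : 1 ≤ C) (δ : ℝ) (hδ : 0 < δ) (C0 : ℝ) (hC0 : 1 ≤ C0) (m : ℕ) (hm : 0 < m)
    (haux : ∀ (r : Fin m → ℕ) (e : Fin m → Fin 4 → ℝ), (∀ h, 0 < r h) → (∀ h l, |e h l| ≤ 4) → (∀ h, ∑ l, e h l ≤ -(8*δ)) →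
      ∃ P : MvPolynomial (Fin m × Fin 4) ℤ, P ≠ 0 ∧ IsWeightedHomogeneous (wv m (Fin 4)) P r ∧ L P ≤ C ^ (∑ h, r h) ∧
      ∀ d : Fin m × Fin 4 →₀ ℕ, -(m * δ) < Zf r e (fun h k => d (h,k)) →
        coeff d (phi θ (map (Int.castRingHom ℝ) P)) = 0)
    (σ : ℝ) (hσ : 0 < σ) (hroth : ∀ (r : Fin m → ℕ) (a b : Fin m → ℤ) (P : MvPolynomial (Fin m) ℤ), (∀ i, 0 < r i) → (∀ i, 0 < b i) →
      (∀ i, IsCoprime (a i) (b i)) → P ≠ 0 → (∀ i, degreeOf i P ≤ r i) → (∀ i j, i < j → (r i : ℝ) ≤ σ * r j) →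
      (∀ i, Real.log (L P) + ∑ j, (r j : ℝ) ≤ σ * r i * Real.log (b i)) →
      ¬ Idx r (tsh (fun i => (a i / b i : ℚ)) (map (Int.castRingHom ℚ) P)) (m * δ / 16))
    (a b u v : Fin m → ℤ) (y : Fin m → Fin 3 → Fin 4 → ℤ) (e : Fin m → Fin 4 → ℝ)
    (hb : ∀ h, 0 < b h) (hab : ∀ h, IsCoprime (a h) (b h)) 
    (hy : ∀ h, LinearIndependent ℚ (fun s k => ((y h s k : ℤ) : ℚ)))
    (hp : ∀ h s, y h s 0 * a h + y h s 1 * b h + y h s 2 * u h + y h s 3 * v h = 0)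
    (he : ∀ h l, |e h l| ≤ 4) (hes : ∀ h, ∑ l, e h l ≤ -(8*δ))
    (hF : ∀ h s l, |LF θ (y h s) l| ≤ C0 * Real.exp (e h l * Real.log (b h)))
    (ℓ0 : ℝ) (hl0 : 1 ≤ ℓ0) (hl1 : 4 * Real.log (192 * C0 * C) < δ * ℓ0) (hl2 : 2 * m * (Real.log C + 1) ≤ σ * ℓ0)
    (hlb : ∀ h, ℓ0 ≤ Real.log (b h))
    (hgr : ∀ i j, i < j → (1 + δ/16) * Real.log (b j) ≤ σ * Real.log (b i)) (hδ1 : δ ≤ 1) : False := by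
  have hε : 0 < δ / 16 := by positivity
  set ℓ : Fin m → ℝ := fun h => Real.log (b h) with hℓ
  have hℓpos : ∀ h, 0 < ℓ h := fun h => lt_of_lt_of_le (by linarith) (hlb h)
  set Λ : ℝ := (∑ h, ℓ h) / (δ / 16) with hΛdef
  have hsum : ∀ h, ℓ h ≤ ∑ h, ℓ h := fun h => Finset.single_le_sum (fun x _ => (hℓpos x).le) (Finset.mem_univ h)
  have hΛ1 : ∀ h, ℓ h ≤ δ/16 * Λ := by
    intro h
    rw [hΛdef, mul_div_cancel₀ _ hε.ne']; exact hsum h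
  have hΛ : 0 < Λ := by
    have := hΛ1 ⟨0, hm⟩
    have := hℓpos ⟨0, hm⟩
    by_contra hc
    push Not at hc
    nlinarith
  set r : Fin m → ℕ := fun h => ⌈Λ / ℓ h⌉₊ with hrdef
  have hr : ∀ h, 0 < r h := fun h => Nat.ceil_pos.2 (div_pos hΛ (hℓpos h))
  have hr' : ∀ h, (0:ℝ) < r h := fun h => by exact_mod_cast hr h
  have hs1 : ∀ h, Λ ≤ r h * ℓ h := by
    intro h
    have := Nat.le_ceil (Λ / ℓ h)
    rwa [div_le_iff₀ (hℓpos h)] at this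
  have hs2 : ∀ h, r h * ℓ h ≤ (1 + δ/16) * Λ := by
    intro h
    have h1 := (Nat.ceil_lt_add_one (div_pos hΛ (hℓpos h)).le).le
    have h2 : (r h : ℝ) * ℓ h ≤ (Λ / ℓ h + 1) * ℓ h := mul_le_mul_of_nonneg_right h1 (hℓpos h).le
    rw [add_mul, div_mul_cancel₀ _ (hℓpos h).ne'] at h2
    have := hΛ1 h
    linarith
  obtain ⟨P, hP0, hP, hPL, hPv⟩ := haux r e hr he hes
  set R := ∑ h, r h with hR
  have hRle : (R:ℝ) * ℓ0 ≤ 2 * Λ * m := by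
    rw [hR]; push_cast
    rw [Finset.sum_mul]
    have : ∀ h ∈ Finset.univ, (r h : ℝ) * ℓ0 ≤ 2 * Λ := by
      intro h _
      calc (r h : ℝ) * ℓ0 ≤ r h * ℓ h := mul_le_mul_of_nonneg_left (hlb h) (hr' h).le
        _ ≤ (1 + δ/16) * Λ := hs2 h
        _ ≤ 2 * Λ := by nlinarith
    refine (Finset.sum_le_sum this).trans ?_
    simp; linarith
  have hm' : (0:ℝ) < m := by exact_mod_cast hm
  -- vanishing
  have hψ : ∀ i, wt r i < m * δ / 16 → psi ℤ y (hD (up i) P) = 0 := by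
    intro i hi
    refine psi_zero θ h0 h1 P r hP i y (fun w => 3 * C0 * Real.exp (e w.1 w.2 * ℓ w.1)) ?_ ((3*C0)^R * Real.exp (-(Λ * m * δ / 2))) (by positivity) ?_ ?_
    · intro h l s
      have := hF h s l
      simp only; linarith
    · intro d hd
      have hMH : IsWeightedHomogeneous (wv m (Fin 4)) (phi θ (map (Int.castRingHom ℝ) P)) r := by
        apply phi_MH
        intro d' hd'
        apply hP
        intro h0
        rw [coeff_map, h0] at hd'
        simp at hd'
      have hdr : ∀ h, ∑ k, d (h,k) ≤ r h := by
        intro h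
        rw [← MH_le hMH _ hd h]
        apply Finset.sum_le_sum
        intro k _; simp
      have hZ : Zf r e (fun h k => (d + up i) (h,k)) ≤ -(m * δ) := by
        by_contra hc
        exact hd (hPv _ (not_le.1 hc))
      have hE := expo_bound r e ℓ d i Λ δ hΛ hδ hr he hs1 hs2 hdr hi.le hZ
      simp only [mul_pow, Finset.prod_mul_distrib]
      have e1 : ∏ w : Fin m × Fin 4, Real.exp (e w.1 w.2 * ℓ w.1) ^ d w = Real.exp (∑ w, (d w : ℝ) * (e w.1 w.2 * ℓ w.1)) := by
        rw [Real.exp_sum]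
        apply Finset.prod_congr rfl
        intro w _
        rw [← Real.exp_nat_mul]
      have e2 : (∏ w : Fin m × Fin 4, (3:ℝ) ^ d w) * ∏ w : Fin m × Fin 4, C0 ^ d w ≤ (3 * C0)^R := by
        rw [← Finset.prod_mul_distrib]
        simp only [← mul_pow]
        rw [Finset.prod_pow_eq_pow_sum]
        apply pow_le_pow_right₀ (by linarith)
        rw [Fintype.sum_prod_type]
        exact Finset.sum_le_sum (fun h _ => hdr h)
      rw [e1, ← mul_pow]
      apply mul_le_mul e2 (Real.exp_le_exp.2 hE) (Real.exp_pos _).le (by positivity)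
    · have hbig : (3*C0)^R * Real.exp (-(Λ * m * δ / 2)) * (64 ^ R * L P) ≤ (192 * C0 * C)^R * Real.exp (-(Λ * m * δ / 2)) := by
        have : (192 * C0 * C)^R = (3*C0)^R * 64^R * C^R := by rw [← mul_pow, ← mul_pow]; ring
        rw [this]
        have h3 : (3*C0)^R * Real.exp (-(Λ * m * δ / 2)) * (64 ^ R * L P) ≤ (3*C0)^R * Real.exp (-(Λ * m * δ / 2)) * (64 ^ R * C^R) := by
          gcongr
        refine h3.trans (le_of_eq (by ring))
      refine lt_of_le_of_lt hbig ?_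
      have hp : (0:ℝ) < 192 * C0 * C := by positivity
      have e3 : (192 * C0 * C)^R = Real.exp (R * Real.log (192 * C0 * C)) := by
        rw [Real.exp_nat_mul, Real.exp_log hp]
      rw [e3, ← Real.exp_add, Real.exp_lt_one_iff]
      have hlog : 0 ≤ Real.log (192 * C0 * C) := Real.log_nonneg (by nlinarith)
      have hRpos : (0:ℝ) < R := by
        have : 0 < R := by
          rw [hR]; exact Finset.sum_pos (fun h _ => hr h) ⟨⟨0, hm⟩, Finset.mem_univ _⟩
        exact_mod_cast this
      have h4 : (R:ℝ) * (4 * Real.log (192 * C0 * C)) < R * (δ * ℓ0) := mul_lt_mul_of_pos_left hl1 hRpos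
      have h5 : δ * (R * ℓ0) ≤ δ * (2 * Λ * m) := mul_le_mul_of_nonneg_left hRle hδ.le
      nlinarith
  obtain ⟨Q, hQ0, hQd, hQL, hQI⟩ := reduce r P hP0 hP a b u v hb y hy hp _ hψ
  refine hroth r (fun h => -a h) b Q hr hb (fun h => (hab h).neg_left) hQ0 hQd ?_ ?_ ?_
  · intro i j hij
    have g := hgr i j hij
    have i1 := hs2 i
    have j1 := hs1 j
    -- r i ℓ i ≤ (1+ε) Λ ≤ (1+ε) r j ℓ j ≤ r j σ ℓ i
    have : (r i : ℝ) * ℓ i ≤ σ * r j * ℓ i := by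
      calc (r i : ℝ) * ℓ i ≤ (1 + δ/16) * Λ := i1
        _ ≤ (1 + δ/16) * (r j * ℓ j) := by gcongr
        _ = r j * ((1 + δ/16) * ℓ j) := by ring
        _ ≤ r j * (σ * ℓ i) := mul_le_mul_of_nonneg_left g (hr' j).le
        _ = _ := by ring
    exact le_of_mul_le_mul_right this (hℓpos i)
  · intro i
    have hL1 := one_le_L Q hQ0
    have h3 : Real.log (L Q) ≤ R * Real.log C := by
      rw [← Real.log_pow]
      exact Real.log_le_log (by linarith) (hQL.trans hPL)
    have h4 : ∑ j, (r j : ℝ) = R := by rw [hR]; push_cast; rfl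
    rw [h4]
    have h5 : σ * Λ ≤ σ * r i * ℓ i := by rw [mul_assoc]; exact mul_le_mul_of_nonneg_left (hs1 i) hσ.le
    refine le_trans ?_ h5
    have hlC : 0 ≤ Real.log C := Real.log_nonneg hC
    have h6 : (R:ℝ) * (Real.log C + 1) * (2 * m) ≤ σ * Λ * (2 * m) := by
      calc (R:ℝ) * (Real.log C + 1) * (2 * m) = R * (2 * m * (Real.log C + 1)) := by ring
        _ ≤ R * (σ * ℓ0) := mul_le_mul_of_nonneg_left hl2 (by positivity)
        _ = σ * (R * ℓ0) := by ring
        _ ≤ σ * (2 * Λ * m) := mul_le_mul_of_nonneg_left hRle hσ.le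
        _ = _ := by ring
    have := le_of_mul_le_mul_right h6 (by positivity)
    linarith
  · simpa using hQI

theorem sub_contra (θ : ℝ) (hθ : IsAlgebraic ℚ θ) (h0 : 0 ≤ θ) (h1 : θ ≤ 1) (c1 : ℝ) (hc1 : 0 < c1) (hc1' : c1 ≤ 1) (C0 : ℝ) (hC0 : 1 ≤ C0)
    (H : ∀ T : ℝ, ∃ (a b u v : ℤ) (x : ℝ) (y : Fin 3 → Fin 4 → ℤ), T ≤ Real.log b ∧ 0 < b ∧ IsCoprime a b ∧ c1 ≤ x ∧ x ≤ 1 ∧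
      LinearIndependent ℚ (fun s k => ((y s k : ℤ) : ℚ)) ∧
      (∀ s, y s 0 * a + y s 1 * b + y s 2 * u + y s 3 * v = 0) ∧
      (∀ s l, |LF θ (y s) l| ≤ C0 * Real.exp ((![1 - x, -1 - x, 1 + 29/10 * x, -1 - x] : Fin 4 → ℝ) l * Real.log b))) : False := by
  obtain ⟨C, hC, haux⟩ := aux θ hθ
  set δ : ℝ := c1 / 80 with hδdef
  have hδ : 0 < δ := by positivity
  obtain ⟨m, hm, haux'⟩ := haux (8 * δ) (by positivity) (by rw [hδdef]; linarith)
  have hm' : (0:ℝ) < m := by exact_mod_cast hm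
  obtain ⟨σ, hσ, hroth⟩ := roth m (m * δ / 16) (by positivity)
  have e8 : 8 * δ / 8 = δ := by ring
  rw [e8] at haux'
  choose a b u v x y hT hb hab hx1 hx2 hy hp hF using H
  set ℓ0 : ℝ := 1 + 4 * |Real.log (192 * C0 * C)| / δ + 2 * m * (Real.log C + 1) / σ with hℓ0
  have hlC : 0 ≤ Real.log C := Real.log_nonneg hC
  have p1 : 0 ≤ 4 * |Real.log (192 * C0 * C)| / δ := by positivity
  have p2 : 0 ≤ 2 * m * (Real.log C + 1) / σ := by positivity
  let T : ℕ → ℝ := fun n => Nat.rec ℓ0 (fun _ T => (2/σ + 1) * Real.log (b T)) n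
  have hT0 : T 0 = ℓ0 := rfl
  have hTs : ∀ n, T (n+1) = (2/σ + 1) * Real.log (b (T n)) := fun n => rfl
  have hlb : ∀ n, ℓ0 ≤ Real.log (b (T n)) := by
    intro n
    induction n with
    | zero => exact hT0 ▸ hT _
    | succ n ih =>
      refine le_trans ?_ (hT _)
      rw [hTs]
      have : 0 < 2/σ := by positivity
      nlinarith
  have hstep : ∀ n, (2/σ + 1) * Real.log (b (T n)) ≤ Real.log (b (T (n+1))) := by
    intro n; rw [← hTs]; exact hT _
  have hmono : Monotone (fun n => Real.log (b (T n))) := by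
    apply monotone_nat_of_le_succ
    intro n
    have := hstep n
    have h2 : 0 < 2/σ := by positivity
    have := hlb n
    nlinarith
  have hgr : ∀ n n', n < n' → 2 * Real.log (b (T n)) ≤ σ * Real.log (b (T n')) := by
    intro n n' hn
    have h3 := hmono (Nat.succ_le_of_lt hn)
    have h4 := hstep n
    have h5 := hlb n
    simp only [Nat.succ_eq_add_one] at h3
    have h6 : 2/σ * Real.log (b (T n)) ≤ Real.log (b (T n')) := by nlinarith
    calc 2 * Real.log (b (T n)) = σ * (2/σ * Real.log (b (T n))) := by field_simp
      _ ≤ _ := mul_le_mul_of_nonneg_left h6 hσ.le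
  let N : Fin m → ℝ := fun h => T (m - h)
  refine sub_step θ h0 h1 C hC δ hδ C0 hC0 m hm haux' σ hσ hroth (fun h => a (N h)) (fun h => b (N h)) (fun h => u (N h)) (fun h => v (N h))
    (fun h => y (N h)) (fun h => ![1 - x (N h), -1 - x (N h), 1 + 29/10 * x (N h), -1 - x (N h)]) (fun h => hb _) (fun h => hab _)
    (fun h => hy _) (fun h => hp _) ?_ ?_ (fun h => hF _) ℓ0 ?_ ?_ ?_ (fun h => hlb _) ?_ ?_
  · intro h l
    have := hx1 (N h)
    have := hx2 (N h)
    fin_cases l <;> simp [abs_le] <;> constructor <;> linarith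
  · intro h
    have := hx1 (N h)
    simp [Fin.sum_univ_four]; linarith
  · linarith
  · have : 4 * Real.log (192 * C0 * C) ≤ δ * (4 * |Real.log (192 * C0 * C)| / δ) := by
      rw [mul_div_cancel₀ _ hδ.ne']; linarith [le_abs_self (Real.log (192 * C0 * C))]
    rw [hℓ0]; nlinarith
  · have : 2 * m * (Real.log C + 1) = σ * (2 * m * (Real.log C + 1) / σ) := by field_simp
    rw [hℓ0]; nlinarith
  · intro i j hij
    have hlt : m - (j:ℕ) < m - (i:ℕ) := by have : (i:ℕ) < j := hij; omega
    have := hgr _ _ hlt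
    have h7 := hlb (m - (j:ℕ))
    refine le_trans ?_ this
    apply mul_le_mul_of_nonneg_right _ (by linarith)
    rw [hδdef]; linarith
  · rw [hδdef]; linarith

end RothAux

set_option linter.all false

namespace CF
variable (a : ℕ → ℕ)

lemma q0 : cvQ a 0 = 1 := rfl
lemma q1 : cvQ a 1 = a 0 := rfl
lemma qs (n : ℕ) : cvQ a (n+2) = a (n+1) * cvQ a (n+1) + cvQ a n := rfl
lemma p0 (a0 : ℤ) : cvP a0 a 0 = a0 := rfl
lemma p1 (a0 : ℤ) : cvP a0 a 1 = a 0 * a0 + 1 := rfl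
lemma ps (a0 : ℤ) (n : ℕ) : cvP a0 a (n+2) = a (n+1) * cvP a0 a (n+1) + cvP a0 a n := rfl

/-- two-step induction -/
lemma two_step {P : ℕ → Prop} (h0 : P 0) (h1 : P 1) (hs : ∀ n, P n → P (n+1) → P (n+2)) (n : ℕ) : P n := by
  have : P n ∧ P (n+1) := by
    induction n with
    | zero => exact ⟨h0, h1⟩
    | succ n ih => exact ⟨ih.2, hs n ih.1 ih.2⟩
  exact this.1

lemma cvP_shift (a0 : ℤ) (n : ℕ) : cvP a0 a n = a0 * cvQ a n + cvP 0 a n := by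
  refine two_step (P := fun n => cvP a0 a n = a0 * cvQ a n + cvP 0 a n) ?_ ?_ ?_ n
  · simp [p0, q0]
  · simp [p1, q1]; ring
  · intro n h1 h2
    rw [ps, qs, ps, h1, h2]; ring

variable (hpos : ∀ i, 0 < a i)

lemma q_pos (hpos : ∀ i, 0 < a i) (n : ℕ) : 1 ≤ cvQ a n := by
  refine two_step (P := fun n => 1 ≤ cvQ a n) ?_ ?_ ?_ n
  · simp [q0]
  · rw [q1]; exact_mod_cast hpos 0
  · intro n h1 h2
    rw [qs]
    have : (1:ℤ) ≤ a (n+1) := by exact_mod_cast hpos (n+1)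
    nlinarith

lemma q_two (hpos : ∀ i, 0 < a i) (n : ℕ) : cvQ a (n+1) + cvQ a n ≤ cvQ a (n+2) := by
  have : (1:ℤ) ≤ a (n+1) := by exact_mod_cast hpos (n+1)
  have := q_pos a hpos (n+1)
  rw [qs]; nlinarith

lemma q_mono (hpos : ∀ i, 0 < a i) : Monotone (cvQ a) := by
  apply monotone_nat_of_le_succ
  intro n
  cases n with
  | zero => rw [q0]; exact q_pos a hpos 1
  | succ n => have := q_two a hpos n; have := q_pos a hpos n; linarith

lemma q_up (hpos : ∀ i, 0 < a i) (B : ℕ) (hB : ∀ i, a i ≤ B) (n : ℕ) : cvQ a (n+1) ≤ (B+1) * cvQ a n := by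
  cases n with
  | zero => rw [q1, q0]; have : (a 0 : ℤ) ≤ B := by exact_mod_cast hB 0
            linarith
  | succ n =>
    rw [qs]
    have h1 : (a (n+1) : ℤ) ≤ B := by exact_mod_cast hB (n+1)
    have h2 := q_mono a hpos (Nat.le_succ n)
    have h3 := q_pos a hpos (n+1)
    simp only [Nat.succ_eq_add_one] at h2
    nlinarith

lemma det (n : ℕ) : cvP 0 a (n+1) * cvQ a n - cvP 0 a n * cvQ a (n+1) = (-1)^n := by
  induction n with
  | zero => simp [p0, p1, q0]
  | succ n ih => rw [ps, qs, pow_succ, ← ih]; ring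

lemma e_bound (hpos : ∀ i, 0 < a i) (n j : ℕ) :
    0 ≤ (-1)^n * (cvP 0 a (n+j) * cvQ a n - cvP 0 a n * cvQ a (n+j)) ∧
    (-1)^n * (cvP 0 a (n+j) * cvQ a n - cvP 0 a n * cvQ a (n+j)) * cvQ a (n+1) ≤ cvQ a (n+j) := by
  have hsq : ((-1:ℤ)^n) * (-1)^n = 1 := by rw [← mul_pow]; simp
  refine two_step (P := fun j => 0 ≤ (-1)^n * (cvP 0 a (n+j) * cvQ a n - cvP 0 a n * cvQ a (n+j)) ∧
    (-1)^n * (cvP 0 a (n+j) * cvQ a n - cvP 0 a n * cvQ a (n+j)) * cvQ a (n+1) ≤ cvQ a (n+j)) ?_ ?_ ?_ j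
  · have := q_pos a hpos n
    have e : cvP 0 a (n+0) * cvQ a n - cvP 0 a n * cvQ a (n+0) = 0 := by simp
    rw [e]; simp; linarith
  · rw [det, hsq]; simp
  · intro j h1 h2
    have e : ∀ j, n + (j + 2) = (n + j) + 2 := fun j => by ring
    have e' : ∀ j, n + (j + 1) = (n + j) + 1 := fun j => by ring
    rw [e, ps, qs, ]
    rw [e'] at h2
    have ha : (0:ℤ) ≤ a (n+j+1) := by positivity
    have key : (-1:ℤ)^n * ((a (n+j+1) * cvP 0 a (n+j+1) + cvP 0 a (n+j)) * cvQ a n - cvP 0 a n * (a (n+j+1) * cvQ a (n+j+1) + cvQ a (n+j)))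
      = a (n+j+1) * ((-1)^n * (cvP 0 a (n+j+1) * cvQ a n - cvP 0 a n * cvQ a (n+j+1))) + (-1)^n * (cvP 0 a (n+j) * cvQ a n - cvP 0 a n * cvQ a (n+j)) := by ring
    rw [key]
    obtain ⟨a1, a2⟩ := h1
    obtain ⟨b1, b2⟩ := h2
    constructor
    · exact add_nonneg (mul_nonneg ha b1) a1
    · have := mul_le_mul_of_nonneg_left b2 ha
      rw [add_mul, mul_assoc]
      linarith

lemma approx (hpos : ∀ i, 0 < a i) (θ : ℝ) (hθ : Tendsto (fun n => (cvP 0 a n : ℝ) / (cvQ a n : ℝ)) atTop (𝓝 θ)) (n : ℕ) :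
    |(cvQ a n : ℝ) * θ - cvP 0 a n| ≤ 1 / cvQ a (n+1) := by
  have h1 : Tendsto (fun j => |(cvQ a n : ℝ) * ((cvP 0 a (n+j) : ℝ) / (cvQ a (n+j) : ℝ)) - cvP 0 a n|) atTop (𝓝 (|(cvQ a n : ℝ) * θ - cvP 0 a n|)) := by
    have : Tendsto (fun j => (cvP 0 a (n+j) : ℝ) / (cvQ a (n+j) : ℝ)) atTop (𝓝 θ) := by
      have := hθ.comp (tendsto_add_atTop_nat n)
      refine this.congr (fun j => ?_)
      simp [add_comm]
    exact ((this.const_mul _).sub_const _).abs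
  refine le_of_tendsto h1 (Eventually.of_forall (fun j => ?_))
  obtain ⟨e1, e2⟩ := e_bound a hpos n j
  have hq : (0:ℝ) < cvQ a (n+j) := by exact_mod_cast q_pos a hpos (n+j)
  have hq1 : (0:ℝ) < cvQ a (n+1) := by exact_mod_cast q_pos a hpos (n+1)
  have e3 : |(cvP 0 a (n+j) * cvQ a n - cvP 0 a n * cvQ a (n+j) : ℤ)| * cvQ a (n+1) ≤ cvQ a (n+j) := by
    rw [← abs_of_nonneg e1] at e2
    rw [abs_mul] at e2
    simpa using e2
  have e4 : |((cvP 0 a (n+j) : ℝ) * cvQ a n - cvP 0 a n * cvQ a (n+j))| * cvQ a (n+1) ≤ cvQ a (n+j) := by exact_mod_cast e3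
  have e5 : (cvQ a n : ℝ) * ((cvP 0 a (n+j) : ℝ) / (cvQ a (n+j) : ℝ)) - cvP 0 a n = ((cvP 0 a (n+j) : ℝ) * cvQ a n - cvP 0 a n * cvQ a (n+j)) / cvQ a (n+j) := by
    field_simp
  rw [e5, abs_div, abs_of_pos hq, div_le_div_iff₀ hq hq1]
  linarith

lemma rep (n k : ℕ) (h : ∀ i, i < k → a (n+1+i) = a i) (j : ℕ) (hj : j ≤ k) :
    cvP 0 a (n+1+j) = cvP 0 a n * cvP 0 a j + cvP 0 a (n+1) * cvQ a j ∧
    cvQ a (n+1+j) = cvQ a n * cvP 0 a j + cvQ a (n+1) * cvQ a j := by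
  revert hj
  refine two_step (P := fun j => j ≤ k → (cvP 0 a (n+1+j) = cvP 0 a n * cvP 0 a j + cvP 0 a (n+1) * cvQ a j ∧
    cvQ a (n+1+j) = cvQ a n * cvP 0 a j + cvQ a (n+1) * cvQ a j)) ?_ ?_ ?_ j
  · intro _; simp [p0, q0]
  · intro hk
    have h0 := h 0 (by omega)
    simp only [add_zero] at h0
    have e : n + 1 + 1 = n + 2 := by ring
    rw [e, ps, qs, p1, q1, h0]; constructor <;> ring
  · intro j h1 h2 hk
    have h0 := h (j+1) (by omega)
    have e : n + 1 + (j + 2) = (n + 1 + j) + 2 := by ring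
    have e' : n + 1 + (j + 1) = (n + 1 + j) + 1 := by ring
    obtain ⟨a1, a2⟩ := h1 (by omega)
    obtain ⟨b1, b2⟩ := h2 (by omega)
    rw [e'] at b1 b2 h0
    rw [e, ps a 0 (n+1+j), qs a (n+1+j), a1, a2, b1, b2, ps a 0 j, qs a j, h0]
    constructor <;> ring

lemma p_nonneg (n : ℕ) : 0 ≤ cvP 0 a n := by
  refine two_step (P := fun n => 0 ≤ cvP 0 a n) ?_ ?_ ?_ n
  · simp [p0]
  · simp [p1]
  · intro n h1 h2
    rw [ps]
    positivity

lemma L1_bound (hpos : ∀ i, 0 < a i) (θ : ℝ) (hθ : Tendsto (fun n => (cvP 0 a n : ℝ) / (cvQ a n : ℝ)) atTop (𝓝 θ)) (n k : ℕ)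
    (h : ∀ i, i < k → a (n+1+i) = a i) :
    |(cvQ a n : ℝ) * θ^2 + (cvQ a (n+1) - cvP 0 a n) * θ - cvP 0 a (n+1)| ≤ 2 / (cvQ a (n+1) * (cvQ a k)^2) := by
  obtain ⟨r1, r2⟩ := rep a n k h k le_rfl
  have hA := approx a hpos θ hθ (n+1+k)
  have hk := approx a hpos θ hθ k
  have hn := approx a hpos θ hθ n
  have hqk : (1:ℝ) ≤ cvQ a k := by exact_mod_cast q_pos a hpos k
  have hqn : (1:ℝ) ≤ cvQ a (n+1) := by exact_mod_cast q_pos a hpos (n+1)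
  have hmul : (cvQ a (n+1) : ℝ) * cvQ a k ≤ cvQ a (n+1+k+1) := by
    have h1 := q_mono a hpos (Nat.le_succ (n+1+k))
    have h2 : cvQ a (n+1) * cvQ a k ≤ cvQ a (n+1+k) := by
      rw [r2]
      have := mul_nonneg (zero_le_one.trans (q_pos a hpos n)) (p_nonneg a k)
      linarith
    exact_mod_cast h2.trans h1
  have hk1 : (cvQ a k : ℝ) ≤ cvQ a (k+1) := by exact_mod_cast q_mono a hpos (Nat.le_succ k)
  rw [r1, r2] at hA
  push_cast at hA
  set q' : ℝ := ((cvQ a n : ℤ) : ℝ)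
  set q : ℝ := ((cvQ a (n+1) : ℤ) : ℝ)
  set p' : ℝ := ((cvP 0 a n : ℤ) : ℝ)
  set p : ℝ := ((cvP 0 a (n+1) : ℤ) : ℝ)
  set Q : ℝ := ((cvQ a k : ℤ) : ℝ)
  set P : ℝ := ((cvP 0 a k : ℤ) : ℝ)
  have e1 : Q * (q' * θ^2 + (q - p') * θ - p) = ((q' * P + q * Q) * θ - (p' * P + p * Q)) + (q' * θ - p') * (Q * θ - P) := by ring
  have b1 : |(q' * P + q * Q) * θ - (p' * P + p * Q)| ≤ 1 / (q * Q) :=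
    hA.trans (one_div_le_one_div_of_le (by positivity) hmul)
  have b2 : |(q' * θ - p') * (Q * θ - P)| ≤ 1 / (q * Q) := by
    rw [abs_mul]
    calc _ ≤ (1 / q) * (1 / Q) := mul_le_mul hn (hk.trans (one_div_le_one_div_of_le (by positivity) hk1)) (abs_nonneg _) (by positivity)
      _ = _ := by field_simp
  have b3 : Q * |q' * θ^2 + (q - p') * θ - p| ≤ 2 / (q * Q) := by
    rw [← abs_of_pos (show 0 < Q by linarith), ← abs_mul, abs_of_pos (show 0 < Q by linarith), e1]
    refine (abs_add_le _ _).trans ?_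
    have : 2 / (q * Q) = 1 / (q*Q) + 1/(q*Q) := by ring
    linarith
  have e2 : 2 / (q * Q^2) = (2 / (q * Q)) / Q := by field_simp
  rw [e2, le_div_iff₀ (by linarith)]
  linarith

lemma coprime (n : ℕ) : IsCoprime (cvP 0 a n) (cvQ a n) := by
  have := det a n
  have hsq : ((-1:ℤ)^n) * (-1)^n = 1 := by rw [← mul_pow]; simp
  refine ⟨-((-1)^n * cvQ a (n+1)), (-1)^n * cvP 0 a (n+1), ?_⟩
  calc _ = (-1)^n * (cvP 0 a (n+1) * cvQ a n - cvP 0 a n * cvQ a (n+1)) := by ring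
    _ = 1 := by rw [this, hsq]

lemma q_ge (hpos : ∀ i, 0 < a i) (n : ℕ) : (2:ℤ)^n ≤ 2 * (cvQ a n)^2 := by
  refine two_step (P := fun n => (2:ℤ)^n ≤ 2 * (cvQ a n)^2) ?_ ?_ ?_ n
  · simp [q0]
  · have := q_pos a hpos 1; nlinarith
  · intro n h1 h2
    have h3 := q_two a hpos n
    have h4 := q_mono a hpos (Nat.le_succ n)
    have h5 := q_pos a hpos n
    simp only [Nat.succ_eq_add_one] at h4
    rw [pow_add]
    nlinarith

lemma q_le (hpos : ∀ i, 0 < a i) (B : ℕ) (hB : ∀ i, a i ≤ B) (n : ℕ) : cvQ a n ≤ (B+1)^n := by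
  induction n with
  | zero => simp [q0]
  | succ n ih =>
    have := q_up a hpos B hB n
    rw [pow_succ]
    have hb : (0:ℤ) ≤ (B:ℤ) + 1 := by positivity
    nlinarith

lemma bad (hpos : ∀ i, 0 < a i) (B : ℕ) (hB : ∀ i, a i ≤ B) (θ : ℝ) (hθ : Tendsto (fun n => (cvP 0 a n : ℝ) / (cvQ a n : ℝ)) atTop (𝓝 θ))
    (s t : ℤ) (ht : t ≠ 0) : 1 / (4 * ((B:ℝ) + 1)) ≤ |(t:ℝ)| * |t * θ - s| := by
  classical
  have hex : ∃ n, 2 * |t| < cvQ a n := by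
    obtain ⟨n, hn⟩ := pow_unbounded_of_one_lt (2 * (2 * |t|)^2) (show (1:ℤ) < 2 by norm_num)
    refine ⟨n, ?_⟩
    have h1 := q_ge a hpos n
    have h2 := q_pos a hpos n
    by_contra hc
    push Not at hc
    have : 0 ≤ |t| := abs_nonneg t
    nlinarith
  obtain ⟨n, hn⟩ : ∃ n, Nat.find hex = n := ⟨_, rfl⟩
  have hn1 : 2 * |t| < cvQ a n := hn ▸ Nat.find_spec hex
  have ht1 : 1 ≤ |t| := Int.one_le_abs ht
  cases n with
  | zero => rw [q0] at hn1; linarith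
  | succ n =>
    have hn2 : cvQ a n ≤ 2 * |t| := by
      have := Nat.find_min hex (m := n) (by omega)
      push Not at this; exact this
    have hn3 := q_up a hpos B hB n
    have hne : cvQ a (n+1) * s - cvP 0 a (n+1) * t ≠ 0 := by
      intro h0
      have hd : cvQ a (n+1) ∣ t := by
        have h1 : cvQ a (n+1) ∣ cvP 0 a (n+1) * t := ⟨s, by linarith⟩
        exact (coprime a (n+1)).symm.dvd_of_dvd_mul_left h1
      have := Int.le_of_dvd (by linarith) ((dvd_abs _ _).2 hd)
      linarith
    have h1 : (1:ℝ) ≤ |(cvQ a (n+1) : ℝ) * s - cvP 0 a (n+1) * t| := by exact_mod_cast Int.one_le_abs hne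
    have hq : (0:ℝ) < cvQ a (n+1) := by exact_mod_cast q_pos a hpos (n+1)
    have e : (cvQ a (n+1) : ℝ) * s - cvP 0 a (n+1) * t = t * (cvQ a (n+1) * θ - cvP 0 a (n+1)) - cvQ a (n+1) * (t * θ - s) := by ring
    have hap := approx a hpos θ hθ (n+1)
    have hm : (cvQ a (n+1) : ℝ) ≤ cvQ a (n+1+1) := by exact_mod_cast q_mono a hpos (Nat.le_succ (n+1))
    have hap2 : |(cvQ a (n+1) : ℝ) * θ - cvP 0 a (n+1)| ≤ 1 / cvQ a (n+1) := hap.trans (one_div_le_one_div_of_le hq hm)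
    have ht' : (1:ℝ) ≤ |(t:ℝ)| := by exact_mod_cast ht1
    have hn1' : 2 * |(t:ℝ)| < cvQ a (n+1) := by exact_mod_cast hn1
    have hn4 : (cvQ a (n+1) : ℝ) ≤ (B+1) * (2 * |(t:ℝ)|) := by
      have : cvQ a (n+1) ≤ (B+1) * (2 * |t|) := hn3.trans (mul_le_mul_of_nonneg_left hn2 (by positivity))
      exact_mod_cast this
    have h2 : |(t:ℝ)| * |(cvQ a (n+1) : ℝ) * θ - cvP 0 a (n+1)| ≤ 1/2 := by
      calc _ ≤ |(t:ℝ)| * (1 / cvQ a (n+1)) := by gcongr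
        _ ≤ 1/2 := by rw [mul_one_div, div_le_div_iff₀ hq (by norm_num)]; linarith
    have h3 : 1 ≤ 1/2 + cvQ a (n+1) * |t * θ - s| := by
      rw [e] at h1
      have := abs_sub (t * (cvQ a (n+1) * θ - cvP 0 a (n+1)) : ℝ) (cvQ a (n+1) * (t * θ - s))
      rw [abs_mul, abs_mul, abs_of_pos hq] at this
      linarith
    have h4 : (cvQ a (n+1) : ℝ) * |t * θ - s| ≤ (B+1) * (2 * |(t:ℝ)|) * |t * θ - s| := mul_le_mul_of_nonneg_right hn4 (abs_nonneg _)
    rw [div_le_iff₀ (by positivity)]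
    linarith

end CF

set_option linter.all false

namespace CM
variable {A : Type} (σ : A → List A)

lemma it_zero (W : List A) : iterM σ 0 W = W := rfl
lemma it_succ (n : ℕ) (W : List A) : iterM σ (n+1) W = iterM σ n (W.flatMap σ) := by
  simp [iterM, Function.iterate_succ_apply]
lemma it_succ' (n : ℕ) (W : List A) : iterM σ (n+1) W = (iterM σ n W).flatMap σ := by
  simp [iterM, Function.iterate_succ_apply']
lemma it_add (m n : ℕ) (W : List A) : iterM σ (m+n) W = iterM σ m (iterM σ n W) := by
  simp [iterM, Function.iterate_add_apply]
lemma it_append (n : ℕ) (u v : List A) : iterM σ n (u ++ v) = iterM σ n u ++ iterM σ n v := by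
  induction n generalizing u v with
  | zero => rfl
  | succ n ih => rw [it_succ, it_succ, it_succ, List.flatMap_append, ih]

lemma flat_len (M : ℕ) (hM : ∀ c, (σ c).length ≤ M) (W : List A) : (W.flatMap σ).length ≤ M * W.length := by
  induction W with
  | nil => simp
  | cons c W ih =>
    have := hM c
    simp only [List.flatMap_cons, List.length_append, List.length_cons]
    nlinarith

lemma it_len (M : ℕ) (hM : ∀ c, (σ c).length ≤ M) (n : ℕ) (W : List A) : (iterM σ n W).length ≤ M^n * W.length := by
  induction n with
  | zero => simp [it_zero]
  | succ n ih =>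
    rw [it_succ']
    refine (flat_len σ M hM _).trans ?_
    rw [pow_succ]
    calc M * (iterM σ n W).length ≤ M * (M^n * W.length) := Nat.mul_le_mul_left _ ih
      _ = _ := by ring

theorem morph [Finite A] (l : A) (x : ℕ → A) (hp : Prolongable σ l) (hx : IsFixedPointSeq σ l x)
    (hr : ∀ b : A, (∃ i, x i = b) → ∃ i j : ℕ, i < j ∧ x i = b ∧ x j = b) :
    ∃ (C : ℕ) (N k : ℕ → ℕ), (∀ n i, i < k n → x (N n + i) = x i) ∧ (∀ n, N n ≤ C * k n) ∧ (∀ n, N (n+1) ≤ C * N n) ∧ (∀ n, n + 1 ≤ N n) := by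
  obtain ⟨W, hW, hWn⟩ := hp
  obtain ⟨M, hM⟩ : ∃ M, ∀ c, (σ c).length ≤ M := by
    have := Fintype.ofFinite A
    exact ⟨∑ c, (σ c).length, fun c => Finset.single_le_sum (f := fun c => (σ c).length) (fun _ _ => Nat.zero_le _) (Finset.mem_univ c)⟩
  have hk : ∀ n, n + 1 ≤ (iterM σ n [l]).length := by
    intro n
    induction n with
    | zero => simp [it_zero]
    | succ n ih =>
      have e : iterM σ (n+1) [l] = iterM σ n [l] ++ iterM σ n W := by
        rw [it_succ, ← it_append]; simp [hW]
      rw [e, List.length_append]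
      have := List.length_pos_iff.2 (hWn n)
      omega
  have hx0 : x 0 = l := by
    have := hx 0 0 (by simp [it_zero])
    simp [it_zero] at this
    exact this.symm
  obtain ⟨i, j, hij, -, hj⟩ := hr l ⟨0, hx0⟩
  set w := iterM σ j [l] with hw
  have hjw : j < w.length := by have := hk j; rw [← hw] at this; omega
  have hwj : w[j] = l := by
    have := hx j j hjw
    rw [← hw, List.getElem?_eq_getElem hjw] at this
    rw [Option.some.inj this, hj]
  have hw0 : w[0] = l := by
    have := hx j 0 (by rw [← hw]; omega)
    rw [← hw, List.getElem?_eq_getElem (by omega)] at this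
    rw [Option.some.inj this, hx0]
  have hsplit : w = w.take j ++ ([l] ++ w.drop (j+1)) := by
    conv_lhs => rw [← List.take_append_drop j w]
    rw [List.drop_eq_getElem_cons hjw, hwj]; rfl
  obtain ⟨u', hu'⟩ : ∃ u', w.take j = [l] ++ u' := by
    refine ⟨(w.take j).drop 1, ?_⟩
    have hl : 0 < (w.take j).length := by simp; omega
    conv_lhs => rw [← List.drop_zero (l := w.take j), List.drop_eq_getElem_cons hl]
    simp [hw0]
  have hN1 : ∀ n, (iterM σ n [l]).length ≤ (iterM σ n (w.take j)).length := by
    intro n; rw [hu', it_append, List.length_append]; omega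
  refine ⟨M^j + M, fun n => (iterM σ n (w.take j)).length, fun n => (iterM σ n [l]).length, ?_, ?_, ?_, ?_⟩
  · intro n i hi
    beta_reduce at hi ⊢
    have e : iterM σ (n+j) [l] = iterM σ n (w.take j) ++ (iterM σ n [l] ++ iterM σ n (w.drop (j+1))) := by
      rw [it_add, ← hw]
      conv_lhs => rw [hsplit]
      rw [it_append, it_append]
    have h1 := hx (n+j) ((iterM σ n (w.take j)).length + i) (by rw [e]; simp only [List.length_append]; omega)
    rw [e, List.getElem?_append_right (by omega), Nat.add_sub_cancel_left, List.getElem?_append_left hi, hx n i hi] at h1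
    exact (Option.some.inj h1).symm
  · intro n
    have h1 : (iterM σ n (w.take j)).length ≤ (iterM σ (n+j) [l]).length := by
      rw [it_add, ← hw]
      conv_rhs => rw [hsplit]
      rw [it_append, List.length_append]; omega
    have h2 := it_len σ M hM j (iterM σ n [l])
    rw [← it_add, add_comm] at h2
    rw [add_mul]
    beta_reduce
    omega
  · intro n
    have h1 := flat_len σ M hM (iterM σ n (w.take j))
    rw [← it_succ'] at h1
    beta_reduce
    rw [add_mul]; omega
  · intro n
    exact (hk n).trans (hN1 n)
end CM

set_option linter.all false

namespace CF

theorem rep_data (a : ℕ → ℕ) (hpos : ∀ i, 0 < a i) (θ : ℝ) (hθ : Tendsto (fun n => (cvP 0 a n : ℝ) / (cvQ a n : ℝ)) atTop (𝓝 θ))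
    (B : ℕ) (hB : ∀ i, a i ≤ B) (C : ℕ) (N k : ℕ → ℕ) (hrep : ∀ n i, i < k n → a (N n + i) = a i)
    (h1 : ∀ n, N n ≤ C * k n) (h2 : ∀ n, N (n+1) ≤ C * N n) (h3 : ∀ n, n + 1 ≤ N n) :
    ∃ κ C2 : ℝ, 0 < κ ∧ κ ≤ 1 ∧ 1 ≤ C2 ∧ ∃ m : ℕ → ℕ, ∀ n,
      |(cvQ a (m n) : ℝ) * θ^2 + (cvQ a (m n+1) - cvP 0 a (m n)) * θ - cvP 0 a (m n+1)| ≤ 4 * Real.exp (-(1+κ) * Real.log (cvQ a (m n + 1))) ∧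
      Real.log (cvQ a (m (n+1) + 1)) ≤ C2 * Real.log (cvQ a (m n + 1)) ∧ (n:ℝ) / 4 ≤ Real.log (cvQ a (m n + 1)) := by
  have hB1 : 1 ≤ B := le_trans (hpos 0) (hB 0)
  have hC1 : 1 ≤ C := by
    rcases Nat.eq_zero_or_pos C with h | h
    · have := h1 0; have := h3 0; subst h; omega
    · exact h
  have hl2 : 0 < Real.log 2 := Real.log_pos (by norm_num)
  have hl2' : (1:ℝ)/2 < Real.log 2 := by have := Real.log_two_gt_d9; linarith
  have hLB : Real.log 2 ≤ Real.log (B+1) := by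
    apply Real.log_le_log (by norm_num)
    have : (1:ℝ) ≤ B := by exact_mod_cast hB1
    linarith
  set L := Real.log ((B:ℝ)+1) with hL
  have hLp : 0 < L := by linarith
  have hCr : (1:ℝ) ≤ C := by exact_mod_cast hC1
  have hqp : ∀ n, (0:ℝ) < cvQ a n := fun n => by exact_mod_cast q_pos a hpos n
  have hup : ∀ n, Real.log (cvQ a n) ≤ n * L := by
    intro n
    rw [hL, ← Real.log_pow]
    apply Real.log_le_log (hqp n)
    exact_mod_cast q_le a hpos B hB n
  have hlo : ∀ n : ℕ, ((n:ℝ) - 1) * Real.log 2 ≤ 2 * Real.log (cvQ a n) := by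
    intro n
    have h : (2:ℝ)^n ≤ 2 * (cvQ a n)^2 := by exact_mod_cast q_ge a hpos n
    have := Real.log_le_log (by positivity) h
    rw [Real.log_pow, Real.log_mul (by norm_num) (by have := hqp n; positivity), Real.log_pow] at this
    push_cast at this
    linarith
  refine ⟨Real.log 2 / (C * L), 4 * C * L / Real.log 2, by positivity, ?_, ?_, fun n => N (n+1) - 1, ?_⟩
  · rw [div_le_one (by positivity)]; nlinarith
  · rw [le_div_iff₀ hl2]; nlinarith
  · intro n
    have e : ∀ n, N (n+1) - 1 + 1 = N (n+1) := fun n => by have := h3 (n+1); omega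
    have hNn : (n:ℝ) + 2 ≤ N (n+1) := by have := h3 (n+1); exact_mod_cast (by omega : n + 2 ≤ N (n+1))
    have hnn : (0:ℝ) ≤ n := by positivity
    refine ⟨?_, ?_, ?_⟩
    · have hb := L1_bound a hpos θ hθ (N (n+1) - 1) (k (n+1)) (by rw [e]; exact hrep (n+1))
      refine hb.trans ?_
      rw [e]
      set q : ℝ := ((cvQ a (N (n+1)) : ℤ) : ℝ) with hq
      have hq0 : 0 < q := hqp _
      have hk0 := hqp (k (n+1))
      have hk : (2:ℝ)^(k (n+1)) ≤ 2 * (cvQ a (k (n+1)))^2 := by exact_mod_cast q_ge a hpos _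
      have h4 : Real.exp (Real.log 2 / (C * L) * Real.log q) ≤ 2^(k (n+1)) := by
        rw [← Real.rpow_natCast, Real.rpow_def_of_pos (by norm_num)]
        apply Real.exp_le_exp.2
        have := hup (N (n+1))
        have h5 : (N (n+1) : ℝ) ≤ C * k (n+1) := by exact_mod_cast h1 (n+1)
        rw [div_mul_eq_mul_div, div_le_iff₀ (by positivity)]
        have : Real.log q ≤ C * k (n+1) * L := this.trans (by gcongr)
        nlinarith
      have e2 : Real.exp (-(1 + Real.log 2 / (C * L)) * Real.log q) = 1 / (q * Real.exp (Real.log 2 / (C * L) * Real.log q)) := by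
        rw [show -(1 + Real.log 2 / (C * L)) * Real.log q = - (Real.log q + Real.log 2 / (C * L) * Real.log q) by ring, Real.exp_neg, Real.exp_add, Real.exp_log hq0, one_div]
      rw [e2]
      have hE := Real.exp_pos (Real.log 2 / (C * L) * Real.log q)
      rw [mul_one_div, div_le_div_iff₀ (by positivity) (by positivity)]
      have := h4.trans hk
      nlinarith
    · have ha := hup (N (n+1+1))
      have hb := hlo (N (n+1))
      have hc : (N (n+1+1) : ℝ) ≤ C * N (n+1) := by exact_mod_cast h2 (n+1)
      beta_reduce
      rw [e, e, div_mul_eq_mul_div, le_div_iff₀ hl2]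
      have hd : (N (n+1) : ℝ) * Real.log 2 ≤ 4 * Real.log (cvQ a (N (n+1))) := by nlinarith
      calc _ ≤ (N (n+1+1) : ℝ) * L * Real.log 2 := by gcongr
        _ ≤ (C * N (n+1)) * L * Real.log 2 := by gcongr
        _ = C * L * (N (n+1) * Real.log 2) := by ring
        _ ≤ C * L * (4 * Real.log (cvQ a (N (n+1)))) := by gcongr
        _ = _ := by ring
    · have hb := hlo (N (n+1))
      beta_reduce
      rw [e]
      nlinarith
end CF

set_option linter.all false

namespace DS

def ev (θ : ℝ) (P : Fin 3 → ℤ) : ℝ := P 0 + P 1 * θ + P 2 * θ^2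
def Par (P Q : Fin 3 → ℤ) : Prop := ∀ i j, P i * Q j = P j * Q i
def cr (P Q : Fin 3 → ℤ) : Fin 3 → ℤ := ![P 1 * Q 2 - P 2 * Q 1, P 2 * Q 0 - P 0 * Q 2, P 0 * Q 1 - P 1 * Q 0]

lemma par_symm {P Q : Fin 3 → ℤ} (h : Par P Q) : Par Q P := fun i j => by
  have := h j i; linarith

lemma par_trans {P Q R : Fin 3 → ℤ} (hQ : Q ≠ 0) (h1 : Par P Q) (h2 : Par Q R) : Par P R := by
  obtain ⟨k, hk⟩ := Function.ne_iff.1 hQ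
  simp only [Pi.zero_apply] at hk
  intro i j
  apply mul_left_cancel₀ hk
  have a1 := h1 i k
  have a2 := h1 j k
  have b1 := h2 j k
  have b2 := h2 i k
  calc Q k * (P i * R j) = (P i * Q k) * R j := by ring
    _ = P k * (Q i * R j) := by rw [a1]; ring
    _ = P k * (Q j * R i) := by rw [h2 i j]
    _ = (P j * Q k) * R i := by rw [a2]; ring
    _ = _ := by ring

lemma par_ev (θ : ℝ) {P Q : Fin 3 → ℤ} (h : Par P Q) (j : Fin 3) : (P j : ℝ) * ev θ Q = Q j * ev θ P := by
  have h' : ∀ i, (P j : ℝ) * Q i = P i * Q j := fun i => by exact_mod_cast h j i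
  unfold ev
  have := h' 0; have := h' 1; have := h' 2
  calc _ = (P j : ℝ) * Q 0 + (P j * Q 1) * θ + (P j * Q 2) * θ^2 := by ring
    _ = _ := by rw [h' 0, h' 1, h' 2]; ring

lemma par_ne {P Q : Fin 3 → ℤ} (h : Par P Q) (hQ : Q ≠ 0) (j : Fin 3) (hj : P j ≠ 0) : Q j ≠ 0 := by
  intro h0
  apply hQ
  ext i
  have := h j i
  rw [h0, mul_zero] at this
  simpa [hj] using this

lemma cr_par {P Q : Fin 3 → ℤ} (h : cr P Q = 0) : Par P Q := by
  have h0 := congrFun h 0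
  have h1 := congrFun h 1
  have h2 := congrFun h 2
  simp [cr] at h0 h1 h2
  intro i j
  fin_cases i <;> fin_cases j <;> simp <;> linarith

def Prim (θ : ℝ) (P : Fin 3 → ℤ) : Prop := ∀ Q : Fin 3 → ℤ, Q ≠ 0 → Par P Q → |ev θ P| ≤ |ev θ Q|

lemma exists_prim (θ : ℝ) (P : Fin 3 → ℤ) (hP : P ≠ 0) :
    ∃ Q : Fin 3 → ℤ, Q ≠ 0 ∧ Prim θ Q ∧ (∀ i, |Q i| ≤ |P i|) ∧ |ev θ Q| ≤ |ev θ P| := by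
  classical
  obtain ⟨j, hj⟩ := Function.ne_iff.1 hP
  simp only [Pi.zero_apply] at hj
  have hex : ∃ n : ℕ, ∃ Q : Fin 3 → ℤ, Q ≠ 0 ∧ Par P Q ∧ (Q j).natAbs = n := ⟨_, P, hP, fun i j => by ring, rfl⟩
  obtain ⟨Q, hQ, hPQ, hn⟩ := Nat.find_spec hex
  have hmin : ∀ R : Fin 3 → ℤ, R ≠ 0 → Par P R → |Q j| ≤ |R j| := by
    intro R hR hPR
    have := Nat.find_min' hex ⟨R, hR, hPR, rfl⟩
    rw [← hn] at this
    have h2 : ((Q j).natAbs : ℤ) ≤ (R j).natAbs := by exact_mod_cast this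
    simpa using h2
  have hQj : Q j ≠ 0 := par_ne hPQ hQ j hj
  have hprim : ∀ R : Fin 3 → ℤ, R ≠ 0 → Par P R → |ev θ Q| ≤ |ev θ R| := by
    intro R hR hPR
    have h1 := hmin R hR hPR
    have h2 := par_ev θ (par_trans hP (par_symm hPQ) hPR) j
    have h3 : (0:ℝ) < |(Q j : ℝ)| := by simpa using hQj
    have h4 : |(Q j:ℝ)| ≤ |(R j : ℝ)| := by exact_mod_cast h1
    have h5 : |(Q j : ℝ)| * |ev θ R| = |(R j:ℝ)| * |ev θ Q| := by rw [← abs_mul, ← abs_mul, h2]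
    have := mul_le_mul_of_nonneg_right h4 (abs_nonneg (ev θ Q))
    rw [← h5] at this
    exact le_of_mul_le_mul_left this h3
  refine ⟨Q, hQ, fun R hR hQR => hprim R hR (par_trans hQ hPQ hQR), fun i => ?_, hprim P hP (fun i j => by ring)⟩
  have h1 := hmin P hP (fun i j => by ring)
  have h2 := hPQ j i
  have h3 : |P j| * |Q i| = |P i| * |Q j| := by rw [← abs_mul, ← abs_mul, h2]
  have h4 : 0 < |P j| := abs_pos.2 hj
  have h5 : |P j| * |Q i| ≤ |P j| * |P i| := by
    rw [h3, mul_comm]; exact mul_le_mul_of_nonneg_right h1 (abs_nonneg _)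
  exact le_of_mul_le_mul_left h5 h4

/-- a quadratic with a rational root is not too small at a badly approximable number -/
lemma red (θ c : ℝ) (hc : 0 < c) (hc1 : c ≤ 1) (hbad : ∀ s t : ℤ, t ≠ 0 → c ≤ |(t:ℝ)| * |t * θ - s|)
    (P : Fin 3 → ℤ) (hP : P ≠ 0) (X : ℝ) (hX : 1 ≤ X) (hb : ∀ i, |(P i : ℝ)| ≤ X) (r : ℚ)
    (hr : (P 0 : ℚ) + P 1 * r + P 2 * r^2 = 0) : c^2 / X ≤ |ev θ P| := by
  obtain ⟨a, ha⟩ : ∃ a : ℤ, a = r.num := ⟨_, rfl⟩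
  obtain ⟨b, hb'⟩ : ∃ b : ℤ, b = r.den := ⟨_, rfl⟩
  have hb0 : b ≠ 0 := by rw [hb']; exact_mod_cast r.den_ne_zero
  have hco : IsCoprime b a := by
    rw [ha, hb']
    exact (Rat.isCoprime_num_den r).symm
  have hrab : r = a / b := by rw [ha, hb']; exact_mod_cast (Rat.num_div_den r).symm
  have hbq : (b:ℚ) ≠ 0 := by exact_mod_cast hb0
  have hintg : P 0 * b^2 + P 1 * a * b + P 2 * a^2 = 0 := by
    rw [hrab] at hr
    field_simp at hr
    have : (P 0 : ℚ) * b^2 + P 1 * a * b + P 2 * a^2 = 0 := by linarith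
    exact_mod_cast this
  obtain ⟨e, he⟩ : b ∣ P 2 := by
    have : b ∣ a * (a * P 2) := ⟨-(P 0 * b + P 1 * a), by linarith⟩
    exact hco.dvd_of_dvd_mul_left (hco.dvd_of_dvd_mul_left this)
  have h1 : P 0 * b + P 1 * a + e * a^2 = 0 := by
    apply mul_left_cancel₀ hb0
    rw [he] at hintg; linarith
  obtain ⟨d, hd⟩ : b ∣ P 1 + a * e := by
    have : b ∣ a * (P 1 + a * e) := ⟨-(P 0), by linarith⟩
    exact hco.dvd_of_dvd_mul_left this
  have hP1 : P 1 = b * d - a * e := by linarith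
  have h2 : P 0 = - (a * d) := by
    apply mul_left_cancel₀ hb0
    rw [hP1] at h1; linarith
  have hev : ev θ P = (b * θ - a) * (e * θ - (-d : ℤ)) := by
    unfold ev
    rw [h2, hP1, he]; push_cast; ring
  have hA := hbad a b hb0
  have hbpos : (0:ℝ) < |(b:ℝ)| := by simpa using hb0
  rw [hev, abs_mul]
  by_cases he0 : e = 0
  · subst he0
    have hd0 : d ≠ 0 := by
      rintro rfl
      apply hP; ext i; fin_cases i <;> simp [h2, hP1, he]
    have hd1 : (1:ℝ) ≤ |(d:ℝ)| := by exact_mod_cast Int.one_le_abs hd0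
    have h3 := hb 1
    rw [hP1] at h3
    simp [abs_mul] at h3
    simp only [Int.cast_zero, zero_mul, zero_sub, abs_neg, Int.cast_neg, neg_neg]
    rw [div_le_iff₀ (by linarith)]
    have h4 : c^2 ≤ c := by nlinarith
    have h5 := abs_nonneg ((b:ℝ) * θ - a)
    calc c^2 ≤ |(b:ℝ)| * |b * θ - a| := h4.trans hA
      _ ≤ (|(b:ℝ)| * |(d:ℝ)|) * |b * θ - a| := by gcongr; nlinarith
      _ ≤ X * |b * θ - a| := by gcongr
      _ ≤ (|(d:ℝ)| * |b * θ - a|) * X := by nlinarith [mul_nonneg (mul_nonneg (by linarith : (0:ℝ) ≤ X) h5) (by linarith : 0 ≤ |(d:ℝ)| - 1)]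
      _ = _ := by ring
  · have hB := hbad (-d) e he0
    have h3 := hb 2
    rw [he] at h3
    simp [abs_mul] at h3
    rw [div_le_iff₀ (by linarith)]
    have h5 := abs_nonneg ((b:ℝ) * θ - a)
    have h6 := abs_nonneg ((e:ℝ) * θ - (-d : ℤ))
    calc c^2 = c * c := by ring
      _ ≤ (|(b:ℝ)| * |b * θ - a|) * (|(e:ℝ)| * |e * θ - (-d:ℤ)|) := by gcongr
      _ = (|b * θ - a| * |e * θ - (-d:ℤ)|) * (|(b:ℝ)| * |(e:ℝ)|) := by ring
      _ ≤ _ := by gcongr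


/-- centred minors -/
lemma minor0 (θ : ℝ) (P Q : Fin 3 → ℤ) : (cr P Q 0 : ℝ) * θ - cr P Q 1 = ev θ P * Q 2 - ev θ Q * P 2 := by
  simp [cr, ev]; ring
lemma minor1 (θ : ℝ) (P Q : Fin 3 → ℤ) : (cr P Q 2 : ℝ) - cr P Q 0 * θ^2 = ev θ P * Q 1 - ev θ Q * P 1 := by
  simp [cr, ev]; ring

structure St (θ L0 : ℝ) (s : ℝ × (Fin 3 → ℤ)) : Prop where
  l : L0 ≤ s.1
  ne : s.2 ≠ 0
  b : ∀ i, |(s.2 i : ℝ)| ≤ Real.exp s.1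
  e : |ev θ s.2| ≤ Real.exp (-(29/10) * s.1)
  p : Prim θ s.2

structure Nx (θ : ℝ) (s t : ℝ × (Fin 3 → ℤ)) : Prop where
  l : s.1 + 1/5 ≤ t.1
  e : |ev θ s.2| = 2 * Real.exp (-(29/10) * t.1)
  p : cr s.2 t.2 ≠ 0

lemma next (θ L0 : ℝ) (hnr : ∀ P : Fin 3 → ℤ, P ≠ 0 → ev θ P ≠ 0)
    (H : ∀ L, L0 ≤ L → ∃ P : Fin 3 → ℤ, P ≠ 0 ∧ (∀ i, |(P i : ℝ)| ≤ Real.exp L) ∧ |ev θ P| ≤ Real.exp (-(29/10) * L))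
    (s : ℝ × (Fin 3 → ℤ)) (hs : St θ L0 s) : ∃ t, St θ L0 t ∧ Nx θ s t := by
  have he : 0 < |ev θ s.2| := abs_pos.2 (hnr _ hs.ne)
  set L' := -(10/29) * Real.log (|ev θ s.2| / 2) with hL'
  have h1 : Real.exp (-(29/10) * L') = |ev θ s.2| / 2 := by
    rw [hL', show -(29/10) * (-(10/29) * Real.log (|ev θ s.2| / 2)) = Real.log (|ev θ s.2| / 2) by ring, Real.exp_log (by positivity)]
  have h2 : s.1 + 1/5 ≤ L' := by
    have := hs.e
    have h3 := Real.log_le_log he this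
    rw [Real.log_exp] at h3
    rw [hL', Real.log_div (by positivity) (by norm_num)]
    have := Real.log_two_gt_d9
    linarith
  have hl := hs.l
  obtain ⟨P, hP, hb, hev⟩ := H L' (by linarith)
  obtain ⟨Q, hQ, hpr, hQP, hQe⟩ := exists_prim θ P hP
  refine ⟨(L', Q), ⟨by simp only; linarith, hQ, fun i => ?_, hQe.trans hev, hpr⟩, ⟨h2, by simp only; rw [h1]; ring, fun h0 => ?_⟩⟩
  · refine le_trans ?_ (hb i)
    exact_mod_cast hQP i
  · have h4 := hs.p Q hQ (cr_par h0)
    have h5 := h4.trans (hQe.trans hev)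
    rw [h1] at h5
    linarith

end DS

set_option linter.all false

namespace DS

lemma zb (θ L0 : ℝ) {s t : ℝ × (Fin 3 → ℤ)} (hs : St θ L0 s) (ht : St θ L0 t) (h : Nx θ s t) (i : Fin 3) :
    |ev θ s.2 * t.2 i - ev θ t.2 * s.2 i| ≤ 3 * Real.exp (-(19/10) * t.1) := by
  have hl := h.l
  calc _ ≤ |ev θ s.2 * t.2 i| + |ev θ t.2 * s.2 i| := abs_sub _ _
    _ = |ev θ s.2| * |(t.2 i : ℝ)| + |ev θ t.2| * |(s.2 i : ℝ)| := by rw [abs_mul, abs_mul]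
    _ ≤ (2 * Real.exp (-(29/10) * t.1)) * Real.exp t.1 + Real.exp (-(29/10) * t.1) * Real.exp t.1 := by
      have h1 := h.e.le
      have h2 := ht.b i
      have h3 := ht.e
      have h4 : |(s.2 i : ℝ)| ≤ Real.exp t.1 := (hs.b i).trans (Real.exp_le_exp.2 (by linarith))
      gcongr
    _ = 3 * (Real.exp (-(29/10) * t.1) * Real.exp t.1) := by ring
    _ = _ := by rw [← Real.exp_add]; ring_nf

lemma c0b (θ L0 : ℝ) {s t : ℝ × (Fin 3 → ℤ)} (hs : St θ L0 s) (ht : St θ L0 t) :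
    |(cr s.2 t.2 0 : ℝ)| ≤ 2 * Real.exp (s.1 + t.1) := by
  have e : (cr s.2 t.2 0 : ℝ) = s.2 1 * t.2 2 - s.2 2 * t.2 1 := by simp [cr]
  rw [e]
  refine (abs_sub _ _).trans ?_
  rw [abs_mul, abs_mul, Real.exp_add]
  have h1 := hs.b 1; have h2 := hs.b 2; have h3 := ht.b 1; have h4 := ht.b 2
  calc _ ≤ Real.exp s.1 * Real.exp t.1 + Real.exp s.1 * Real.exp t.1 := by gcongr
    _ = _ := by ring

lemma Rne (θ c L0 : ℝ) (hc : 0 < c) (hc1 : c ≤ 1) (hbad : ∀ s t : ℤ, t ≠ 0 → c ≤ |(t:ℝ)| * |t * θ - s|)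
    (hL : 30 ≤ L0) (hL' : Real.exp (-(19/10) * L0) < c^2)
    {s t : ℝ × (Fin 3 → ℤ)} (hs : St θ L0 s) (h : Nx θ s t) :
    (cr s.2 t.2 1)^2 - cr s.2 t.2 2 * cr s.2 t.2 0 ≠ 0 := by
  intro hR
  have hl := hs.l
  have key : ∀ r : ℚ, (s.2 0 : ℚ) + s.2 1 * r + s.2 2 * r^2 ≠ 0 := by
    intro r hr
    have h1 := red θ c hc hc1 hbad s.2 hs.ne (Real.exp s.1) (Real.one_le_exp (by linarith)) hs.b r hr
    have h2 := h1.trans hs.e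
    rw [div_le_iff₀ (Real.exp_pos _), ← Real.exp_add] at h2
    have h3 : Real.exp (-(29/10) * s.1 + s.1) ≤ Real.exp (-(19/10) * L0) := Real.exp_le_exp.2 (by linarith)
    linarith
  set P := s.2 with hPdef
  set Q := t.2 with hQdef
  have hperp : P 0 * cr P Q 0 + P 1 * cr P Q 1 + P 2 * cr P Q 2 = 0 := by simp [cr]; ring
  by_cases h0 : cr P Q 0 = 0
  · have h1 : cr P Q 1 = 0 := by rw [h0] at hR; simpa using hR
    have h2 : cr P Q 2 ≠ 0 := by
      intro h2; apply h.p
      ext i; fin_cases i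
      · exact h0
      · exact h1
      · exact h2
    have hP2 : P 2 = 0 := by
      have : P 2 * cr P Q 2 = 0 := by
        rw [h0, h1] at hperp; simpa using hperp
      simpa [h2] using this
    by_cases hP1 : P 1 = 0
    · have hP0 : P 0 ≠ 0 := by
        intro hP0; apply hs.ne; ext i; fin_cases i
        · exact hP0
        · exact hP1
        · exact hP2
      have h3 := hs.e
      have h4 : (1:ℝ) ≤ |(P 0 : ℝ)| := by exact_mod_cast Int.one_le_abs hP0
      simp only [ev, ← hPdef, hP1, hP2] at h3
      simp at h3
      have : Real.exp (-(29/10 * s.1)) < 1 := by rw [Real.exp_lt_one_iff]; linarith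
      linarith
    · apply key (-(P 0) / P 1)
      have : (P 1 : ℚ) ≠ 0 := by exact_mod_cast hP1
      rw [hP2]; field_simp; simp
  · apply key (cr P Q 1 / cr P Q 0)
    have h1 : (cr P Q 0 : ℚ) ≠ 0 := by exact_mod_cast h0
    have hR' : (cr P Q 1 : ℚ)^2 - cr P Q 2 * cr P Q 0 = 0 := by exact_mod_cast hR
    have hp' : (P 0 : ℚ) * cr P Q 0 + P 1 * cr P Q 1 + P 2 * cr P Q 2 = 0 := by exact_mod_cast hperp
    field_simp
    linear_combination (cr P Q 0 : ℚ) * hp' + P 2 * hR'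

lemma Xb (θ c L0 : ℝ) (h0 : 0 ≤ θ) (h1 : θ ≤ 1) (hc : 0 < c) (hc1 : c ≤ 1) (hbad : ∀ s t : ℤ, t ≠ 0 → c ≤ |(t:ℝ)| * |t * θ - s|)
    (hL : 30 ≤ L0) (hL' : Real.exp (-(19/10) * L0) < c^2)
    {s t : ℝ × (Fin 3 → ℤ)} (hs : St θ L0 s) (ht : St θ L0 t) (h : Nx θ s t) : 9/10 * t.1 ≤ s.1 + 4 := by
  have hR := Rne θ c L0 hc hc1 hbad hL hL' hs h
  have hA := zb θ L0 hs ht h 2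
  have hB := zb θ L0 hs ht h 1
  rw [← minor0] at hA
  rw [← minor1] at hB
  have hc0 := c0b θ L0 hs ht
  have hR1 : (1:ℝ) ≤ |((cr s.2 t.2 1 : ℝ))^2 - cr s.2 t.2 2 * cr s.2 t.2 0| := by exact_mod_cast Int.one_le_abs hR
  set c0 : ℝ := ((cr s.2 t.2 0 : ℤ) : ℝ)
  set c1 : ℝ := ((cr s.2 t.2 1 : ℤ) : ℝ)
  set c2 : ℝ := ((cr s.2 t.2 2 : ℤ) : ℝ)
  have e : c1^2 - c2 * c0 = (c0 * θ - c1)^2 + (- 2 * θ * (c0 * θ - c1) * c0) + (- (c2 - c0 * θ^2) * c0) := by ring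
  rw [e] at hR1
  have b1 : |(c0 * θ - c1)^2| ≤ (3 * Real.exp (-(19/10) * t.1))^2 := by rw [abs_pow]; gcongr
  have b2 : |- 2 * θ * (c0 * θ - c1) * c0| ≤ 2 * 1 * (3 * Real.exp (-(19/10) * t.1)) * (2 * Real.exp (s.1 + t.1)) := by
    rw [abs_mul, abs_mul, abs_mul, abs_of_nonneg h0, show |(-2:ℝ)| = 2 by norm_num]; gcongr
  have b3 : |- (c2 - c0 * θ^2) * c0| ≤ (3 * Real.exp (-(19/10) * t.1)) * (2 * Real.exp (s.1 + t.1)) := by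
    rw [abs_mul, abs_neg]; gcongr
  have b4 := (abs_add_le _ _).trans (add_le_add ((abs_add_le _ _).trans (add_le_add b1 b2)) b3)
  have b5 := hR1.trans b4
  have hsl := hs.l
  have htl := ht.l
  have e1 : Real.exp (-(19/10) * t.1) * Real.exp (s.1 + t.1) = Real.exp (s.1 - 9/10 * t.1) := by rw [← Real.exp_add]; ring_nf
  have e2 : (Real.exp (-(19/10) * t.1))^2 ≤ Real.exp (s.1 - 9/10 * t.1) := by
    rw [sq, ← Real.exp_add]; apply Real.exp_le_exp.2; linarith
  have b6 : 1 ≤ 27 * Real.exp (s.1 - 9/10 * t.1) := by nlinarith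
  have e3 : (27:ℝ) ≤ Real.exp 4 := by
    have := Real.exp_one_gt_d9
    have e4 : Real.exp 4 = Real.exp 1 ^ 4 := by rw [← Real.exp_nat_mul]; norm_num
    rw [e4]
    calc (27:ℝ) ≤ (2.7)^4 := by norm_num
      _ ≤ _ := by gcongr; linarith
  have b7 : 1 ≤ Real.exp (4 + (s.1 - 9/10 * t.1)) := by
    rw [Real.exp_add]
    have := Real.exp_pos (s.1 - 9/10 * t.1)
    nlinarith
  rw [Real.one_le_exp_iff] at b7
  linarith

lemma det0 (θ c L0 : ℝ) (h0 : 0 ≤ θ) (h1 : θ ≤ 1) (hc : 0 < c) (hc1 : c ≤ 1) (hbad : ∀ s t : ℤ, t ≠ 0 → c ≤ |(t:ℝ)| * |t * θ - s|)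
    (hL : 30 ≤ L0) (hL' : Real.exp (-(19/10) * L0) < c^2)
    {s t u : ℝ × (Fin 3 → ℤ)} (hs : St θ L0 s) (ht : St θ L0 t) (hu : St θ L0 u) (h : Nx θ s t) (h' : Nx θ t u) :
    Par (cr s.2 t.2) (cr t.2 u.2) := by
  have hX := Xb θ c L0 h0 h1 hc hc1 hbad hL hL' ht hu h'
  have hA := zb θ L0 hs ht h 2
  have hB := zb θ L0 hs ht h 1
  rw [← minor0] at hA
  rw [← minor1] at hB
  have hc0 := c0b θ L0 hs ht
  have hD : u.2 0 * cr s.2 t.2 0 + u.2 1 * cr s.2 t.2 1 + u.2 2 * cr s.2 t.2 2 = 0 := by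
    by_contra hne
    have hR1 : (1:ℝ) ≤ |(u.2 0 : ℝ) * cr s.2 t.2 0 + u.2 1 * cr s.2 t.2 1 + u.2 2 * cr s.2 t.2 2| := by exact_mod_cast Int.one_le_abs hne
    set c0 : ℝ := ((cr s.2 t.2 0 : ℤ) : ℝ)
    set c1 : ℝ := ((cr s.2 t.2 1 : ℤ) : ℝ)
    set c2 : ℝ := ((cr s.2 t.2 2 : ℤ) : ℝ)
    have e : (u.2 0 : ℝ) * c0 + u.2 1 * c1 + u.2 2 * c2 = ev θ u.2 * c0 + (-(u.2 1 : ℝ) * (c0 * θ - c1)) + u.2 2 * (c2 - c0 * θ^2) := by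
      simp only [ev]; ring
    rw [e] at hR1
    have g1 := hu.e
    have g2 := hu.b 1
    have g3 := hu.b 2
    have b1 : |ev θ u.2 * c0| ≤ Real.exp (-(29/10) * u.1) * (2 * Real.exp (s.1 + t.1)) := by rw [abs_mul]; gcongr
    have b2 : |-(u.2 1 : ℝ) * (c0 * θ - c1)| ≤ Real.exp u.1 * (3 * Real.exp (-(19/10) * t.1)) := by rw [abs_mul, abs_neg]; gcongr
    have b3 : |(u.2 2 : ℝ) * (c2 - c0 * θ^2)| ≤ Real.exp u.1 * (3 * Real.exp (-(19/10) * t.1)) := by rw [abs_mul]; gcongr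
    have b4 := (abs_add_le _ _).trans (add_le_add ((abs_add_le _ _).trans (add_le_add b1 b2)) b3)
    have b5 := hR1.trans b4
    have l1 := h.l
    have l2 := h'.l
    have l3 := hu.l
    have l4 := hs.l
    have e1 : Real.exp (-(29/10) * u.1) * Real.exp (s.1 + t.1) ≤ Real.exp (-13) := by
      rw [← Real.exp_add]; apply Real.exp_le_exp.2; linarith
    have e2 : Real.exp u.1 * Real.exp (-(19/10) * t.1) ≤ Real.exp (-13) := by
      rw [← Real.exp_add]; apply Real.exp_le_exp.2; linarith
    have e3 : Real.exp (-13) ≤ 1 / 13 := by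
      rw [Real.exp_neg, ← one_div]
      apply one_div_le_one_div_of_le (by norm_num)
      have := Real.add_one_le_exp 13
      linarith
    linarith
  apply cr_par
  ext i
  fin_cases i
  · simp [cr] at hD ⊢; linear_combination (t.2 0) * hD
  · simp [cr] at hD ⊢; linear_combination (t.2 1) * hD
  · simp [cr] at hD ⊢; linear_combination (t.2 2) * hD

theorem ds (θ c : ℝ) (h0 : 0 ≤ θ) (h1 : θ ≤ 1) (hc : 0 < c) (hc1 : c ≤ 1) (hbad : ∀ s t : ℤ, t ≠ 0 → c ≤ |(t:ℝ)| * |t * θ - s|)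
    (hnr : ∀ P : Fin 3 → ℤ, P ≠ 0 → ev θ P ≠ 0) (L1 : ℝ) :
    ∃ L, L1 ≤ L ∧ ∀ P : Fin 3 → ℤ, P ≠ 0 → (∀ i, |(P i : ℝ)| ≤ Real.exp L) → Real.exp (-(29/10) * L) < |ev θ P| := by
  by_contra hcon
  push Not at hcon
  obtain ⟨L0, hL1, hL, hL'⟩ : ∃ L0, L1 ≤ L0 ∧ 30 ≤ L0 ∧ Real.exp (-(19/10) * L0) < c^2 := by
    refine ⟨max (max L1 30) (-(2 * Real.log c)), ?_, ?_, ?_⟩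
    · exact (le_max_left _ _).trans (le_max_left _ _)
    · exact (le_max_right _ _).trans (le_max_left _ _)
    · set M := max (max L1 30) (-(2 * Real.log c))
      have a1 : 30 ≤ M := (le_max_right _ _).trans (le_max_left _ _)
      have a2 : -(2 * Real.log c) ≤ M := le_max_right _ _
      have e : c^2 = Real.exp (2 * Real.log c) := by rw [two_mul, Real.exp_add, Real.exp_log hc, sq]
      rw [e]; apply Real.exp_lt_exp.2; linarith
  have H : ∀ L, L0 ≤ L → ∃ P : Fin 3 → ℤ, P ≠ 0 ∧ (∀ i, |(P i : ℝ)| ≤ Real.exp L) ∧ |ev θ P| ≤ Real.exp (-(29/10) * L) :=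
    fun L hl => hcon L (hL1.trans hl)
  obtain ⟨P0, hP0, hb0, he0⟩ := H L0 le_rfl
  obtain ⟨Q0, hQ0, hpr0, hQP0, hQe0⟩ := exists_prim θ P0 hP0
  have hs0 : St θ L0 (L0, Q0) := ⟨le_rfl, hQ0, fun i => le_trans (by exact_mod_cast hQP0 i) (hb0 i), hQe0.trans he0, hpr0⟩
  have hn : ∀ s : {s // St θ L0 s}, ∃ t : {s // St θ L0 s}, Nx θ s.1 t.1 := fun s => by
    obtain ⟨t, ht, hst⟩ := next θ L0 hnr H s.1 s.2
    exact ⟨⟨t, ht⟩, hst⟩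
  choose f hf using hn
  set S : ℕ → {s // St θ L0 s} := fun k => f^[k] ⟨_, hs0⟩ with hS
  have hSs : ∀ k, Nx θ (S k).1 (S (k+1)).1 := fun k => by
    have : S (k+1) = f (S k) := Function.iterate_succ_apply' f k _
    rw [this]; exact hf _
  have hgrow : ∀ k : ℕ, (k:ℝ) / 5 ≤ (S k).1.1 := by
    intro k
    induction k with
    | zero => have := (S 0).2.l; simp; linarith
    | succ k ih => have := (hSs k).l; push_cast; linarith
  set C : ℕ → Fin 3 → ℤ := fun k => cr (S k).1.2 (S (k+1)).1.2 with hC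
  have hCne : ∀ k, C k ≠ 0 := fun k => (hSs k).p
  have hpar : ∀ k, Par (C 0) (C k) := by
    intro k
    induction k with
    | zero => exact fun i j => by ring
    | succ k ih => exact par_trans (hCne k) ih (det0 θ c L0 h0 h1 hc hc1 hbad hL hL' (S k).2 (S (k+1)).2 (S (k+1+1)).2 (hSs k) (hSs (k+1)))
  obtain ⟨j, hj⟩ := Function.ne_iff.1 (hCne 0)
  simp only [Pi.zero_apply] at hj
  have hCj : ∀ k, (1:ℝ) ≤ |(C k j : ℝ)| := fun k => by exact_mod_cast Int.one_le_abs (par_ne (hpar k) (hCne k) j hj)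
  have hpar' : ∀ k i, (C 0 j : ℝ) * C k i = C k j * C 0 i := fun k i => by
    have := hpar k j i; exact_mod_cast (by linarith : C 0 j * C k i = C k j * C 0 i)
  have hlim : Tendsto (fun k : ℕ => |(C 0 j : ℝ)| * (3 * Real.exp (-(19/10) * (((k + 1 : ℕ):ℝ) / 5)))) atTop (𝓝 0) := by
    have t1 : Tendsto (fun k : ℕ => -(19/10) * (((k + 1 : ℕ):ℝ) / 5)) atTop atBot := by
      have : Tendsto (fun k : ℕ => ((k+1 : ℕ) : ℝ)) atTop atTop := tendsto_natCast_atTop_atTop.comp (tendsto_add_atTop_nat 1)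
      exact (this.atTop_div_const (by norm_num)).const_mul_atTop_of_neg (by norm_num)
    have := ((Real.tendsto_exp_atBot.comp t1).const_mul 3).const_mul (|(C 0 j : ℝ)|)
    simpa using this
  have hzero : ∀ (z : ℕ → ℝ), (∀ k, |z k| ≤ 3 * Real.exp (-(19/10) * (S (k+1)).1.1)) → (∀ k, (C 0 j : ℝ) * z k = C k j * z 0) → z 0 = 0 := by
    intro z hz1 hz2
    have : |z 0| ≤ 0 := by
      refine ge_of_tendsto hlim (Eventually.of_forall fun k => ?_)
      calc |z 0| ≤ |(C k j : ℝ)| * |z 0| := by nlinarith [hCj k, abs_nonneg (z 0)]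
        _ = |(C 0 j : ℝ)| * |z k| := by rw [← abs_mul, ← abs_mul, hz2]
        _ ≤ _ := by
          refine mul_le_mul_of_nonneg_left ((hz1 k).trans ?_) (abs_nonneg _)
          have := hgrow (k+1)
          have : Real.exp (-(19/10) * (S (k+1)).1.1) ≤ Real.exp (-(19/10) * (((k + 1 : ℕ):ℝ) / 5)) := Real.exp_le_exp.2 (by linarith)
          linarith
    exact abs_eq_zero.1 (le_antisymm this (abs_nonneg _))
  have hA := hzero (fun k => (C k 0 : ℝ) * θ - C k 1) (fun k => by
      have := zb θ L0 (S k).2 (S (k+1)).2 (hSs k) 2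
      rw [← minor0] at this; exact this) (fun k => by
      have a1 := hpar' k 0; have a2 := hpar' k 1
      calc _ = (C 0 j : ℝ) * C k 0 * θ - C 0 j * C k 1 := by ring
        _ = _ := by rw [a1, a2]; ring)
  have hB := hzero (fun k => (C k 2 : ℝ) - C k 0 * θ^2) (fun k => by
      have := zb θ L0 (S k).2 (S (k+1)).2 (hSs k) 1
      rw [← minor1] at this; exact this) (fun k => by
      have a1 := hpar' k 0; have a2 := hpar' k 2
      calc _ = (C 0 j : ℝ) * C k 2 - C 0 j * C k 0 * θ^2 := by ring
        _ = _ := by rw [a1, a2]; ring)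
  beta_reduce at hA hB
  have hv : (![-(C 0 1), C 0 0, 0] : Fin 3 → ℤ) = 0 := by
    by_contra hne
    apply hnr _ hne
    simp [ev]; linarith
  have v0 := congrFun hv 0
  have v1 := congrFun hv 1
  simp at v0 v1
  have v2 : C 0 2 = 0 := by
    rw [v1] at hB; simpa using hB
  apply hCne 0
  ext i; fin_cases i
  · exact v1
  · exact v0
  · exact v2
end DS

set_option linter.all false

namespace DS

/-- Minkowski's linear forms theorem in dimension three (strict version). -/
lemma mink (M : Matrix (Fin 3) (Fin 3) ℝ) (hM : M.det ≠ 0) (s : Fin 3 → ℝ) (hs : ∀ i, 0 < s i)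
    (h : |M.det| < s 0 * s 1 * s 2) :
    ∃ v : Fin 3 → ℤ, v ≠ 0 ∧ ∀ i, |M.mulVec (fun j => (v j : ℝ)) i| < s i := by
  classical
  set f : (Fin 3 → ℝ) →ₗ[ℝ] (Fin 3 → ℝ) := Matrix.toLin' M with hf
  set S : Set (Fin 3 → ℝ) := f ⁻¹' (Set.pi Set.univ fun i => Set.Ioo (-(s i)) (s i)) with hS
  have hdet : LinearMap.det f = M.det := LinearMap.det_toLin' M
  have hvol : MeasureTheory.volume S = ENNReal.ofReal (|M.det|⁻¹ * (8 * (s 0 * s 1 * s 2))) := by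
    rw [hS, MeasureTheory.Measure.addHaar_preimage_linearMap _ (by rw [hdet]; exact hM), Real.volume_pi_Ioo, hdet, abs_inv,
      Fin.prod_univ_three, ← ENNReal.ofReal_mul (by have := hs 0; linarith), ← ENNReal.ofReal_mul, ← ENNReal.ofReal_mul (by positivity)]
    · congr 1; ring
    · have := hs 0; have := hs 1
      apply mul_nonneg <;> linarith
  have hfund := ZSpan.isAddFundamentalDomain' (Pi.basisFun ℝ (Fin 3)) MeasureTheory.volume
  have hF : MeasureTheory.volume (ZSpan.fundamentalDomain (Pi.basisFun ℝ (Fin 3))) = 1 := by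
    rw [ZSpan.fundamentalDomain_pi_basisFun, MeasureTheory.volume_pi, MeasureTheory.Measure.pi_pi]; simp
  have hsym : ∀ x ∈ S, -x ∈ S := by
    intro x hx
    simp only [hS, Set.mem_preimage, Set.mem_pi, Set.mem_univ, true_implies, Set.mem_Ioo, map_neg, Pi.neg_apply] at hx ⊢
    intro i; have := hx i; constructor <;> linarith
  have hconv : Convex ℝ S := (convex_pi (fun i _ => convex_Ioo _ _)).linear_preimage f
  have hlt : MeasureTheory.volume (ZSpan.fundamentalDomain (Pi.basisFun ℝ (Fin 3))) * 2 ^ Module.finrank ℝ (Fin 3 → ℝ) < MeasureTheory.volume S := by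
    rw [hF, hvol, one_mul, Module.finrank_fin_fun]
    rw [show (2:ENNReal)^3 = ENNReal.ofReal 8 by rw [show (8:ℝ) = 2^3 by norm_num, ENNReal.ofReal_pow (by norm_num)]; simp]
    apply (ENNReal.ofReal_lt_ofReal_iff_of_nonneg (by norm_num)).2
    have hp : 0 < |M.det| := abs_pos.2 hM
    rw [inv_mul_eq_div, lt_div_iff₀ hp]
    linarith
  have : Countable (Submodule.span ℤ (Set.range (Pi.basisFun ℝ (Fin 3)))).toAddSubgroup := by
    have : Countable (Submodule.span ℤ (Set.range (Pi.basisFun ℝ (Fin 3)))) := inferInstance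
    exact this
  obtain ⟨⟨x, hx⟩, hx0, hxS⟩ := MeasureTheory.exists_ne_zero_mem_lattice_of_measure_mul_two_pow_lt_measure hfund hsym hconv hlt
  have hxm : x ∈ Submodule.span ℤ (Set.range (Pi.basisFun ℝ (Fin 3))) := hx
  rw [Module.Basis.mem_span_iff_repr_mem] at hxm
  choose v hv using hxm
  simp at hv
  have hxv : x = fun j => (v j : ℝ) := funext fun j => (hv j).symm
  refine ⟨v, ?_, ?_⟩
  · rintro rfl
    apply hx0
    apply Subtype.ext
    simp [hxv]; rfl
  · intro i
    simp only [hS, Set.mem_preimage, Set.mem_pi, Set.mem_univ, true_implies, Set.mem_Ioo, hf, Matrix.toLin'_apply] at hxS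
    rw [abs_lt, ← hxv]
    exact hxS i

end DS

set_option linter.all false

namespace DS

def U (η θ : ℝ) (w : Fin 3 → ℤ) : Fin 3 → ℝ := ![η * w 0, w 1 - θ * w 0, w 2 - θ^2 * w 0]
def nsq (u : Fin 3 → ℝ) : ℝ := u 0^2 + u 1^2 + u 2^2
def dt (u v : Fin 3 → ℝ) : ℝ := u 0 * v 0 + u 1 * v 1 + u 2 * v 2
def cx (u v : Fin 3 → ℝ) : Fin 3 → ℝ := ![u 1 * v 2 - u 2 * v 1, u 2 * v 0 - u 0 * v 2, u 0 * v 1 - u 1 * v 0]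

lemma nsq_nonneg (u : Fin 3 → ℝ) : 0 ≤ nsq u := by unfold nsq; positivity

lemma cx_U (η θ : ℝ) (y w : Fin 3 → ℤ) : cx (U η θ y) (U η θ w) = ![ev θ (cr y w), η * cr y w 1, η * cr y w 2] := by
  ext i; fin_cases i
  · simp [cx, U, ev, cr]; ring
  · simp [cx, U, ev, cr]; ring
  · simp [cx, U, ev, cr]; ring

lemma lagr (u v : Fin 3 → ℝ) : nsq (cx u v) ≤ nsq u * nsq v := by
  have : nsq u * nsq v - nsq (cx u v) = (dt u v)^2 := by simp [nsq, cx, dt]; ring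
  nlinarith [sq_nonneg (dt u v)]

lemma dt_cx (u v : Fin 3 → ℝ) : dt u (cx u v) = 0 := by simp [dt, cx]; ring

lemma gram (u n z : Fin 3 → ℝ) (h : dt u n = 0) :
    nsq z * nsq u * nsq n = (dt u z)^2 * nsq n + (dt (cx n u) z)^2 + (dt n z)^2 * nsq u := by
  have : nsq z * nsq u * nsq n - ((dt u z)^2 * nsq n + (dt (cx n u) z)^2 + (dt n z)^2 * nsq u) = dt u n * (nsq z * dt u n - 2 * dt u z * dt n z) := by
    simp [nsq, dt, cx]; ring
  rw [h, zero_mul] at this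
  linarith

lemma nsq_U_pos (η θ : ℝ) (hη : 0 < η) (w : Fin 3 → ℤ) (hw : w ≠ 0) : 0 < nsq (U η θ w) := by
  rcases (nsq_nonneg (U η θ w)).lt_or_eq with h | h
  · exact h
  · exfalso
    have h0 : (η * w 0)^2 = 0 := by
      simp [nsq, U] at h
      nlinarith [sq_nonneg (η * w 0), sq_nonneg ((w 1 : ℝ) - θ * w 0), sq_nonneg ((w 2 : ℝ) - θ^2 * w 0)]
    have h1 : ((w 1 : ℝ) - θ * w 0)^2 = 0 := by
      simp [nsq, U] at h
      nlinarith [sq_nonneg (η * w 0), sq_nonneg ((w 1 : ℝ) - θ * w 0), sq_nonneg ((w 2 : ℝ) - θ^2 * w 0)]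
    have h2 : ((w 2 : ℝ) - θ^2 * w 0)^2 = 0 := by
      simp [nsq, U] at h
      nlinarith [sq_nonneg (η * w 0), sq_nonneg ((w 1 : ℝ) - θ * w 0), sq_nonneg ((w 2 : ℝ) - θ^2 * w 0)]
    have w0 : w 0 = 0 := by simpa [hη.ne'] using h0
    have w1 : w 1 = 0 := by simpa [w0] using h1
    have w2 : w 2 = 0 := by simpa [w0] using h2
    apply hw; ext i; fin_cases i
    · exact w0
    · exact w1
    · exact w2

lemma sq_le_abs {x R : ℝ} (h : x^2 ≤ R) : |x| ≤ R + 1 := by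
  rw [abs_le]; constructor <;> nlinarith [sq_nonneg (x - 1), sq_nonneg (x+1)]

lemma min_ex (η θ : ℝ) (hη : 0 < η) (h0 : 0 ≤ θ) (h1 : θ ≤ 1) (S : (Fin 3 → ℤ) → Prop) (hS : ∃ w, S w) :
    ∃ y, S y ∧ ∀ w, S w → nsq (U η θ y) ≤ nsq (U η θ w) := by
  obtain ⟨w0, hw0⟩ := hS
  set R := nsq (U η θ w0) with hR
  have hRn : 0 ≤ R := nsq_nonneg _
  obtain ⟨K, hK⟩ := exists_int_gt (R + 1 + (R+1)/η)
  have hfin : Set.Finite {w | S w ∧ nsq (U η θ w) ≤ R} := by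
    refine (Set.finite_Icc (fun _ => -K : Fin 3 → ℤ) (fun _ => K)).subset ?_
    rintro w ⟨-, hw⟩
    have b : ∀ i, |(w i : ℝ)| ≤ K := by
      have e : nsq (U η θ w) = (η * w 0)^2 + ((w 1 : ℝ) - θ * w 0)^2 + ((w 2 : ℝ) - θ^2 * w 0)^2 := by simp [nsq, U]
      rw [e] at hw
      have a0 := sq_le_abs (x := η * w 0) (R := R) (by nlinarith [sq_nonneg ((w 1 : ℝ) - θ * w 0), sq_nonneg ((w 2 : ℝ) - θ^2 * w 0)])
      have a1 := sq_le_abs (x := (w 1 : ℝ) - θ * w 0) (R := R) (by nlinarith [sq_nonneg (η * w 0), sq_nonneg ((w 2 : ℝ) - θ^2 * w 0)])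
      have a2 := sq_le_abs (x := (w 2 : ℝ) - θ^2 * w 0) (R := R) (by nlinarith [sq_nonneg (η * w 0), sq_nonneg ((w 1 : ℝ) - θ * w 0)])
      have c0 : |(w 0 : ℝ)| ≤ (R+1)/η := by
        rw [le_div_iff₀ hη]
        rw [abs_mul, abs_of_pos hη] at a0
        linarith
      have hp : 0 ≤ |(w 0 : ℝ)| := abs_nonneg _
      have c1 : |(w 1 : ℝ)| ≤ R + 1 + (R+1)/η := by
        have : (w 1 : ℝ) = (w 1 - θ * w 0) + θ * w 0 := by ring
        rw [this]
        refine (abs_add_le _ _).trans ?_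
        rw [abs_mul, abs_of_nonneg h0]
        nlinarith
      have c2 : |(w 2 : ℝ)| ≤ R + 1 + (R+1)/η := by
        have : (w 2 : ℝ) = (w 2 - θ^2 * w 0) + θ^2 * w 0 := by ring
        rw [this]
        refine (abs_add_le _ _).trans ?_
        rw [abs_mul, abs_of_nonneg (sq_nonneg θ)]
        have : θ^2 ≤ 1 := by nlinarith
        nlinarith
      intro i; fin_cases i
      · simp only [Fin.zero_eta]; linarith
      · simp only [Fin.mk_one]; linarith
      · show |(w 2 : ℝ)| ≤ _
        linarith
    constructor <;> intro i
    · have := (abs_le.1 (b i)).1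
      exact_mod_cast this
    · have := (abs_le.1 (b i)).2
      exact_mod_cast this
  obtain ⟨y, hy, hmin⟩ := Set.exists_min_image _ (fun w => nsq (U η θ w)) hfin ⟨w0, hw0, le_rfl⟩
  refine ⟨y, hy.1, fun w hw => ?_⟩
  by_cases h : nsq (U η θ w) ≤ R
  · exact hmin w ⟨hw, h⟩
  · exact hy.2.trans (not_le.1 h).le

/-- Minkowski for the forms adapted to an orthogonal frame. -/
lemma frame (η θ : ℝ) (hη : 0 < η) (u n : Fin 3 → ℝ) (hun : dt u n = 0) (hu : 0 < nsq u) (hn : 0 < nsq n)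
    (s : Fin 3 → ℝ) (hs : ∀ i, 0 < s i) (h : η * nsq u * nsq n < s 0 * s 1 * s 2) :
    ∃ v : Fin 3 → ℤ, v ≠ 0 ∧ |dt u (U η θ v)| < s 0 ∧ |dt (cx n u) (U η θ v)| < s 1 ∧ |dt n (U η θ v)| < s 2 := by
  set R : Matrix (Fin 3) (Fin 3) ℝ := !![u 0, u 1, u 2; cx n u 0, cx n u 1, cx n u 2; n 0, n 1, n 2] with hR
  set A : Matrix (Fin 3) (Fin 3) ℝ := !![η, 0, 0; -θ, 1, 0; -θ^2, 0, 1] with hA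
  have dA : A.det = η := by simp [hA, Matrix.det_fin_three]
  have dR : R.det = nsq u * nsq n := by
    have : R.det = nsq u * nsq n - (dt u n)^2 := by
      simp [hR, Matrix.det_fin_three, nsq, dt, cx]; ring
    rw [this, hun]; ring
  have dM : (R * A).det = η * nsq u * nsq n := by rw [Matrix.det_mul, dA, dR]; ring
  obtain ⟨v, hv, hb⟩ := mink (R * A) (by rw [dM]; positivity) s hs (by rw [dM, abs_of_pos (by positivity)]; exact h)
  have hAv : A.mulVec (fun j => (v j : ℝ)) = U η θ v := by
    ext i; fin_cases i
    · simp [hA, U, Matrix.mulVec, dotProduct, Fin.sum_univ_three]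
    · simp [hA, U, Matrix.mulVec, dotProduct, Fin.sum_univ_three]; ring
    · simp [hA, U, Matrix.mulVec, dotProduct, Fin.sum_univ_three]; ring
  refine ⟨v, hv, ?_, ?_, ?_⟩
  · have := hb 0
    rw [← Matrix.mulVec_mulVec, hAv] at this
    simpa [hR, Matrix.mulVec, dotProduct, Fin.sum_univ_three, dt] using this
  · have := hb 1
    rw [← Matrix.mulVec_mulVec, hAv] at this
    simpa [hR, Matrix.mulVec, dotProduct, Fin.sum_univ_three, dt] using this
  · have := hb 2
    rw [← Matrix.mulVec_mulVec, hAv] at this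
    simpa [hR, Matrix.mulVec, dotProduct, Fin.sum_univ_three, dt] using this

def D3 (y1 y2 v : Fin 3 → ℤ) : ℤ := cr y1 y2 0 * v 0 + cr y1 y2 1 * v 1 + cr y1 y2 2 * v 2

lemma dt_D3 (η θ : ℝ) (y1 y2 v : Fin 3 → ℤ) : dt (cx (U η θ y1) (U η θ y2)) (U η θ v) = η * D3 y1 y2 v := by
  rw [cx_U]; simp [dt, U, ev, D3]; ring

set_option maxHeartbeats 2000000 in
theorem three (η θ ρ : ℝ) (hη : 0 < η) (h0 : 0 ≤ θ) (h1 : θ ≤ 1) (hρ : 0 < ρ) :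
    (∃ y1 y2 v : Fin 3 → ℤ, D3 y1 y2 v ≠ 0 ∧ nsq (U η θ y1) ≤ ρ^2 ∧ nsq (U η θ y2) ≤ ρ^2 ∧ nsq (U η θ v) ≤ ρ^2) ∨
    ∃ P : Fin 3 → ℤ, P ≠ 0 ∧ |ev θ P| * ρ ≤ 8 * η ∧ |(P 1:ℝ)| * ρ ≤ 8 ∧ |(P 2 : ℝ)| * ρ ≤ 8 := by
  obtain ⟨y1, hy1, hm1⟩ := min_ex η θ hη h0 h1 (fun w => w ≠ 0) ⟨fun _ => 1, fun h => by simpa using congrFun h 0⟩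
  obtain ⟨y2, hy2, hm2⟩ := min_ex η θ hη h0 h1 (fun w => cr y1 w ≠ 0) (by
    by_contra hcon
    push Not at hcon
    apply hy1
    have a1 := hcon ![1, 0, 0]
    have a2 := hcon ![0, 1, 0]
    have b1 := congrFun a1 1
    have b2 := congrFun a1 2
    have b3 := congrFun a2 2
    simp [cr] at b1 b2 b3
    ext i; fin_cases i
    · exact b3
    · exact b2
    · exact b1)
  beta_reduce at hm1 hm2
  have hy2' : y2 ≠ 0 := by
    rintro rfl; apply hy2; ext i; fin_cases i <;> simp [cr]
  set u1 := U η θ y1 with hu1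
  set u2 := U η θ y2 with hu2
  set n := cx u1 u2 with hn
  have p1 : 0 < nsq u1 := nsq_U_pos η θ hη y1 hy1
  have p2 : 0 < nsq u2 := nsq_U_pos η θ hη y2 hy2'
  have p12 : nsq u1 ≤ nsq u2 := hm1 y2 hy2'
  have hnv : n = ![ev θ (cr y1 y2), η * cr y1 y2 1, η * cr y1 y2 2] := cx_U η θ y1 y2
  have hnsq : nsq n = (ev θ (cr y1 y2))^2 + (η * cr y1 y2 1)^2 + (η * cr y1 y2 2)^2 := by rw [hnv]; simp [nsq]
  have pn : 0 < nsq n := by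
    rcases (nsq_nonneg n).lt_or_eq with h | h
    · exact h
    · exfalso
      rw [hnsq] at h
      have g1 := sq_nonneg (ev θ (cr y1 y2))
      have g2 := sq_nonneg (η * (cr y1 y2 1 : ℝ))
      have g3 := sq_nonneg (η * (cr y1 y2 2 : ℝ))
      have k1 : (ev θ (cr y1 y2))^2 = 0 := by linarith
      have k2 : (η * (cr y1 y2 1 : ℝ))^2 = 0 := by linarith
      have k3 : (η * (cr y1 y2 2 : ℝ))^2 = 0 := by linarith
      have c1 : cr y1 y2 1 = 0 := by simpa [hη.ne'] using k2
      have c2 : cr y1 y2 2 = 0 := by simpa [hη.ne'] using k3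
      have c0 : cr y1 y2 0 = 0 := by simpa [ev, c1, c2] using k1
      apply hy2; ext i; fin_cases i
      · exact c0
      · exact c1
      · exact c2
  have hun : dt u1 n = 0 := dt_cx u1 u2
  set N1 := Real.sqrt (nsq u1) with hN1
  set N2 := Real.sqrt (nsq u2) with hN2
  set m := Real.sqrt (nsq n) with hm
  have q1 : 0 < N1 := Real.sqrt_pos.2 p1
  have q2 : 0 < N2 := Real.sqrt_pos.2 p2
  have qn : 0 < m := Real.sqrt_pos.2 pn
  have s1 : N1^2 = nsq u1 := Real.sq_sqrt p1.le
  have s2 : N2^2 = nsq u2 := Real.sq_sqrt p2.le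
  have sn : m^2 = nsq n := Real.sq_sqrt pn.le
  have q12 : N1 ≤ N2 := Real.sqrt_le_sqrt p12
  set ρ' := max ρ N2 with hρ'
  have pr : 0 < ρ' := lt_of_lt_of_le hρ (le_max_left _ _)
  by_cases hvol : 8 * η < N1 * N2 * ρ'
  · left
    obtain ⟨v, hv, f0, f1, f2⟩ := frame η θ hη u1 n hun p1 pn ![N1^2/2, N1 * m * N2 / 2, m * ρ' / 2]
      (by intro i; fin_cases i <;> simp <;> positivity)
      (by
        simp
        rw [← s1, ← sn]
        calc η * N1^2 * m^2 = (8 * η) * (N1^2 * m^2 / 8) := by ring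
          _ < (N1 * N2 * ρ') * (N1^2 * m^2 / 8) := by gcongr
          _ = _ := by ring)
    simp at f0 f1 f2
    set z := U η θ v with hz
    have hg := gram u1 n z hun
    rw [← s1, ← sn] at hg
    have g0 : (dt u1 z)^2 ≤ (N1^2/2)^2 := sq_le_sq' (abs_lt.1 f0).1.le (abs_lt.1 f0).2.le
    have g1 : (dt (cx n u1) z)^2 ≤ (N1 * m * N2 / 2)^2 := sq_le_sq' (abs_lt.1 f1).1.le (abs_lt.1 f1).2.le
    have g2 : (dt n z)^2 ≤ (m * ρ' / 2)^2 := sq_le_sq' (abs_lt.1 f2).1.le (abs_lt.1 f2).2.le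
    have hpos : 0 < N1^2 * m^2 := by positivity
    have hl2 : dt n z = η * D3 y1 y2 v := dt_D3 η θ y1 y2 v
    by_cases hD : D3 y1 y2 v = 0
    · exfalso
      rw [hD] at hl2
      simp at hl2
      rw [hl2] at hg
      by_cases hc : cr y1 v = 0
      · have hl1 : dt (cx n u1) z = 0 := by
          have e1 : dt (cx n u1) z = dt n (cx u1 z) := by simp [dt, cx]; ring
          rw [e1, hu1, hz, cx_U, hc]; simp [dt, ev]
        rw [hl1] at hg
        have k1 := hm1 v hv
        rw [← s1] at k1
        have k2 : nsq z * N1^2 * m^2 ≤ (N1^2/2)^2 * m^2 := by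
          rw [hg]; have := mul_le_mul_of_nonneg_right g0 (sq_nonneg m); linarith
        have k3 : N1^2 * (N1^2 * m^2) ≤ N1^2/4 * (N1^2 * m^2) := by
          calc _ ≤ nsq z * (N1^2 * m^2) := mul_le_mul_of_nonneg_right k1 hpos.le
            _ ≤ _ := by linarith
        have := le_of_mul_le_mul_right k3 hpos
        nlinarith
      · have k1 := hm2 v hc
        rw [← s2] at k1
        have k3 : N2^2 * (N1^2 * m^2) ≤ ((N1^2 + N2^2)/4) * (N1^2 * m^2) := by
          calc _ ≤ nsq z * (N1^2 * m^2) := mul_le_mul_of_nonneg_right k1 hpos.le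
            _ ≤ _ := by
              have := mul_le_mul_of_nonneg_right g0 (sq_nonneg m)
              linarith
        have := le_of_mul_le_mul_right k3 hpos
        nlinarith
    · have hc : cr y1 v ≠ 0 := by
        intro hc
        apply hD
        have e : D3 y1 y2 v = -(cr y1 v 0 * y2 0 + cr y1 v 1 * y2 1 + cr y1 v 2 * y2 2) := by simp [D3, cr]; ring
        rw [e, hc]; simp
      have k3 : nsq z * (N1^2 * m^2) ≤ ((N1^2 + N2^2 + ρ'^2)/4) * (N1^2 * m^2) := by
        have h3 := mul_le_mul_of_nonneg_right g0 (sq_nonneg m)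
        have h4 := mul_le_mul_of_nonneg_right g2 (sq_nonneg N1)
        linarith
      have k4 := le_of_mul_le_mul_right k3 hpos
      have k1 := hm2 v hc
      rw [← s2] at k1
      rcases le_total ρ N2 with h | h
      · exfalso
        have : ρ' = N2 := max_eq_right h
        rw [this] at k4
        nlinarith
      · have : ρ' = ρ := max_eq_left h
        rw [this] at k4
        refine ⟨y1, y2, v, hD, ?_, ?_, ?_⟩
        · rw [← s1]; nlinarith
        · rw [← s2]; nlinarith
        · nlinarith
  · right
    push Not at hvol
    have hmN : m ≤ N1 * N2 := by
      apply Real.sqrt_le_iff.2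
      refine ⟨by positivity, ?_⟩
      rw [mul_pow, s1, s2]; exact lagr u1 u2
    have hmρ : m * ρ ≤ 8 * η := by
      calc m * ρ ≤ (N1 * N2) * ρ' := by gcongr; exact le_max_left _ _
        _ ≤ _ := hvol
    have g1 := sq_nonneg (ev θ (cr y1 y2))
    have g2 := sq_nonneg (η * (cr y1 y2 1 : ℝ))
    have g3 := sq_nonneg (η * (cr y1 y2 2 : ℝ))
    have a0 : |ev θ (cr y1 y2)| ≤ m := abs_le_of_sq_le_sq (by rw [sn, hnsq]; linarith) qn.le
    have a1 : |η * (cr y1 y2 1 : ℝ)| ≤ m := abs_le_of_sq_le_sq (by rw [sn, hnsq]; linarith) qn.le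
    have a2 : |η * (cr y1 y2 2 : ℝ)| ≤ m := abs_le_of_sq_le_sq (by rw [sn, hnsq]; linarith) qn.le
    rw [abs_mul, abs_of_pos hη] at a1 a2
    refine ⟨cr y1 y2, hy2, ?_, ?_, ?_⟩
    · calc _ ≤ m * ρ := by gcongr
        _ ≤ _ := hmρ
    · have : η * (|(cr y1 y2 1 : ℝ)| * ρ) ≤ η * 8 := by
        calc _ = (η * |(cr y1 y2 1 : ℝ)|) * ρ := by ring
          _ ≤ m * ρ := by gcongr
          _ ≤ _ := by linarith
      exact le_of_mul_le_mul_left this hη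
    · have : η * (|(cr y1 y2 2 : ℝ)| * ρ) ≤ η * 8 := by
        calc _ = (η * |(cr y1 y2 2 : ℝ)|) * ρ := by ring
          _ ≤ m * ρ := by gcongr
          _ ≤ _ := by linarith
      exact le_of_mul_le_mul_left this hη

theorem tr (θ L : ℝ) (h0 : 0 ≤ θ) (h1 : θ ≤ 1) (hL0 : 0 ≤ L)
    (hL : ∀ P : Fin 3 → ℤ, P ≠ 0 → (∀ i, |(P i : ℝ)| ≤ Real.exp L) → Real.exp (-(29/10) * L) < |ev θ P|) :
    ∃ w : Fin 3 → Fin 3 → ℤ, D3 (w 0) (w 1) (w 2) ≠ 0 ∧ ∀ s, |(w s 0 : ℝ)| ≤ 48 * Real.exp (29/10 * L) ∧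
      |(w s 1 : ℝ) - θ * w s 0| ≤ 48 * Real.exp (-L) ∧ |(w s 2 : ℝ) - θ^2 * w s 0| ≤ 48 * Real.exp (-L) := by
  set η := Real.exp (-(39/10) * L) with hη
  have pη : 0 < η := Real.exp_pos _
  set ρ := 48 * Real.exp (-L) with hρ
  have pρ : 0 < ρ := by positivity
  have e1 : η * Real.exp (29/10 * L) = Real.exp (-L) := by rw [hη, ← Real.exp_add]; ring_nf
  rcases three η θ ρ pη h0 h1 pρ with ⟨y1, y2, v, hD, b1, b2, b3⟩ | ⟨P, hP, c0, c1, c2⟩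
  · refine ⟨![y1, y2, v], hD, ?_⟩
    have key : ∀ w : Fin 3 → ℤ, nsq (U η θ w) ≤ ρ^2 → |(w 0 : ℝ)| ≤ 48 * Real.exp (29/10 * L) ∧
      |(w 1 : ℝ) - θ * w 0| ≤ ρ ∧ |(w 2 : ℝ) - θ^2 * w 0| ≤ ρ := by
      intro w hw
      have e : nsq (U η θ w) = (η * w 0)^2 + ((w 1 : ℝ) - θ * w 0)^2 + ((w 2 : ℝ) - θ^2 * w 0)^2 := by simp [nsq, U]
      rw [e] at hw
      have g1 := sq_nonneg (η * w 0)
      have g2 := sq_nonneg ((w 1 : ℝ) - θ * w 0)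
      have g3 := sq_nonneg ((w 2 : ℝ) - θ^2 * w 0)
      refine ⟨?_, abs_le_of_sq_le_sq (by linarith) pρ.le, abs_le_of_sq_le_sq (by linarith) pρ.le⟩
      have := abs_le_of_sq_le_sq (a := η * w 0) (b := ρ) (by linarith) pρ.le
      rw [abs_mul, abs_of_pos pη, hρ, ← e1] at this
      apply le_of_mul_le_mul_left _ pη
      linarith
    intro s; fin_cases s
    · exact key y1 b1
    · exact key y2 b2
    · exact key v b3
  · exfalso
    have hE := Real.exp_pos L
    have e2 : Real.exp (-L) * Real.exp L = 1 := by rw [← Real.exp_add]; simp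
    have e3 : η * Real.exp L = Real.exp (-(29/10) * L) := by rw [hη, ← Real.exp_add]; ring_nf
    have tr1 : ∀ x y : ℝ, x * ρ ≤ 8 * y → x ≤ y * Real.exp L / 6 := by
      intro x y hxy
      have := mul_le_mul_of_nonneg_right hxy hE.le
      have e4 : x * ρ * Real.exp L = 48 * x := by rw [hρ]; linear_combination (48 * x) * e2
      rw [e4] at this
      linarith
    have d0 := tr1 _ _ c0
    have d1 := tr1 |(P 1 : ℝ)| 1 (by linarith)
    have d2 := tr1 |(P 2 : ℝ)| 1 (by linarith)
    rw [e3] at d0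
    have hp := Real.exp_pos (-(29/10) * L)
    have hle : Real.exp (-(29/10) * L) ≤ Real.exp L := Real.exp_le_exp.2 (by linarith)
    have hP0 : |(P 0 : ℝ)| ≤ Real.exp L := by
      have e : (P 0 : ℝ) = ev θ P + (-(P 1 * θ)) + (- (P 2 * θ^2)) := by simp only [ev]; ring
      rw [e]
      refine (abs_add_le _ _).trans ?_
      have := abs_add_le (ev θ P) (-(P 1 * θ))
      rw [abs_neg, abs_mul, abs_of_nonneg h0] at this
      rw [abs_neg, abs_mul, abs_of_nonneg (sq_nonneg θ)]
      have t2 : θ^2 ≤ 1 := by nlinarith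
      have k1 := abs_nonneg (P 1 : ℝ)
      have k2 := abs_nonneg (P 2 : ℝ)
      have k3 : |(P 1 : ℝ)| * θ ≤ |(P 1 : ℝ)| := mul_le_of_le_one_right k1 h1
      have k4 : |(P 2 : ℝ)| * θ^2 ≤ |(P 2 : ℝ)| := mul_le_of_le_one_right k2 t2
      linarith
    have := hL P hP (fun i => by
      fin_cases i
      · exact hP0
      · show |(P 1 : ℝ)| ≤ _
        linarith
      · show |(P 2 : ℝ)| ≤ _
        linarith)
    linarith
end DS

set_option linter.all false

namespace DS

lemma li_y (w : Fin 3 → Fin 3 → ℤ) (hw : D3 (w 0) (w 1) (w 2) ≠ 0) (p' p q' q : ℤ) (hd : p * q' - p' * q ≠ 0) :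
    LinearIndependent ℚ (fun (s : Fin 3) (k : Fin 4) => (((![w s 1 * q + w s 2 * q', -(w s 1 * p) - w s 2 * p', w s 0 * q + w s 1 * q', -(w s 0 * p) - w s 1 * p'] : Fin 4 → ℤ) k : ℤ) : ℚ)) := by
  rw [Fintype.linearIndependent_iff]
  intro g hg
  have e0 := congrFun hg 0
  have e1 := congrFun hg 1
  have e2 := congrFun hg 2
  have e3 := congrFun hg 3
  simp [Fin.sum_univ_three] at e0 e1 e2 e3
  have hd' : ((p * q' - p' * q : ℤ) : ℚ) ≠ 0 := by exact_mod_cast hd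
  push_cast at hd'
  have W1 : g 0 * w 0 1 + g 1 * w 1 1 + g 2 * w 2 1 = 0 := by
    apply mul_left_cancel₀ hd'
    linear_combination -(p':ℚ) * e0 - (q':ℚ) * e1
  have W2 : g 0 * w 0 2 + g 1 * w 1 2 + g 2 * w 2 2 = 0 := by
    apply mul_left_cancel₀ hd'
    linear_combination (p:ℚ) * e0 + (q:ℚ) * e1
  have W0 : g 0 * w 0 0 + g 1 * w 1 0 + g 2 * w 2 0 = 0 := by
    apply mul_left_cancel₀ hd'
    linear_combination -(p':ℚ) * e2 - (q':ℚ) * e3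
  have hw' : ((D3 (w 0) (w 1) (w 2) : ℤ) : ℚ) ≠ 0 := by exact_mod_cast hw
  simp [D3, cr] at hw'
  intro i
  apply mul_left_cancel₀ hw'
  fin_cases i
  · simp only [Fin.zero_eta, Fin.isValue]
    linear_combination ((w 1 1 : ℚ) * w 2 2 - w 1 2 * w 2 1) * W0 + ((w 1 2 : ℚ) * w 2 0 - w 1 0 * w 2 2) * W1 + ((w 1 0 : ℚ) * w 2 1 - w 1 1 * w 2 0) * W2
  · simp only [Fin.mk_one, Fin.isValue]
    linear_combination ((w 2 1 : ℚ) * w 0 2 - w 2 2 * w 0 1) * W0 + ((w 2 2 : ℚ) * w 0 0 - w 2 0 * w 0 2) * W1 + ((w 2 0 : ℚ) * w 0 1 - w 2 1 * w 0 0) * W2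
  · simp only [Fin.reduceFinMk, Fin.isValue]
    linear_combination ((w 0 1 : ℚ) * w 1 2 - w 0 2 * w 1 1) * W0 + ((w 0 2 : ℚ) * w 1 0 - w 0 0 * w 1 2) * W1 + ((w 0 0 : ℚ) * w 1 1 - w 0 1 * w 1 0) * W2

/-- Size estimates for the linear forms. -/
lemma lf_bd (θ w0 w1 w2 p' p q' q E E3 B1 : ℝ) (h0 : 0 ≤ θ) (h1 : θ ≤ 1) (hE : 0 < E) (hE1 : E ≤ E3) (hB : 1 ≤ B1)
    (hw0 : |w0| ≤ 48 * E3) (hw1 : |w1 - θ * w0| ≤ 48 * E) (hw2 : |w2 - θ^2 * w0| ≤ 48 * E)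
    (hq' : 0 < q') (hqq : q' ≤ q) (hq : q ≤ B1 * q') (ha' : |q' * θ - p'| ≤ 1 / q) (ha : |q * θ - p| ≤ 1 / q)
    (hL : E3 * |q' * θ^2 + (q - p') * θ - p| ≤ 4 * E / q) :
    |(w1 * q + w2 * q') - θ * (w0 * q + w1 * q')| ≤ 240 * B1 * (q' * E) ∧
    |(-(w1 * p) - w2 * p') + θ * (w1 * q + w2 * q') - θ * (-(w0 * p) - w1 * p') - θ^2 * (w0 * q + w1 * q')| ≤ 240 * B1 * (E / q') ∧
    |w0 * q + w1 * q'| ≤ 240 * B1 * (q' * E3) ∧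
    |θ * (w0 * q + w1 * q') + (-(w0 * p) - w1 * p')| ≤ 240 * B1 * (E / q') := by
  have hw3 : |w2 - θ * w1| ≤ 96 * E := by
    have e : w2 - θ * w1 = (w2 - θ^2 * w0) - θ * (w1 - θ * w0) := by ring
    rw [e]
    refine (abs_sub _ _).trans ?_
    rw [abs_mul, abs_of_nonneg h0]
    nlinarith [abs_nonneg (w1 - θ * w0)]
  have hw4 : |w1| ≤ 96 * E3 := by
    have e : w1 = (w1 - θ * w0) + θ * w0 := by ring
    rw [e]
    refine (abs_add_le _ _).trans ?_
    rw [abs_mul, abs_of_nonneg h0]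
    nlinarith [abs_nonneg w0]
  have hqp : 0 < q := by linarith
  have hinv : 1 / q ≤ 1 / q' := one_div_le_one_div_of_le hq' hqq
  have hqi : 0 < 1 / q' := by positivity
  have hB1 : E / q' ≤ B1 * (E / q') := le_mul_of_one_le_left (by positivity) hB
  have hE3 : 0 < E3 := by linarith
  refine ⟨?_, ?_, ?_, ?_⟩
  · have e : (w1 * q + w2 * q') - θ * (w0 * q + w1 * q') = (w1 - θ * w0) * q + (w2 - θ * w1) * q' := by ring
    rw [e]
    refine (abs_add_le _ _).trans ?_
    rw [abs_mul, abs_mul, abs_of_pos hqp, abs_of_pos hq']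
    have i1 : |w1 - θ * w0| * q ≤ (48 * E) * (B1 * q') := by gcongr
    have i2 : |w2 - θ * w1| * q' ≤ (96 * E) * (B1 * q') := by
      gcongr
      exact le_mul_of_one_le_left hq'.le hB
    have : 0 < E * (B1 * q') := by positivity
    nlinarith
  · have e : (-(w1 * p) - w2 * p') + θ * (w1 * q + w2 * q') - θ * (-(w0 * p) - w1 * p') - θ^2 * (w0 * q + w1 * q') = (w1 - θ * w0) * (q * θ - p) + (w2 - θ * w1) * (q' * θ - p') := by ring
    rw [e]
    refine (abs_add_le _ _).trans ?_
    rw [abs_mul, abs_mul]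
    have i1 : |w1 - θ * w0| * |q * θ - p| ≤ (48 * E) * (1 / q') := by
      gcongr; linarith
    have i2 : |w2 - θ * w1| * |q' * θ - p'| ≤ (96 * E) * (1 / q') := by
      gcongr; linarith
    have e2 : E * (1 / q') = E / q' := by ring
    have : 0 < E / q' := by positivity
    nlinarith
  · refine (abs_add_le _ _).trans ?_
    rw [abs_mul, abs_mul, abs_of_pos hqp, abs_of_pos hq']
    have i1 : |w0| * q ≤ (48 * E3) * (B1 * q') := by gcongr
    have i2 : |w1| * q' ≤ (96 * E3) * (B1 * q') := by
      gcongr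
      exact le_mul_of_one_le_left hq'.le hB
    have : 0 < E3 * (B1 * q') := by positivity
    nlinarith
  · have e : θ * (w0 * q + w1 * q') + (-(w0 * p) - w1 * p') = w0 * (q' * θ^2 + (q - p') * θ - p) + (w1 - θ * w0) * (q' * θ - p') := by ring
    rw [e]
    refine (abs_add_le _ _).trans ?_
    rw [abs_mul, abs_mul]
    have i1 : |w0| * |q' * θ^2 + (q - p') * θ - p| ≤ 48 * (4 * E / q) := by
      calc _ ≤ (48 * E3) * |q' * θ^2 + (q - p') * θ - p| := by gcongr
        _ = 48 * (E3 * |q' * θ^2 + (q - p') * θ - p|) := by ring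
        _ ≤ _ := by gcongr
    have i2 : |w1 - θ * w0| * |q' * θ - p'| ≤ (48 * E) * (1 / q') := by
      gcongr; linarith
    have i3 : E / q ≤ E / q' := by gcongr
    have e2 : E * (1 / q') = E / q' := by ring
    have e3 : 4 * E / q = 4 * (E / q) := by ring
    have : 0 < E / q' := by positivity
    nlinarith

end DS

set_option linter.all false

namespace CF

lemma hnr_of_deg (α : ℝ) (hdeg : 3 ≤ (minpoly ℚ α).natDegree) (a0 : ℤ) (P : Fin 3 → ℤ) (hP : P ≠ 0) :
    DS.ev (α - a0) P ≠ 0 := by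
  intro h
  let X : Polynomial ℚ := Polynomial.X
  let R : Polynomial ℚ := Polynomial.C (P 0 : ℚ) + Polynomial.C (P 1 : ℚ) * (Polynomial.X - Polynomial.C (a0 : ℚ)) + Polynomial.C (P 2 : ℚ) * (Polynomial.X - Polynomial.C (a0 : ℚ))^2
  have hR : Polynomial.aeval α R = 0 := by
    simp only [R, map_add, map_mul, map_sub, map_pow, Polynomial.aeval_X, Polynomial.aeval_C]
    simp only [DS.ev] at h
    simpa using h
  have hRd : R.natDegree ≤ 2 := by
    simp only [R]
    compute_degree
  have hR0 : R = 0 := by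
    by_contra hne
    have := minpoly.degree_le_of_ne_zero ℚ α hne hR
    have := Polynomial.natDegree_le_natDegree this
    omega
  have e0 : R.eval (a0 : ℚ) = 0 := by rw [hR0]; simp
  have e1 : R.eval ((a0 : ℚ) + 1) = 0 := by rw [hR0]; simp
  have e2 : R.eval ((a0 : ℚ) - 1) = 0 := by rw [hR0]; simp
  simp [R] at e0 e1 e2
  apply hP
  have f1 : (P 1 : ℚ) = 0 := by rw [e0] at e1 e2; push_cast at e1 e2; linarith
  have f2 : (P 2 : ℚ) = 0 := by rw [e0] at e1 e2; push_cast at e1 e2; linarith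
  ext i
  fin_cases i
  · simpa using e0
  · simpa using f1
  · simpa using f2

theorem core (a : ℕ → ℕ) (hpos : ∀ i, 0 < a i) (θ : ℝ) (hθ : Tendsto (fun n => (cvP 0 a n : ℝ) / (cvQ a n : ℝ)) atTop (𝓝 θ))
    (halg : IsAlgebraic ℚ θ) (hnr : ∀ P : Fin 3 → ℤ, P ≠ 0 → DS.ev θ P ≠ 0)
    (B : ℕ) (hB : ∀ i, a i ≤ B) (C : ℕ) (N k : ℕ → ℕ) (hrep : ∀ n i, i < k n → a (N n + i) = a i)
    (h1 : ∀ n, N n ≤ C * k n) (h2 : ∀ n, N (n+1) ≤ C * N n) (h3 : ∀ n, n + 1 ≤ N n) : False := by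
  obtain ⟨κ, C2, hκ, hκ1, hC2, m, hm⟩ := rep_data a hpos θ hθ B hB C N k hrep h1 h2 h3
  have hqR : ∀ n, (1:ℝ) ≤ cvQ a n := fun n => by exact_mod_cast q_pos a hpos n
  have t0 : 0 ≤ θ := by
    refine ge_of_tendsto' hθ fun n => ?_
    have : (0:ℝ) ≤ cvP 0 a n := by exact_mod_cast p_nonneg a n
    have := hqR n
    positivity
  have t1 : θ ≤ 1 := by
    have h := approx a hpos θ hθ 0
    rw [q0, p0] at h
    have h' : (1:ℝ) / cvQ a (0+1) ≤ 1 := by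
      rw [div_le_one (by linarith [hqR (0+1)])]; exact hqR _
    have := le_abs_self ((((1:ℤ):ℝ)) * θ - ((0:ℤ):ℝ))
    push_cast at this h
    linarith
  have hB1 : (1:ℝ) ≤ (B:ℝ) + 1 := by have : (0:ℝ) ≤ B := Nat.cast_nonneg _; linarith
  have hlB : 0 ≤ Real.log ((B:ℝ)+1) := Real.log_nonneg hB1
  have hc1' : κ / (39/10 * C2) ≤ 1 := by
    rw [div_le_one (by positivity)]; linarith
  refine RothAux.sub_contra θ halg t0 t1 (κ / (39/10 * C2)) (by positivity) hc1' (240 * ((B:ℝ)+1)) (by linarith) ?_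
  intro T
  obtain ⟨L, hL1, hL⟩ := DS.ds θ (1/(4*((B:ℝ)+1))) t0 t1 (by positivity)
    (by rw [div_le_one (by positivity)]; linarith) (fun s t ht => bad a hpos B hB θ hθ s t ht) hnr
    (1 + |T| + Real.log ((B:ℝ)+1) + |Real.log (cvQ a (m 0 + 1))|)
  have hT := le_abs_self T
  have hT' := abs_nonneg T
  have hH0 := le_abs_self (Real.log (cvQ a (m 0 + 1)))
  have hH0' := abs_nonneg (Real.log (cvQ a (m 0 + 1)))
  have hLp : 1 ≤ L := by linarith
  obtain ⟨w, hw, hws⟩ := DS.tr θ L t0 t1 (by linarith) hL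
  have hex : ∃ n, 39/10 * L ≤ κ * Real.log (cvQ a (m n + 1)) := by
    obtain ⟨n, hn⟩ := exists_nat_ge (39/10 * L * 4 / κ)
    refine ⟨n, ?_⟩
    have := (hm n).2.2
    rw [div_le_iff₀ hκ] at hn
    nlinarith
  classical
  obtain ⟨j, hj, hjm⟩ : ∃ j, 39/10 * L ≤ κ * Real.log (cvQ a (m j + 1)) ∧ ∀ i < j, ¬ (39/10 * L ≤ κ * Real.log (cvQ a (m i + 1))) :=
    ⟨Nat.find hex, Nat.find_spec hex, fun i hi => Nat.find_min hex hi⟩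
  have hup : κ * Real.log (cvQ a (m j + 1)) ≤ 39/10 * C2 * L := by
    cases j with
    | zero =>
      exfalso
      nlinarith
    | succ i =>
      have u1 := hjm i (Nat.lt_succ_self i)
      have u2 := (hm i).2.1
      push Not at u1
      calc κ * Real.log (cvQ a (m (i+1) + 1)) ≤ κ * (C2 * Real.log (cvQ a (m i + 1))) := by gcongr
        _ = C2 * (κ * Real.log (cvQ a (m i + 1))) := by ring
        _ ≤ C2 * (39/10 * L) := by gcongr
        _ = _ := by ring
  have hL1j := (hm j).1
  generalize hn : m j = n at hL1j hj hup
  have Q' := hqR n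
  have Q := hqR (n+1)
  have hqq : (cvQ a n : ℝ) ≤ cvQ a (n+1) := by exact_mod_cast q_mono a hpos (Nat.le_succ n)
  have hqu : (cvQ a (n+1) : ℝ) ≤ ((B:ℝ)+1) * cvQ a n := by exact_mod_cast q_up a hpos B hB n
  have hlog1 : Real.log (cvQ a n) ≤ Real.log (cvQ a (n+1)) := Real.log_le_log (by linarith) hqq
  have hlog2 : Real.log (cvQ a (n+1)) ≤ Real.log ((B:ℝ)+1) + Real.log (cvQ a n) := by
    rw [← Real.log_mul (by positivity) (by positivity)]
    exact Real.log_le_log (by linarith) hqu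
  have hlogq : 39/10 * L ≤ Real.log (cvQ a (n+1)) := by
    have : 0 ≤ Real.log (cvQ a (n+1)) := Real.log_nonneg Q
    nlinarith
  have hLb : L ≤ Real.log (cvQ a n) := by linarith
  have hbpos : 0 < Real.log (cvQ a n) := by linarith
  have hxb : L / Real.log (cvQ a n) * Real.log (cvQ a n) = L := div_mul_cancel₀ _ hbpos.ne'
  refine ⟨cvP 0 a n, cvQ a n, cvP 0 a (n+1), cvQ a (n+1), L / Real.log (cvQ a n),
    fun s => ![w s 1 * cvQ a (n+1) + w s 2 * cvQ a n, -(w s 1 * cvP 0 a (n+1)) - w s 2 * cvP 0 a n,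
      w s 0 * cvQ a (n+1) + w s 1 * cvQ a n, -(w s 0 * cvP 0 a (n+1)) - w s 1 * cvP 0 a n],
    by linarith, q_pos a hpos n, coprime a n, ?_, ?_, ?_, ?_, ?_⟩
  · rw [div_le_div_iff₀ (by positivity) hbpos]
    have : κ * Real.log (cvQ a n) ≤ κ * Real.log (cvQ a (n+1)) := by gcongr
    linarith
  · rw [div_le_one hbpos]; exact hLb
  · apply DS.li_y w hw
    rw [det]
    exact pow_ne_zero _ (by norm_num)
  · intro s
    simp
    ring
  · intro s
    obtain ⟨b0, b1, b2⟩ := hws s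
    have hexpb : Real.exp (Real.log (cvQ a n)) = cvQ a n := Real.exp_log (by linarith)
    have hexpq : Real.exp (Real.log (cvQ a (n+1))) = cvQ a (n+1) := Real.exp_log (by linarith)
    have key := DS.lf_bd θ (w s 0) (w s 1) (w s 2) (cvP 0 a n) (cvP 0 a (n+1)) (cvQ a n) (cvQ a (n+1))
      (Real.exp (-L)) (Real.exp (29/10 * L)) ((B:ℝ)+1) t0 t1 (Real.exp_pos _)
      (Real.exp_le_exp.2 (by linarith)) hB1 b0 b1 b2 (by linarith) hqq hqu
      (approx a hpos θ hθ n)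
      ((approx a hpos θ hθ (n+1)).trans (one_div_le_one_div_of_le (by linarith) (by exact_mod_cast q_mono a hpos (Nat.le_succ (n+1)))))
      (by
        calc _ ≤ Real.exp (29/10 * L) * (4 * Real.exp (-(1+κ) * Real.log (cvQ a (n+1)))) := by gcongr
          _ = 4 * Real.exp (29/10 * L + -(1+κ) * Real.log (cvQ a (n+1))) := by rw [Real.exp_add]; ring
          _ ≤ 4 * Real.exp (-L - Real.log (cvQ a (n+1))) := by
            gcongr
            linarith
          _ = _ := by rw [Real.exp_sub, hexpq]; ring)
    obtain ⟨k0, k1, k2, k3⟩ := key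
    intro l
    fin_cases l
    · have e : Real.exp ((1 - L / Real.log (cvQ a n)) * Real.log (cvQ a n)) = cvQ a n * Real.exp (-L) := by
        rw [sub_mul, hxb, one_mul, sub_eq_add_neg, Real.exp_add, hexpb]
      simp [RothAux.LF]
      rw [e]
      exact k0
    · have e : Real.exp ((-1 - L / Real.log (cvQ a n)) * Real.log (cvQ a n)) = Real.exp (-L) / cvQ a n := by
        rw [sub_mul, hxb, neg_one_mul, sub_eq_add_neg, add_comm, ← sub_eq_add_neg, Real.exp_sub, hexpb]
      simp [RothAux.LF]
      rw [e]
      exact k1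
    · have e : Real.exp ((1 + 29/10 * (L / Real.log (cvQ a n))) * Real.log (cvQ a n)) = cvQ a n * Real.exp (29/10 * L) := by
        rw [add_mul, mul_assoc, hxb, one_mul, Real.exp_add, hexpb]
      simp [RothAux.LF]
      rw [e]
      exact k2
    · have e : Real.exp ((-1 - L / Real.log (cvQ a n)) * Real.log (cvQ a n)) = Real.exp (-L) / cvQ a n := by
        rw [sub_mul, hxb, neg_one_mul, sub_eq_add_neg, add_comm, ← sub_eq_add_neg, Real.exp_sub, hexpb]
      simp [RothAux.LF]
      rw [e]
      exact k3

end CF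

/-- Theorem 3: the continued fraction expansion of an algebraic number of degree
at least three cannot be generated by a recurrent morphism.  Here `a0` and
`(a i)` are the partial quotients of `α`, i.e. `α = [a_0; a_1, a_2, …]`. -/
theorem statement4 (α : ℝ) (halg : IsAlgebraic ℚ α) (hdeg : 3 ≤ (minpoly ℚ α).natDegree)
    (a0 : ℤ) (a : ℕ → ℕ) (hpos : ∀ i, 0 < a i)
    (hα : Tendsto (fun ℓ => (cvP a0 a ℓ : ℝ) / (cvQ a ℓ : ℝ)) atTop (𝓝 α)) :
    ¬ ∃ (A : Type) (_ : Finite A) (σ : A → List A) (l : A) (x : ℕ → A) (φ : A → ℕ),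
        Prolongable σ l ∧ IsFixedPointSeq σ l x ∧
        (∀ b : A, (∃ i, x i = b) → ∃ i j : ℕ, i < j ∧ x i = b ∧ x j = b) ∧
        (∀ i, a i = φ (x i)) := by
  rintro ⟨A, hA, σ, l, x, φ, hp, hx, hr, hax⟩
  obtain ⟨C, N, k, hk, h1, h2, h3⟩ := CM.morph σ l x hp hx hr
  obtain ⟨B, hB⟩ : ∃ B : ℕ, ∀ b, φ b ≤ B := by
    obtain ⟨B, hB⟩ := (Set.finite_range φ).bddAbove
    exact ⟨B, fun b => hB ⟨b, rfl⟩⟩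
  refine CF.core a hpos (α - a0) ?_ ?_ (CF.hnr_of_deg α hdeg a0) B (fun i => by rw [hax]; exact hB _) C N k
    (fun n i hi => by rw [hax, hax, hk n i hi]) h1 h2 h3
  · have : (fun n => (cvP 0 a n : ℝ) / (cvQ a n : ℝ)) = fun n => (cvP a0 a n : ℝ) / (cvQ a n : ℝ) - a0 := by
      funext n
      have : (cvQ a n : ℝ) ≠ 0 := by
        have := CF.q_pos a hpos n
        exact_mod_cast (by omega : cvQ a n ≠ 0)
      rw [CF.cvP_shift a a0 n]
      push_cast
      field_simp
      ring
    rw [this]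
    exact hα.sub_const _
  · refine halg.sub ?_
    have := isAlgebraic_algebraMap (R := ℚ) (A := ℝ) (a0 : ℚ)
    simpa using this
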